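/- Suppose s ≥ 3, c is a nonzero integer, and 𝒞*(x₂,…,x_s) is an integral cubic form not of the shape a(b₂x₂+⋯+b_sx_s)³ for rationals a, b₂,…,b_s. Let 𝒫(x) = c·x₁⁴ + 𝒞*(x₂,…,x_s), and for P ≥ 2 set Q = P^{3/4} and N_𝒫(P) = Σ μ(|𝒫(x)|)² over integers x₁ with |x₁| ≤ Q and integers x₂,…,x_s with |x_j| ≤ P. Then N_𝒫(P) = 2^s·Q·P^{s−1}·𝔖_𝒫 + E₄ where |E₄| ≤ C·Q·P^{s−1}/((log P)·(log log P)) for P ≥ 3 and a constant C depending only on 𝒫; here 𝔖_𝒫 = ∏_p (1 − ρ_𝒫(p²)/p^{2s}). -/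

import Mathlib

namespace SquarefreeDensity

/-- The number of coincidences between two maps, sorted by the common value. -/
theorem card_coincidence_eq_sum {α β γ : Type*} [DecidableEq γ] (s : Finset α) (t : Finset β)
    (f : α → γ) (g : β → γ) (U : Finset γ) (hU : ∀ a ∈ s, f a ∈ U) :
    ((s ×ˢ t).filter fun z => f z.1 = g z.2).card =
      ∑ c ∈ U, (s.filter fun a => f a = c).card * (t.filter fun b => g b = c).card := by
  classical
  rw [Finset.card_eq_sum_card_fiberwise (f := fun z => f z.1) (t := U)]
  · refine Finset.sum_congr rfl fun c _ => ?_
    rw [← Finset.card_product]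
    congr 1
    ext ⟨a, b⟩
    simp only [Finset.mem_filter, Finset.mem_product]
    constructor
    · rintro ⟨⟨⟨ha, hb⟩, h⟩, h'⟩
      exact ⟨⟨ha, h'⟩, hb, h ▸ h'⟩
    · rintro ⟨⟨ha, h'⟩, hb, h⟩
      exact ⟨⟨⟨ha, hb⟩, h'.trans h.symm⟩, h'⟩
  · intro z hz
    exact hU _ (Finset.mem_product.1 (Finset.mem_filter.1 hz).1).1

/-- Cauchy--Schwarz for the number of coincidences between two maps into the same type. -/
theorem card_coincidence_sq_le {α β γ : Type*} [DecidableEq γ] (s : Finset α) (t : Finset β)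
    (f : α → γ) (g : β → γ) :
    (((s ×ˢ t).filter fun z => f z.1 = g z.2).card) ^ 2 ≤
      ((s ×ˢ s).filter fun z => f z.1 = f z.2).card *
        ((t ×ˢ t).filter fun z => g z.1 = g z.2).card := by
  classical
  set U := s.image f ∪ t.image g with hU
  have hs : ∀ a ∈ s, f a ∈ U := fun a ha =>
    Finset.mem_union_left _ (Finset.mem_image_of_mem _ ha)
  have ht : ∀ a ∈ t, g a ∈ U := fun a ha =>
    Finset.mem_union_right _ (Finset.mem_image_of_mem _ ha)
  rw [card_coincidence_eq_sum s t f g U hs, card_coincidence_eq_sum s s f f U hs,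
    card_coincidence_eq_sum t t g g U ht]
  simpa only [sq] using Finset.sum_mul_sq_le_sq_mul_sq U
    (fun c => (s.filter fun a => f a = c).card) (fun c => (t.filter fun b => g b = c).card)

/-- The divisor bound. -/
theorem exists_card_divisors_le_rpow (ε : ℝ) (hε : 0 < ε) :
    ∃ K : ℝ, 0 < K ∧ ∀ n : ℕ, n ≠ 0 → (n.divisors.card : ℝ) ≤ K * (n : ℝ) ^ ε := by
  classical
  -- the local factor at `p` is at most `A`, and at most `1` once `p` is at least `z`
  obtain ⟨A, hA1, hA⟩ : ∃ A : ℝ, 1 ≤ A ∧ ∀ a : ℕ, (a + 1 : ℝ) ≤ A * (2 : ℝ) ^ (ε * a) := by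
    refine ⟨1 + 1 / (ε * Real.log 2), by
      have := Real.log_pos (by norm_num : (1:ℝ) < 2); simp; positivity, fun a => ?_⟩
    have hl := Real.log_pos (by norm_num : (1:ℝ) < 2)
    have h1 : ε * Real.log 2 * a + 1 ≤ (2 : ℝ) ^ (ε * a) := by
      rw [Real.rpow_def_of_pos (by norm_num)]
      calc _ = (Real.log 2 * (ε * a)) + 1 := by ring
        _ ≤ _ := Real.add_one_le_exp _
    have h2 : (1:ℝ) ≤ (2 : ℝ) ^ (ε * a) := le_trans (by
      have : 0 ≤ ε * Real.log 2 * a := by positivity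
      linarith) h1
    have h3 : (a : ℝ) ≤ 1 / (ε * Real.log 2) * (2 : ℝ) ^ (ε * a) := by
      rw [div_mul_eq_mul_div, le_div_iff₀ (by positivity)]
      linarith
    linarith
  obtain ⟨z, hz⟩ : ∃ z : ℕ, ∀ p : ℕ, z ≤ p → (2 : ℝ) ≤ (p : ℝ) ^ ε := by
    have := (tendsto_rpow_atTop hε).comp tendsto_natCast_atTop_atTop
    exact Filter.eventually_atTop.1 (this.eventually_ge_atTop 2)
  refine ⟨A ^ z, by positivity, fun n hn => ?_⟩
  have hfac : (n : ℝ) ^ ε = ∏ p ∈ n.primeFactors, ((p : ℝ) ^ ε) ^ (n.factorization p) := by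
    conv_lhs => rw [← Nat.prod_factorization_pow_eq_self hn]
    rw [Nat.prod_factorization_eq_prod_primeFactors]
    push_cast
    rw [← Real.finsetProd_rpow _ _ (fun i _ => by positivity)]
    refine Finset.prod_congr rfl fun p _ => ?_
    rw [← Real.rpow_natCast, ← Real.rpow_natCast, ← Real.rpow_mul (by positivity),
      ← Real.rpow_mul (by positivity), mul_comm]
  rw [Nat.card_divisors hn, hfac]
  push_cast
  calc (∏ p ∈ n.primeFactors, ((n.factorization p : ℝ) + 1))
      ≤ ∏ p ∈ n.primeFactors, ((if p < z then A else 1) *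
          ((p : ℝ) ^ ε) ^ (n.factorization p)) := by
        refine Finset.prod_le_prod (fun i _ => by positivity) fun p hp => ?_
        have hp2 := (Nat.prime_of_mem_primeFactors hp).two_le
        split_ifs with h
        · refine (hA _).trans ?_
          rw [Real.rpow_mul (by norm_num), Real.rpow_natCast]
          gcongr
          exact_mod_cast hp2
        · rw [one_mul]
          calc ((n.factorization p : ℝ) + 1) ≤ 2 ^ (n.factorization p) := by
                exact_mod_cast Nat.lt_two_pow_self
            _ ≤ _ := by
                gcongr
                exact hz p (not_lt.1 h)
    _ = (∏ p ∈ n.primeFactors, (if p < z then A else 1)) *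
          ∏ p ∈ n.primeFactors, ((p : ℝ) ^ ε) ^ (n.factorization p) := Finset.prod_mul_distrib
    _ ≤ _ := by
        refine mul_le_mul_of_nonneg_right ?_ (Finset.prod_nonneg fun i _ => by positivity)
        rw [Finset.prod_ite, Finset.prod_const, Finset.prod_const_one, mul_one]
        refine pow_le_pow_right₀ hA1 ?_
        calc _ ≤ (Finset.range z).card := Finset.card_le_card fun p hp => by
                simpa using (Finset.mem_filter.1 hp).2
          _ = z := Finset.card_range z

/-- If `(x₀, y₀)` and `(x, y)` both solve `x² - D y² = N`, then the complementary factor of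
`gcd(N, x y₀ - x₀ y)` in `N` divides `x y₀ + x₀ y`. -/
theorem pell_complementary_dvd {D N x₀ y₀ x y : ℤ} (hN : N ≠ 0) (h₀ : x₀ ^ 2 - D * y₀ ^ 2 = N)
    (h : x ^ 2 - D * y ^ 2 = N) {n₁ n₂ : ℤ} (hn₁ : (Int.gcd N (x * y₀ - x₀ * y) : ℤ) = n₁)
    (hn : N = n₁ * n₂) : n₂ ∣ x * y₀ + x₀ * y := by
  have hpos : 0 < Int.gcd N (x * y₀ - x₀ * y) := Int.gcd_pos_of_ne_zero_left _ hN
  obtain ⟨m', k', hc, hm, hk⟩ := Int.exists_gcd_one hpos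
  rw [hn₁] at hm hk
  have hn0 : n₁ ≠ 0 := by rintro rfl; simp at hn; exact hN hn
  have hmn : m' = n₂ := mul_right_cancel₀ hn0 (by rw [← hm, hn, mul_comm])
  subst hmn
  have hdvd : n₁ * m' ∣ n₁ * (k' * (x * y₀ + x₀ * y)) := by
    refine ⟨y₀ ^ 2 - y ^ 2, ?_⟩
    rw [← hn, ← mul_assoc, mul_comm n₁ k', ← hk]
    linear_combination (-y ^ 2) * h₀ + y₀ ^ 2 * h
  exact (Int.isCoprime_iff_gcd_eq_one.2 hc).dvd_of_dvd_mul_left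
    (Int.dvd_of_mul_dvd_mul_left hn0 hdvd)

/-- Two primitive solutions of `x² - D y² = N` in the same class are far from proportional. -/
theorem pell_cross_bound {D N x₀ y₀ x y x' y' : ℤ} (hD : D ≠ 0) (hN : N ≠ 0)
    (h₀ : x₀ ^ 2 - D * y₀ ^ 2 = N) (h : x ^ 2 - D * y ^ 2 = N) (h' : x' ^ 2 - D * y' ^ 2 = N)
    (c₀ : IsCoprime x₀ y₀) (c : IsCoprime x y)
    (hcl : Int.gcd N (x * y₀ - x₀ * y) = Int.gcd N (x' * y₀ - x₀ * y'))
    (hw : x * y' - x' * y ≠ 0) :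
    N ^ 2 ≤ 4 * |D| * (x * y' - x' * y) ^ 2 := by
  obtain ⟨n₂, hn⟩ : (Int.gcd N (x * y₀ - x₀ * y) : ℤ) ∣ N := Int.gcd_dvd_left ..
  set n₁ : ℤ := (Int.gcd N (x * y₀ - x₀ * y) : ℤ) with hn₁
  have e1 : n₁ ∣ x * y₀ - x₀ * y := Int.gcd_dvd_right ..
  have e1' : n₁ ∣ x' * y₀ - x₀ * y' := by rw [hn₁, hcl]; exact Int.gcd_dvd_right ..
  have e2 : n₂ ∣ x * y₀ + x₀ * y := pell_complementary_dvd hN h₀ h rfl hn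
  have e2' : n₂ ∣ x' * y₀ + x₀ * y' := pell_complementary_dvd hN h₀ h' (by rw [hn₁, hcl]) hn
  have red : ∀ m : ℤ, m ∣ x₀ * (x * y' - x' * y) → m ∣ y₀ * (x * y' - x' * y) →
      m ∣ x * y' - x' * y := by
    intro m h1 h2
    obtain ⟨a, b, hab⟩ := c₀
    have := dvd_add (h1.mul_left a) (h2.mul_left b)
    rwa [← mul_assoc, ← mul_assoc, ← add_mul, hab, one_mul] at this
  have w1 : n₁ ∣ x * y' - x' * y := red _
    ((((e1.mul_left x').sub (e1'.mul_left x))).trans (dvd_of_eq (by ring)))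
    ((((e1.mul_left y').sub (e1'.mul_left y))).trans (dvd_of_eq (by ring)))
  have w2 : n₂ ∣ x * y' - x' * y := red _
    ((((e2'.mul_left x).sub (e2.mul_left x'))).trans (dvd_of_eq (by ring)))
    ((((e2.mul_left y').sub (e2'.mul_left y))).trans (dvd_of_eq (by ring)))
  set w := x * y' - x' * y with hwdef
  set G : ℤ := (Int.gcd n₁ n₂ : ℤ) with hG
  have g1 : G ∣ n₁ := Int.gcd_dvd_left ..
  have g2 : G ∣ n₂ := Int.gcd_dvd_right ..
  have hNG : N ∣ G * w := by
    rw [hn, hG, Int.gcd_eq_gcd_ab, add_mul]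
    refine dvd_add ?_ ?_
    · rw [mul_assoc]; exact mul_dvd_mul_left _ (w2.mul_left _)
    · rw [mul_assoc, mul_comm n₁ n₂]; exact mul_dvd_mul_left _ (w1.mul_left _)
  have hGN : G ^ 2 ∣ N := by rw [hn, sq]; exact mul_dvd_mul g1 g2
  have cop : ∀ u v : ℤ, u ^ 2 - D * v ^ 2 = N → IsCoprime u v → IsCoprime G v := by
    intro u v huv huc
    have h1 : IsCoprime (u ^ 2 - D * v ^ 2) v := by
      have : IsCoprime (u ^ 2) v := huc.pow_left
      have := this.add_mul_left_left (-(D * v))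
      rwa [show u ^ 2 + v * -(D * v) = u ^ 2 - D * v ^ 2 by ring] at this
    rw [huv] at h1
    exact h1.of_isCoprime_of_dvd_left ((dvd_pow_self G two_ne_zero).trans hGN)
  have hx0 : G ∣ 2 * x₀ := by
    have : G ∣ y * (2 * x₀) :=
      ((g2.trans e2).sub (g1.trans e1)).trans (dvd_of_eq (by ring))
    exact (cop x y h c).dvd_of_dvd_mul_left this
  have hG4 : G ^ 2 ∣ y₀ ^ 2 * (4 * D) := by
    have h1 : G ^ 2 ∣ (2 * x₀) ^ 2 := pow_dvd_pow_of_dvd hx0 2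
    exact (h1.sub (hGN.mul_left 4)).trans (dvd_of_eq (by rw [← h₀]; ring))
  have hGD : G ^ 2 ∣ 4 * D := ((cop x₀ y₀ h₀ c₀).pow).dvd_of_dvd_mul_left hG4
  have hD4 : G ^ 2 ≤ 4 * |D| := by
    have := Int.le_of_dvd (by positivity) ((dvd_abs _ _).2 hGD)
    rwa [abs_mul, abs_of_pos (by norm_num : (0:ℤ) < 4)] at this
  have hG0 : G ≠ 0 := by
    rintro h0
    rw [h0] at hGN
    exact hN (by simpa using hGN)
  have hle : |N| ≤ |G * w| := Int.le_of_dvd (abs_pos.2 (mul_ne_zero hG0 hw))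
    ((abs_dvd_abs _ _).2 hNG)
  calc N ^ 2 ≤ (G * w) ^ 2 := sq_le_sq.2 hle
    _ = G ^ 2 * w ^ 2 := by ring
    _ ≤ _ := by gcongr

theorem card_pell_separated_of_pos {D N : ℤ} {B : ℝ} (hB : 1 ≤ B) (hD : 0 < D) (hDB : (D : ℝ) ≤ B)
    (hN : N ≠ 0) (S : Finset (ℤ × ℤ)) (hS : ∀ z ∈ S, z.1 ^ 2 - D * z.2 ^ 2 = N)
    (hSB : ∀ z ∈ S, |(z.1 : ℝ)| ≤ B ∧ |(z.2 : ℝ)| ≤ B)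
    (hsep : ∀ z ∈ S, ∀ z' ∈ S, z.1 * z'.2 - z'.1 * z.2 ≠ 0 →
      N ^ 2 ≤ 4 * |D| * (z.1 * z'.2 - z'.1 * z.2) ^ 2) :
    (S.card : ℝ) ≤ 81 + 24 * Real.log B := by
  classical
  set r : ℝ := √(D : ℝ) with hr
  have hDR : (0 : ℝ) < D := by exact_mod_cast hD
  have hr0 : 0 < r := Real.sqrt_pos.2 hDR
  have hrr : r ^ 2 = D := Real.sq_sqrt hDR.le
  have hrB : r ≤ B := by
    rw [hr, Real.sqrt_le_left (by linarith)]
    nlinarith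
  set α : ℤ × ℤ → ℝ := fun z => z.1 + z.2 * r with hα
  set β : ℤ × ℤ → ℝ := fun z => z.1 - z.2 * r with hβ
  have hαβ : ∀ z ∈ S, α z * β z = N := by
    intro z hz
    have : ((z.1 : ℝ)) ^ 2 - D * z.2 ^ 2 = N := by exact_mod_cast hS z hz
    simp only [hα, hβ]
    rw [← this, ← hrr]; ring
  have hN1 : (1 : ℝ) ≤ |(N : ℝ)| := by exact_mod_cast Int.one_le_abs hN
  have hNR : (N : ℝ) ≠ 0 := by exact_mod_cast hN
  have hα0 : ∀ z ∈ S, α z ≠ 0 := fun z hz h => hNR (by rw [← hαβ z hz, h, zero_mul])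
  have hup : ∀ x y : ℝ, |x| ≤ B → |y| ≤ B → |x| + |y| * r ≤ 2 * B ^ 2 := by
    intro x y hx hy
    have : |y| * r ≤ B * B := by gcongr
    nlinarith
  have hαup : ∀ z ∈ S, |α z| ≤ 2 * B ^ 2 := fun z hz => by
    refine le_trans ?_ (hup _ _ (hSB z hz).1 (hSB z hz).2)
    refine (abs_add_le _ _).trans ?_
    rw [abs_mul, abs_of_pos hr0]
  have hβup : ∀ z ∈ S, |β z| ≤ 2 * B ^ 2 := fun z hz => by
    refine le_trans ?_ (hup _ _ (hSB z hz).1 (hSB z hz).2)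
    refine (abs_sub _ _).trans ?_
    rw [abs_mul, abs_of_pos hr0]
  have hαlo : ∀ z ∈ S, 1 / (2 * B ^ 2) ≤ |α z| := fun z hz => by
    rw [div_le_iff₀ (by positivity)]
    calc 1 ≤ |(N : ℝ)| := hN1
      _ = |α z| * |β z| := by rw [← hαβ z hz, abs_mul]
      _ ≤ _ := by gcongr; exact hβup z hz
  set Λ : ℝ := 3 * Real.log (2 * B ^ 2) with hΛ
  have hlog : ∀ z ∈ S, |3 * Real.log (|α z|)| ≤ Λ := by
    intro z hz
    have h1 := Real.log_le_log (abs_pos.2 (hα0 z hz)) (hαup z hz)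
    have h2 := Real.log_le_log (by positivity) (hαlo z hz)
    rw [one_div, Real.log_inv] at h2
    rw [abs_le]; constructor <;> linarith
  have hΛ0 : 0 ≤ Λ := by
    have : 0 ≤ Real.log (2 * B ^ 2) := Real.log_nonneg (by nlinarith)
    positivity
  set F : ℤ × ℤ → Bool × ℤ := fun z => (decide (0 < α z), ⌊3 * Real.log |α z|⌋) with hF
  have hinj : Set.InjOn F S := by
    intro z hz z' hz' hzz
    simp only [hF, Prod.mk.injEq, decide_eq_decide] at hzz
    obtain ⟨hs, hfl⟩ := hzz
    have a0 := hα0 z hz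
    have a0' := hα0 z' hz'
    set ρ := α z / α z' with hρ
    have hρ0 : 0 < ρ := by
      rcases lt_or_gt_of_ne a0 with h | h
      · have : α z' < 0 := lt_of_le_of_ne (not_lt.1 fun h' => (lt_asymm h (hs.2 h'))) a0'
        exact div_pos_of_neg_of_neg h this
      · exact div_pos h (hs.1 h)
    have hlogρ : Real.log ρ = Real.log |α z| - Real.log |α z'| := by
      rw [hρ, Real.log_div a0 a0', Real.log_abs, Real.log_abs]
    have hab := Int.abs_sub_lt_one_of_floor_eq_floor hfl
    have hl : |Real.log ρ| < 1 / 3 := by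
      rw [hlogρ]
      rw [← mul_sub, abs_mul, abs_of_pos (by norm_num : (0:ℝ) < 3)] at hab
      linarith
    have he : Real.exp (1 / 3) ≤ 3 / 2 := by
      have h1 : Real.exp (1 / 3) ^ 3 = Real.exp 1 := by
        rw [← Real.exp_nat_mul]; norm_num
      have h2 := Real.exp_one_lt_d9
      by_contra! h
      have : (3 / 2 : ℝ) ^ 3 < Real.exp (1 / 3) ^ 3 := by gcongr
      norm_num at this
      linarith
    rw [abs_lt] at hl
    have hρ1 : ρ < 3 / 2 := lt_of_lt_of_le
      (by rw [← Real.exp_log hρ0]; exact Real.exp_lt_exp.2 hl.2) he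
    have hρ2 : ρ⁻¹ < 3 / 2 := lt_of_lt_of_le
      (by rw [← Real.exp_log hρ0, ← Real.exp_neg]; exact Real.exp_lt_exp.2 (by linarith)) he
    have hcross : 4 * D * ((z.1 * z'.2 - z'.1 * z.2 : ℤ) : ℝ) ^ 2 = N ^ 2 * (ρ - ρ⁻¹) ^ 2 := by
      have e1 : β z = N / α z := by rw [eq_div_iff a0, mul_comm]; exact hαβ z hz
      have e2 : β z' = N / α z' := by rw [eq_div_iff a0', mul_comm]; exact hαβ z' hz'
      have : (N : ℝ) * (ρ - ρ⁻¹) = α z * β z' - β z * α z' := by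
        rw [e1, e2, hρ]; field_simp
      rw [← mul_pow, this, ← hrr]
      simp only [hα, hβ]; push_cast; ring
    have hsmall : (ρ - ρ⁻¹) ^ 2 < 1 := by
      rw [sq_lt_one_iff_abs_lt_one, abs_lt]
      have hi : ρ * ρ⁻¹ = 1 := mul_inv_cancel₀ hρ0.ne'
      have hi0 : 0 < ρ⁻¹ := inv_pos.2 hρ0
      constructor <;> nlinarith
    have hw : z.1 * z'.2 - z'.1 * z.2 = 0 := by
      by_contra hw
      have h1 := hsep z hz z' hz' hw
      rw [abs_of_pos hD] at h1
      have h2 : (N : ℝ) ^ 2 ≤ 4 * D * ((z.1 * z'.2 - z'.1 * z.2 : ℤ) : ℝ) ^ 2 := by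
        exact_mod_cast h1
      rw [hcross] at h2
      have : 0 < (N : ℝ) ^ 2 := by positivity
      nlinarith
    rw [hw] at hcross
    have hρρ : ρ - ρ⁻¹ = 0 := by
      have : (N : ℝ) ^ 2 * (ρ - ρ⁻¹) ^ 2 = 0 := by rw [← hcross]; simp
      simpa [hNR] using this
    have hρ1 : ρ = 1 := by
      have hi : ρ * ρ⁻¹ = 1 := mul_inv_cancel₀ hρ0.ne'
      have : ρ = ρ⁻¹ := by linarith
      rw [← this] at hi
      nlinarith
    have hαeq : α z = α z' := by rwa [hρ, div_eq_one_iff_eq a0'] at hρ1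
    have hβeq : β z = β z' := by
      have := (hαβ z hz).trans (hαβ z' hz').symm
      rw [hαeq] at this
      exact mul_left_cancel₀ a0' this
    simp only [hα, hβ] at hαeq hβeq
    have hX : (z.1 : ℝ) = z'.1 := by linarith
    have hY : (z.2 : ℝ) = z'.2 := mul_right_cancel₀ hr0.ne' (by linarith)
    exact Prod.ext (by exact_mod_cast hX) (by exact_mod_cast hY)
  have hmaps : Set.MapsTo F S
      ((Finset.univ : Finset Bool) ×ˢ Finset.Icc ⌊-Λ⌋ ⌊Λ⌋ : Finset (Bool × ℤ)) := by
    intro z hz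
    have := abs_le.1 (hlog z hz)
    simp only [hF, Finset.coe_product, Set.mem_prod, Finset.mem_coe, Finset.mem_univ,
      Finset.mem_Icc, true_and]
    exact ⟨Int.floor_le_floor this.1, Int.floor_le_floor this.2⟩
  have hcard := Finset.card_le_card_of_injOn F hmaps hinj
  rw [Finset.card_product, Int.card_Icc, Finset.card_univ, Fintype.card_bool] at hcard
  have h1 : ((⌊Λ⌋ + 1 - ⌊-Λ⌋).toNat : ℝ) ≤ 2 * Λ + 2 := by
    have h0 : (0:ℤ) ≤ ⌊Λ⌋ + 1 - ⌊-Λ⌋ := by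
      have : ⌊-Λ⌋ ≤ ⌊Λ⌋ := Int.floor_le_floor (by linarith)
      omega
    have : (((⌊Λ⌋ + 1 - ⌊-Λ⌋).toNat : ℤ) : ℝ) = ((⌊Λ⌋ + 1 - ⌊-Λ⌋ : ℤ) : ℝ) := by
      rw [Int.toNat_of_nonneg h0]
    rw [Int.cast_natCast] at this
    rw [this]; push_cast
    have := Int.floor_le Λ
    have := Int.sub_one_lt_floor (-Λ)
    linarith
  have h2 : (S.card : ℝ) ≤ 2 * (2 * Λ + 2) := by
    calc (S.card : ℝ) ≤ ((2 * (⌊Λ⌋ + 1 - ⌊-Λ⌋).toNat : ℕ) : ℝ) := by exact_mod_cast hcard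
      _ ≤ _ := by push_cast; linarith
  have h3 : Real.log (2 * B ^ 2) = Real.log 2 + 2 * Real.log B := by
    rw [Real.log_mul (by norm_num) (by positivity), Real.log_pow]; norm_num
  have := Real.log_two_lt_d9
  rw [hΛ, h3] at h2
  linarith

theorem card_pell_separated_of_neg {D N : ℤ} (hD : D < 0)
    (hN : N ≠ 0) (S : Finset (ℤ × ℤ)) (hS : ∀ z ∈ S, z.1 ^ 2 - D * z.2 ^ 2 = N)
    (hsep : ∀ z ∈ S, ∀ z' ∈ S, z.1 * z'.2 - z'.1 * z.2 ≠ 0 →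
      N ^ 2 ≤ 4 * |D| * (z.1 * z'.2 - z'.1 * z.2) ^ 2) :
    S.card ≤ 81 := by
  classical
  rcases S.eq_empty_or_nonempty with rfl | ⟨z₁, hz₁⟩
  · simp
  have hNpos : 0 < N := by
    refine lt_of_le_of_ne ?_ hN.symm
    rw [← hS z₁ hz₁]
    nlinarith [sq_nonneg z₁.1, sq_nonneg z₁.2]
  have hNR : (0 : ℝ) < N := by exact_mod_cast hNpos
  have hER : (0 : ℝ) < -D := by
    have : (D : ℝ) < 0 := by exact_mod_cast hD
    linarith
  set e : ℝ := √(-D : ℝ) with he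
  have he0 : 0 < e := Real.sqrt_pos.2 hER
  have hee : e ^ 2 = -D := Real.sq_sqrt hER.le
  set n : ℝ := √(N : ℝ) with hn
  have hn0 : 0 < n := Real.sqrt_pos.2 hNR
  have hnn : n ^ 2 = N := Real.sq_sqrt hNR.le
  set u : ℤ × ℤ → ℝ := fun z => z.1 / n with hu
  set v : ℤ × ℤ → ℝ := fun z => z.2 * e / n with hv
  have huv : ∀ z ∈ S, u z ^ 2 + v z ^ 2 = 1 := by
    intro z hz
    have : ((z.1 : ℝ)) ^ 2 - D * z.2 ^ 2 = N := by exact_mod_cast hS z hz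
    simp only [hu, hv]
    rw [div_pow, div_pow, ← add_div, div_eq_one_iff_eq (by positivity), hnn, ← this, mul_pow, hee]
    ring
  set F : ℤ × ℤ → ℤ × ℤ := fun z => (⌊4 * u z⌋, ⌊4 * v z⌋) with hF
  have hinj : Set.InjOn F S := by
    intro z hz z' hz' hzz
    simp only [hF, Prod.mk.injEq] at hzz
    have h1 := Int.abs_sub_lt_one_of_floor_eq_floor hzz.1
    have h2 := Int.abs_sub_lt_one_of_floor_eq_floor hzz.2
    have c1 := huv z hz
    have c2 := huv z' hz'
    have d1 : (u z - u z') ^ 2 < 1 / 16 := by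
      have := (sq_lt_one_iff_abs_lt_one _).2 h1
      nlinarith
    have d2 : (v z - v z') ^ 2 < 1 / 16 := by
      have := (sq_lt_one_iff_abs_lt_one _).2 h2
      nlinarith
    have hcr : (u z * v z' - u z' * v z) ^ 2 < 1 / 4 := by
      have : (u z * v z' - u z' * v z) ^ 2 ≤ (u z ^ 2 + v z ^ 2) *
          ((u z - u z') ^ 2 + (v z - v z') ^ 2) := by
        nlinarith [sq_nonneg (u z * (u z - u z') + v z * (v z - v z'))]
      rw [c1] at this
      linarith
    have hcross : (u z * v z' - u z' * v z) ^ 2 * N ^ 2 =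
        -D * ((z.1 * z'.2 - z'.1 * z.2 : ℤ) : ℝ) ^ 2 := by
      simp only [hu, hv]
      rw [← hee, ← hnn]
      push_cast
      field_simp
    have hw : z.1 * z'.2 - z'.1 * z.2 = 0 := by
      by_contra hw
      have h3 := hsep z hz z' hz' hw
      rw [abs_of_neg hD] at h3
      have h4 : (N : ℝ) ^ 2 ≤ 4 * -D * ((z.1 * z'.2 - z'.1 * z.2 : ℤ) : ℝ) ^ 2 := by
        exact_mod_cast h3
      have : 0 < (N : ℝ) ^ 2 := by positivity
      nlinarith
    rw [hw] at hcross
    have hc0 : u z * v z' - u z' * v z = 0 := by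
      have : (u z * v z' - u z' * v z) ^ 2 * (N : ℝ) ^ 2 = 0 := by rw [hcross]; simp
      simpa [hNR.ne'] using this
    have hdot : (u z * u z' + v z * v z') ^ 2 = 1 := by
      have : (u z * u z' + v z * v z') ^ 2 + (u z * v z' - u z' * v z) ^ 2 =
        (u z ^ 2 + v z ^ 2) * (u z' ^ 2 + v z' ^ 2) := by ring
      rw [hc0, c1, c2] at this
      linarith
    have hdot1 : u z * u z' + v z * v z' = 1 := by
      have h3 : (u z * u z' + v z * v z' - 1) * (u z * u z' + v z * v z' + 1) = 0 := by
        linear_combination hdot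
      rcases mul_eq_zero.1 h3 with h | h
      · linarith
      · have h4 : (u z - u z') ^ 2 + (v z - v z') ^ 2 = 4 := by
          linear_combination c1 + c2 - 2 * h
        linarith
    have hdist : (u z - u z') ^ 2 + (v z - v z') ^ 2 = 0 := by
      linear_combination c1 + c2 - 2 * hdot1
    obtain ⟨e1, e2⟩ := (add_eq_zero_iff_of_nonneg (sq_nonneg _) (sq_nonneg _)).1 hdist
    replace e1 := sub_eq_zero.1 (pow_eq_zero_iff two_ne_zero |>.1 e1)
    replace e2 := sub_eq_zero.1 (pow_eq_zero_iff two_ne_zero |>.1 e2)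
    simp only [hu, hv] at e1 e2
    have f1 : (z.1 : ℝ) = z'.1 := by field_simp at e1; exact e1
    have f2 : (z.2 : ℝ) = z'.2 := by field_simp at e2; exact e2
    exact Prod.ext (by exact_mod_cast f1) (by exact_mod_cast f2)
  have hfl : ∀ x : ℝ, x ^ 2 ≤ 1 → ⌊4 * x⌋ ∈ Finset.Icc (-4 : ℤ) 4 := by
    intro x hx
    have := abs_le.1 ((sq_le_one_iff_abs_le_one x).1 hx)
    rw [Finset.mem_Icc, Int.le_floor]
    refine ⟨by push_cast; linarith, ?_⟩
    have : ⌊4 * x⌋ ≤ ⌊(4:ℝ)⌋ := Int.floor_le_floor (by linarith)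
    simpa using this
  have hmaps : Set.MapsTo F S (Finset.Icc (-4 : ℤ) 4 ×ˢ Finset.Icc (-4 : ℤ) 4 : Finset _) := by
    intro z hz
    have := huv z hz
    simp only [hF, Finset.coe_product, Set.mem_prod, Finset.mem_coe]
    exact ⟨hfl _ (by nlinarith [sq_nonneg (v z)]), hfl _ (by nlinarith [sq_nonneg (u z)])⟩
  have hcard := Finset.card_le_card_of_injOn F hmaps hinj
  simpa using hcard

theorem card_pell_separated {D N : ℤ} {B : ℝ} (hB : 1 ≤ B) (hD : D ≠ 0) (hDB : |(D : ℝ)| ≤ B)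
    (hN : N ≠ 0) (S : Finset (ℤ × ℤ)) (hS : ∀ z ∈ S, z.1 ^ 2 - D * z.2 ^ 2 = N)
    (hSB : ∀ z ∈ S, |(z.1 : ℝ)| ≤ B ∧ |(z.2 : ℝ)| ≤ B)
    (hsep : ∀ z ∈ S, ∀ z' ∈ S, z.1 * z'.2 - z'.1 * z.2 ≠ 0 →
      N ^ 2 ≤ 4 * |D| * (z.1 * z'.2 - z'.1 * z.2) ^ 2) :
    (S.card : ℝ) ≤ 81 + 24 * Real.log B := by
  rcases lt_or_gt_of_ne hD with h | h
  · have h1 : (S.card : ℝ) ≤ 81 := by exact_mod_cast card_pell_separated_of_neg h hN S hS hsep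
    have := Real.log_nonneg hB
    linarith
  · exact card_pell_separated_of_pos hB h ((le_abs_self _).trans hDB) hN S hS hSB hsep

/-- The number of solutions of `x² - D y² = N` in a box. -/
theorem card_pell_le {D N : ℤ} {B : ℝ} (hB : 1 ≤ B) (hD : D ≠ 0) (hDB : |(D : ℝ)| ≤ B)
    (hN : N ≠ 0) (S : Finset (ℤ × ℤ)) (hS : ∀ z ∈ S, z.1 ^ 2 - D * z.2 ^ 2 = N)
    (hSB : ∀ z ∈ S, |(z.1 : ℝ)| ≤ B ∧ |(z.2 : ℝ)| ≤ B) :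
    (S.card : ℝ) ≤ (81 + 24 * Real.log B) * (N.natAbs.divisors.card : ℝ) ^ 2 := by
  classical
  set L : ℕ := ⌊81 + 24 * Real.log B⌋₊ with hL
  have hL0 : 0 ≤ 81 + 24 * Real.log B := by
    have := Real.log_nonneg hB; positivity
  have hNn : N.natAbs ≠ 0 := Int.natAbs_ne_zero.2 hN
  have key : ∀ e ∈ N.natAbs.divisors, (S.filter fun z => Int.gcd z.1 z.2 = e).card ≤
      L * N.natAbs.divisors.card := by
    intro e he
    set T := S.filter fun z => Int.gcd z.1 z.2 = e with hT
    rcases T.eq_empty_or_nonempty with h | ⟨z₀, hz₀⟩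
    · simp [h]
    have prim : ∀ z ∈ T, ∃ x y : ℤ, z.1 = x * e ∧ z.2 = y * e ∧ IsCoprime x y := by
      intro z hz
      have hge := (Finset.mem_filter.1 hz).2
      have hpos : 0 < Int.gcd z.1 z.2 := by
        rw [hge]; exact Nat.pos_of_mem_divisors he
      obtain ⟨x, y, hxy, h1, h2⟩ := Int.exists_gcd_one hpos
      rw [hge] at h1 h2
      exact ⟨x, y, h1, h2, Int.isCoprime_iff_gcd_eq_one.2 hxy⟩
    have he0 : (e : ℤ) ≠ 0 := by exact_mod_cast (Nat.pos_of_mem_divisors he).ne'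
    choose! X Y hX hY hXY using prim
    obtain ⟨M, hM⟩ : ((e : ℤ) ^ 2) ∣ N := by
      refine ⟨X z₀ ^ 2 - D * Y z₀ ^ 2, ?_⟩
      rw [← hS z₀ (Finset.mem_filter.1 hz₀).1, hX _ hz₀, hY _ hz₀]; ring
    have hM0 : M ≠ 0 := by rintro rfl; simp at hM; exact hN hM
    have hsol : ∀ z ∈ T, X z ^ 2 - D * Y z ^ 2 = M := by
      intro z hz
      have h1 := hS z (Finset.mem_filter.1 hz).1
      rw [hX _ hz, hY _ hz, hM] at h1
      exact mul_left_cancel₀ (pow_ne_zero 2 he0) (by rw [← h1]; ring)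
    refine Finset.card_le_mul_card_image_of_maps_to
      (f := fun z => Int.gcd M (X z * Y z₀ - X z₀ * Y z)) ?_ _ ?_
    · intro z hz
      rw [Nat.mem_divisors]
      refine ⟨?_, hNn⟩
      rw [← Int.natCast_dvd]
      exact (Int.gcd_dvd_left ..).trans ⟨(e : ℤ) ^ 2, by rw [hM]; ring⟩
    · intro n₁ _
      rw [hL]
      refine Nat.le_floor ?_
      refine card_pell_separated hB hD hDB hN _ (fun z hz => ?_) (fun z hz => ?_) ?_
      · exact hS z (Finset.mem_filter.1 (Finset.mem_filter.1 hz).1).1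
      · exact hSB z (Finset.mem_filter.1 (Finset.mem_filter.1 hz).1).1
      · intro z hz z' hz' hw
        obtain ⟨hz, hcl⟩ := Finset.mem_filter.1 hz
        obtain ⟨hz', hcl'⟩ := Finset.mem_filter.1 hz'
        have hww : z.1 * z'.2 - z'.1 * z.2 = (e : ℤ) ^ 2 * (X z * Y z' - X z' * Y z) := by
          rw [hX _ hz, hY _ hz, hX _ hz', hY _ hz']; ring
        rw [hww] at hw ⊢
        have := pell_cross_bound hD hM0 (hsol z₀ hz₀) (hsol z hz) (hsol z' hz') (hXY z₀ hz₀)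
          (hXY z hz) (hcl.trans hcl'.symm) (right_ne_zero_of_mul hw)
        rw [hM, mul_pow, mul_pow]
        calc _ ≤ ((e : ℤ) ^ 2) ^ 2 * (4 * |D| * (X z * Y z' - X z' * Y z) ^ 2) := by gcongr
          _ = _ := by ring
  have hcard : S.card ≤ L * N.natAbs.divisors.card * N.natAbs.divisors.card := by
    refine Finset.card_le_mul_card_image_of_maps_to (f := fun z => Int.gcd z.1 z.2) ?_ _ key
    intro z hz
    rw [Nat.mem_divisors]
    refine ⟨?_, hNn⟩
    rw [← Int.natCast_dvd, ← hS z hz]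
    exact ((Int.gcd_dvd_left ..).trans (dvd_pow_self _ two_ne_zero)).sub
      (((Int.gcd_dvd_right ..).trans (dvd_pow_self _ two_ne_zero)).mul_left _)
  calc (S.card : ℝ) ≤ ((L * N.natAbs.divisors.card * N.natAbs.divisors.card : ℕ) : ℝ) := by
        exact_mod_cast hcard
    _ = (L : ℝ) * (N.natAbs.divisors.card : ℝ) ^ 2 := by push_cast; ring
    _ ≤ _ := by gcongr; exact Nat.floor_le hL0

/-- A nonzero polynomial of degree at most five has at most five integral zeros. -/
theorem card_zeros_le_five (c₀ c₁ c₂ c₃ c₄ c₅ : ℤ)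
    (hc : c₀ ≠ 0 ∨ c₁ ≠ 0 ∨ c₂ ≠ 0 ∨ c₃ ≠ 0 ∨ c₄ ≠ 0 ∨ c₅ ≠ 0) (S : Finset ℤ)
    (hS : ∀ a ∈ S, c₅ * a ^ 5 + c₄ * a ^ 4 + c₃ * a ^ 3 + c₂ * a ^ 2 + c₁ * a + c₀ = 0) :
    S.card ≤ 5 := by
  classical
  open Polynomial in
  set p : ℤ[X] := C c₅ * X ^ 5 + C c₄ * X ^ 4 + C c₃ * X ^ 3 + C c₂ * X ^ 2 + C c₁ * X + C c₀
    with hp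
  have hdeg : p.natDegree ≤ 5 := by rw [hp]; compute_degree
  have hp0 : p ≠ 0 := by
    intro h
    have hco : ∀ i, p.coeff i = 0 := fun i => by rw [h, Polynomial.coeff_zero]
    have h0 := hco 0
    have h1 := hco 1
    have h2 := hco 2
    have h3 := hco 3
    have h4 := hco 4
    have h5 := hco 5
    simp [hp, Polynomial.coeff_X, Polynomial.coeff_C, Polynomial.coeff_X_pow, -eq_intCast] at h0 h1 h2 h3 h4 h5
    rcases hc with h | h | h | h | h | h
    exacts [h h0, h h1, h h2, h h3, h h4, h h5]
  calc S.card ≤ p.roots.toFinset.card := Finset.card_le_card fun a ha => by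
        rw [Multiset.mem_toFinset, Polynomial.mem_roots hp0, Polynomial.IsRoot.def, hp]
        simpa using hS a ha
    _ ≤ Multiset.card p.roots := Multiset.toFinset_card_le _
    _ ≤ p.natDegree := Polynomial.card_roots' p
    _ ≤ 5 := hdeg

theorem abs_add_sub_bound {x y X Y : ℝ} (hx : |x| ≤ X) (hy : |y| ≤ Y) :
    |x + y| ≤ X + Y ∧ |x - y| ≤ X + Y :=
  ⟨(abs_add_le _ _).trans (add_le_add hx hy), (abs_sub _ _).trans (add_le_add hx hy)⟩

theorem abs_mul_bound {x y X Y : ℝ} (hx : |x| ≤ X) (hy : |y| ≤ Y) : |x * y| ≤ X * Y := by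
  rw [abs_mul]
  exact mul_le_mul hx hy (abs_nonneg _) ((abs_nonneg _).trans hx)

/-- Integral points of a nondegenerate conic in a box. -/
theorem exists_card_conic_le (ε : ℝ) (hε : 0 < ε) :
    ∃ K : ℝ, 0 < K ∧ ∀ (A B E F G H : ℤ) (M : ℝ), 1 ≤ M →
      |(A : ℝ)| ≤ M → |(B : ℝ)| ≤ M → |(E : ℝ)| ≤ M → |(F : ℝ)| ≤ M → |(G : ℝ)| ≤ M →
      |(H : ℝ)| ≤ M → A ≠ 0 → B ^ 2 - 4 * A * E ≠ 0 →
      A * G ^ 2 - B * F * G + E * F ^ 2 + (B ^ 2 - 4 * A * E) * H ≠ 0 →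
      ∀ S : Finset (ℤ × ℤ), (∀ z ∈ S, |(z.1 : ℝ)| ≤ M ∧ |(z.2 : ℝ)| ≤ M) →
      (∀ z ∈ S, A * z.1 ^ 2 + B * z.1 * z.2 + E * z.2 ^ 2 + F * z.1 + G * z.2 + H = 0) →
      (S.card : ℝ) ≤ K * M ^ ε := by
  classical
  set η : ℝ := ε / 16 with hη
  have hη0 : 0 < η := by positivity
  obtain ⟨K₀, hK₀, hdiv⟩ := exists_card_divisors_le_rpow η hη0
  refine ⟨(81 + 24 * (8 ^ (2 * η) / (2 * η))) * (K₀ * 32 ^ η) ^ 2, by positivity, ?_⟩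
  intro A B E F G H M hM hA hB hE hF hG hH hA0 hD0 hΘ0 S hSM hS
  set D := B ^ 2 - 4 * A * E with hD
  set Θ := A * G ^ 2 - B * F * G + E * F ^ 2 + D * H with hΘ
  set N := 4 * A * Θ with hN
  have hN0 : N ≠ 0 := by rw [hN]; exact mul_ne_zero (mul_ne_zero (by norm_num) hA0) hΘ0
  have hMM : M ≤ M ^ 2 := by nlinarith
  have hMM3 : M ^ 2 ≤ M ^ 3 := by nlinarith [sq_nonneg M]
  have hDb : |(D : ℝ)| ≤ 5 * M ^ 2 := by
    rw [hD]; push_cast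
    have h1 : |(B : ℝ) ^ 2| ≤ M ^ 2 := by rw [abs_pow]; gcongr
    have h2 : |(4 * A * E : ℝ)| ≤ 4 * M * M :=
      abs_mul_bound (abs_mul_bound (by norm_num) hA) hE
    have := (abs_add_sub_bound h1 h2).2
    linarith
  have hΘb : |(Θ : ℝ)| ≤ 8 * M ^ 3 := by
    rw [hΘ]; push_cast
    have hG2 : |(G : ℝ) ^ 2| ≤ M ^ 2 := by rw [abs_pow]; gcongr
    have hF2 : |(F : ℝ) ^ 2| ≤ M ^ 2 := by rw [abs_pow]; gcongr
    have h1 := abs_mul_bound hA hG2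
    have h2 := abs_mul_bound (abs_mul_bound hB hF) hG
    have h3 := abs_mul_bound hE hF2
    have h4 := abs_mul_bound hDb hH
    have := (abs_add_sub_bound (abs_add_sub_bound (abs_add_sub_bound h1 h2).2 h3).1 h4).1
    refine this.trans (le_of_eq (by ring))
  set f : ℤ × ℤ → ℤ × ℤ := fun z =>
    (D * z.2 - (2 * A * G - B * F), 2 * A * z.1 + B * z.2 + F) with hf
  have hinj : Set.InjOn f S := by
    intro z hz z' hz' h
    simp only [hf, Prod.mk.injEq] at h
    have h2 : z.2 = z'.2 := mul_left_cancel₀ hD0 (by linarith [h.1])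
    have h1 : z.1 = z'.1 := by
      have := h.2
      rw [h2] at this
      exact mul_left_cancel₀ (mul_ne_zero two_ne_zero hA0) (by linarith)
    exact Prod.ext h1 h2
  rw [← Finset.card_image_of_injOn hinj]
  have hpell := card_pell_le (D := D) (N := N) (B := 8 * M ^ 3) (by nlinarith) hD0
    (hDb.trans (by nlinarith)) hN0 (S.image f) (by
      intro w hw
      obtain ⟨z, hz, rfl⟩ := Finset.mem_image.1 hw
      have := hS z hz
      simp only [hf, hN, hΘ, hD]
      linear_combination (-4 * A * (B ^ 2 - 4 * A * E)) * this) (by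
      intro w hw
      obtain ⟨z, hz, rfl⟩ := Finset.mem_image.1 hw
      obtain ⟨h1, h2⟩ := hSM z hz
      simp only [hf]; push_cast
      constructor
      · have := (abs_add_sub_bound (abs_mul_bound hDb h2) (abs_add_sub_bound
          (abs_mul_bound (abs_mul_bound (by norm_num : |(2:ℝ)| ≤ 2) hA) hG)
          (abs_mul_bound hB hF)).2).2
        nlinarith
      · have := (abs_add_sub_bound (abs_add_sub_bound (abs_mul_bound
          (abs_mul_bound (by norm_num : |(2:ℝ)| ≤ 2) hA) h1) (abs_mul_bound hB h2)).1 hF).1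
        nlinarith)
  refine hpell.trans ?_
  have hM0 : 0 < M := by linarith
  have hNb : (N.natAbs : ℝ) ≤ 32 * M ^ 4 := by
    rw [Nat.cast_natAbs, Int.cast_abs, hN]; push_cast
    have := abs_mul_bound (abs_mul_bound (by norm_num : |(4:ℝ)| ≤ 4) hA) hΘb
    refine this.trans (le_of_eq (by ring))
  have hd : (N.natAbs.divisors.card : ℝ) ≤ K₀ * 32 ^ η * M ^ (4 * η) := by
    refine (hdiv _ (Int.natAbs_ne_zero.2 hN0)).trans ?_
    rw [mul_assoc]
    gcongr
    calc (N.natAbs : ℝ) ^ η ≤ (32 * M ^ 4) ^ η := by gcongr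
      _ = _ := by
        rw [Real.mul_rpow (by norm_num) (by positivity), ← Real.rpow_natCast M 4,
          ← Real.rpow_mul hM0.le]; norm_num
  have hlog : Real.log (8 * M ^ 3) ≤ 8 ^ (2 * η) / (2 * η) * M ^ (8 * η) := by
    have h1 : Real.log (8 * M ^ 3) ≤ (8 * M ^ 3) ^ (2 * η) / (2 * η) :=
      Real.log_le_rpow_div (by positivity) (by positivity)
    refine h1.trans ?_
    rw [Real.mul_rpow (by norm_num) (by positivity), ← Real.rpow_natCast M 3,
      ← Real.rpow_mul hM0.le, mul_div_right_comm]
    exact mul_le_mul_of_nonneg_left (Real.rpow_le_rpow_of_exponent_le hM (by push_cast; linarith))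
      (by positivity)
  have hM1 : 1 ≤ M ^ (8 * η) := Real.one_le_rpow hM (by positivity)
  calc (81 + 24 * Real.log (8 * M ^ 3)) * (N.natAbs.divisors.card : ℝ) ^ 2
      ≤ ((81 + 24 * (8 ^ (2 * η) / (2 * η))) * M ^ (8 * η)) *
          (K₀ * 32 ^ η * M ^ (4 * η)) ^ 2 := by
        gcongr
        nlinarith
    _ = (81 + 24 * (8 ^ (2 * η) / (2 * η))) * (K₀ * 32 ^ η) ^ 2 *
          (M ^ (8 * η) * (M ^ (4 * η)) ^ 2) := by ring
    _ = _ := by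
      rw [← Real.rpow_natCast (M ^ (4 * η)) 2, ← Real.rpow_mul hM0.le, ← Real.rpow_add hM0]
      congr 2
      rw [hη]; push_cast; ring

theorem card_filter_product_le_right {α β : Type*} (s : Finset α) (t : Finset β)
    (p : α × β → Prop) [DecidablePred p] (k : ℕ)
    (h : ∀ b ∈ t, (s.filter fun a => p (a, b)).card ≤ k) :
    ((s ×ˢ t).filter p).card ≤ k * t.card := by
  classical
  refine Finset.card_le_mul_card_image_of_maps_to (f := Prod.snd) ?_ _ fun b hb => ?_
  · intro z hz
    exact (Finset.mem_product.1 (Finset.mem_filter.1 hz).1).2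
  · refine le_trans ?_ (h b hb)
    refine Finset.card_le_card_of_injOn Prod.fst ?_ ?_
    · rintro ⟨a, b'⟩ hz
      simp only [Finset.coe_filter, Finset.mem_product, Set.mem_ofPred_eq, Finset.mem_filter] at hz ⊢
      obtain ⟨⟨⟨h1, h2⟩, h3⟩, rfl⟩ := hz
      exact ⟨h1, h3⟩
    · rintro ⟨a, b'⟩ hz ⟨a', b''⟩ hz' haa
      simp only [Finset.coe_filter, Finset.mem_product, Set.mem_ofPred_eq, Finset.mem_filter] at hz hz' haa
      rw [haa, hz.2, hz'.2]

theorem card_filter_product_le_left {α β : Type*} (s : Finset α) (t : Finset β)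
    (p : α × β → Prop) [DecidablePred p] (k : ℕ)
    (h : ∀ a ∈ s, (t.filter fun b => p (a, b)).card ≤ k) :
    ((s ×ˢ t).filter p).card ≤ k * s.card := by
  classical
  refine le_trans (le_of_eq ?_) (card_filter_product_le_right t s (fun z => p z.swap) k h)
  refine Finset.card_bij (fun z _ => z.swap) ?_ ?_ ?_
  · rintro ⟨a, b⟩ hz
    simpa [and_comm] using hz
  · rintro ⟨a, b⟩ _ ⟨a', b'⟩ _ h
    simpa [and_comm] using h
  · rintro ⟨b, a⟩ hz
    exact ⟨(a, b), by simpa [and_comm] using hz, rfl⟩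

/-- A binary cubic polynomial whose leading form has no `u² v` term. -/
def binCubic (α γ δ a₁ a₂ a₃ b₁ b₂ d : ℤ) (w : ℤ × ℤ) : ℤ :=
  α * w.1 ^ 3 + γ * w.1 * w.2 ^ 2 + δ * w.2 ^ 3 + a₁ * w.1 ^ 2 + a₂ * w.1 * w.2 + a₃ * w.2 ^ 2 +
    b₁ * w.1 + b₂ * w.2 + d

/-- The conic `A s² + B s r + E r² + F s + G r + H` at which a difference of two values of a binary
cubic polynomial vanishes, once the differences `a`, `b` of the arguments are fixed. -/
def diffConic (α γ δ a₁ a₂ a₃ b₁ b₂ a b s r : ℤ) : ℤ :=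
  3 * α * a * s ^ 2 + 2 * γ * b * s * r + (γ * a + 3 * δ * b) * r ^ 2 +
    (4 * a₁ * a + 2 * a₂ * b) * s + (2 * a₂ * a + 4 * a₃ * b) * r +
    (α * a ^ 3 + γ * a * b ^ 2 + δ * b ^ 3 + 4 * b₁ * a + 4 * b₂ * b)

theorem binCubic_sub_binCubic (α γ δ a₁ a₂ a₃ b₁ b₂ d u v u' v' : ℤ) :
    4 * (binCubic α γ δ a₁ a₂ a₃ b₁ b₂ d (u, v) - binCubic α γ δ a₁ a₂ a₃ b₁ b₂ d (u', v')) =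
      diffConic α γ δ a₁ a₂ a₃ b₁ b₂ (u - u') (v - v') (u + u') (v + v') := by
  simp only [binCubic, diffConic]; ring

theorem card_diffConic_zeros_le {α γ δ : ℤ} (hα : α ≠ 0) (hγδ : γ ≠ 0 ∨ δ ≠ 0)
    (a₁ a₂ a₃ b₁ b₂ : ℤ) (J : Finset ℤ) {a b : ℤ} (hab : a ≠ 0 ∨ b ≠ 0) :
    ((J ×ˢ J).filter fun w => diffConic α γ δ a₁ a₂ a₃ b₁ b₂ a b w.1 w.2 = 0).card ≤
      6 * J.card := by
  classical
  by_cases ha : a = 0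
  · have hb : b ≠ 0 := by tauto
    subst ha
    by_cases hδ : δ = 0
    · have hγ : γ ≠ 0 := by tauto
      subst hδ
      have hB : 2 * γ * b ≠ 0 := mul_ne_zero (mul_ne_zero two_ne_zero hγ) hb
      have h1 : ((J ×ˢ J).filter fun w => 2 * γ * b * w.2 + 2 * a₂ * b ≠ 0 ∧
          diffConic α γ 0 a₁ a₂ a₃ b₁ b₂ 0 b w.1 w.2 = 0).card ≤ 5 * J.card := by
        refine card_filter_product_le_right _ _ _ _ fun r _ => ?_
        by_cases hr : 2 * γ * b * r + 2 * a₂ * b = 0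
        · simp [hr]
        refine card_zeros_le_five (4 * a₃ * b * r + 4 * b₂ * b) (2 * γ * b * r + 2 * a₂ * b)
          0 0 0 0 (by tauto) _ fun s hs => ?_
        have := (Finset.mem_filter.1 hs).2.2
        simp only [diffConic] at this
        linear_combination this
      have h2 : ((J ×ˢ J).filter fun w => 2 * γ * b * w.2 + 2 * a₂ * b = 0).card ≤ 1 * J.card := by
        refine card_filter_product_le_left _ _ _ _ fun s _ => ?_
        refine Finset.card_le_one.2 fun r hr r' hr' => ?_
        have e1 := (Finset.mem_filter.1 hr).2
        have e2 := (Finset.mem_filter.1 hr').2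
        simp only at e1 e2
        exact mul_left_cancel₀ hB (by linarith)
      calc _ ≤ (((J ×ˢ J).filter fun w => 2 * γ * b * w.2 + 2 * a₂ * b ≠ 0 ∧
          diffConic α γ 0 a₁ a₂ a₃ b₁ b₂ 0 b w.1 w.2 = 0) ∪
          ((J ×ˢ J).filter fun w => 2 * γ * b * w.2 + 2 * a₂ * b = 0)).card := by
            refine Finset.card_le_card fun w hw => ?_
            simp only [Finset.mem_union, Finset.mem_filter] at hw ⊢
            tauto
        _ ≤ _ := (Finset.card_union_le _ _).trans (by omega)
    · refine (card_filter_product_le_left _ _ _ 5 fun s _ => ?_).trans (by omega)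
      refine card_zeros_le_five ((2 * a₂ * b) * s + (δ * b ^ 3 + 4 * b₂ * b))
        (2 * γ * b * s + 4 * a₃ * b) (3 * δ * b) 0 0 0
        (Or.inr (Or.inr (Or.inl (mul_ne_zero (mul_ne_zero (by norm_num) hδ) hb)))) _ fun r hr => ?_
      have := (Finset.mem_filter.1 hr).2
      simp only [diffConic] at this
      linear_combination this
  · refine (card_filter_product_le_right _ _ _ 5 fun r _ => ?_).trans (by omega)
    refine card_zeros_le_five ((γ * a + 3 * δ * b) * r ^ 2 + (2 * a₂ * a + 4 * a₃ * b) * r +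
      (α * a ^ 3 + γ * a * b ^ 2 + δ * b ^ 3 + 4 * b₁ * a + 4 * b₂ * b))
      (2 * γ * b * r + (4 * a₁ * a + 2 * a₂ * b)) (3 * α * a) 0 0 0
      (Or.inr (Or.inr (Or.inl (mul_ne_zero (mul_ne_zero (by norm_num) hα) ha)))) _ fun s hs => ?_
    have := (Finset.mem_filter.1 hs).2
    simp only [diffConic] at this
    linear_combination this

/-- The discriminant of the quadratic part of `diffConic`. -/
def diffConicDisc (α γ δ a b : ℤ) : ℤ :=
  (2 * γ * b) ^ 2 - 4 * (3 * α * a) * (γ * a + 3 * δ * b)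

/-- Up to a constant factor, the determinant of `diffConic`. -/
def diffConicDet (α γ δ a₁ a₂ a₃ b₁ b₂ a b : ℤ) : ℤ :=
  (3 * α * a) * (2 * a₂ * a + 4 * a₃ * b) ^ 2 -
    (2 * γ * b) * (4 * a₁ * a + 2 * a₂ * b) * (2 * a₂ * a + 4 * a₃ * b) +
    (γ * a + 3 * δ * b) * (4 * a₁ * a + 2 * a₂ * b) ^ 2 +
    ((2 * γ * b) ^ 2 - 4 * (3 * α * a) * (γ * a + 3 * δ * b)) *
      (α * a ^ 3 + γ * a * b ^ 2 + δ * b ^ 3 + 4 * b₁ * a + 4 * b₂ * b)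

theorem card_degenerate_diffConic_le {α γ δ : ℤ} (hα : α ≠ 0) (hγδ : γ ≠ 0 ∨ δ ≠ 0)
    (a₁ a₂ a₃ b₁ b₂ : ℤ) (J : Finset ℤ) :
    ((J ×ˢ J).filter fun w => w.1 = 0 ∨ diffConicDisc α γ δ w.1 w.2 = 0 ∨
      diffConicDet α γ δ a₁ a₂ a₃ b₁ b₂ w.1 w.2 = 0).card ≤ 12 * J.card := by
  classical
  have h1 : ((J ×ˢ J).filter fun w => w.2 ≠ 0 ∧ (w.1 = 0 ∨ diffConicDisc α γ δ w.1 w.2 = 0 ∨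
      diffConicDet α γ δ a₁ a₂ a₃ b₁ b₂ w.1 w.2 = 0)).card ≤ 11 * J.card := by
    refine card_filter_product_le_right _ _ _ _ fun b _ => ?_
    by_cases hb : b = 0
    · simp [hb]
    have k1 : (J.filter fun a => a = 0).card ≤ 1 :=
      Finset.card_le_one.2 fun x hx y hy => by
        rw [(Finset.mem_filter.1 hx).2, (Finset.mem_filter.1 hy).2]
    have k2 : (J.filter fun a => diffConicDisc α γ δ a b = 0).card ≤ 5 := by
      refine card_zeros_le_five (4 * γ ^ 2 * b ^ 2) (-36 * α * δ * b) (-12 * α * γ) 0 0 0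
        ?_ _ fun a ha => ?_
      · by_cases hγ : γ = 0
        · have hδ : δ ≠ 0 := by tauto
          refine Or.inr (Or.inl ?_)
          simp [hα, hδ, hb]
        · refine Or.inr (Or.inr (Or.inl ?_))
          simp [hα, hγ]
      · have := (Finset.mem_filter.1 ha).2
        simp only [diffConicDisc] at this
        linear_combination this
    have k3 : (J.filter fun a => diffConicDet α γ δ a₁ a₂ a₃ b₁ b₂ a b = 0).card ≤ 5 := by
      refine card_zeros_le_five
        (-16 * γ * a₂ * a₃ * b ^ 3 + 12 * δ * a₂ ^ 2 * b ^ 3 +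
          4 * γ ^ 2 * b ^ 2 * (δ * b ^ 3 + 4 * b₂ * b))
        (48 * α * a₃ ^ 2 * b ^ 2 - 2 * γ * b * (16 * a₁ * a₃ * b + 4 * a₂ ^ 2 * b) +
          4 * γ * a₂ ^ 2 * b ^ 2 + 48 * δ * a₁ * a₂ * b ^ 2 -
          36 * α * δ * b * (δ * b ^ 3 + 4 * b₂ * b) + 4 * γ ^ 2 * b ^ 2 * (γ * b ^ 2 + 4 * b₁))
        (48 * α * a₂ * a₃ * b - 16 * γ * a₁ * a₂ * b + 16 * γ * a₁ * a₂ * b +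
          48 * δ * a₁ ^ 2 * b - 12 * α * γ * (δ * b ^ 3 + 4 * b₂ * b) -
          36 * α * δ * b * (γ * b ^ 2 + 4 * b₁))
        (12 * α * a₂ ^ 2 + 16 * γ * a₁ ^ 2 + 4 * γ ^ 2 * b ^ 2 * α -
          12 * α * γ * (γ * b ^ 2 + 4 * b₁))
        (-36 * α ^ 2 * δ * b) (-12 * α ^ 2 * γ) ?_ _ fun a ha => ?_
      · by_cases hγ : γ = 0
        · have hδ : δ ≠ 0 := by tauto
          refine Or.inr (Or.inr (Or.inr (Or.inr (Or.inl ?_))))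
          simp [hα, hδ, hb]
        · refine Or.inr (Or.inr (Or.inr (Or.inr (Or.inr ?_))))
          simp [hα, hγ]
      · have := (Finset.mem_filter.1 ha).2
        simp only [diffConicDet] at this
        linear_combination this
    calc _ ≤ ((J.filter fun a => a = 0) ∪ ((J.filter fun a => diffConicDisc α γ δ a b = 0) ∪
        (J.filter fun a => diffConicDet α γ δ a₁ a₂ a₃ b₁ b₂ a b = 0))).card := by
          refine Finset.card_le_card fun w hw => ?_
          simp only [Finset.mem_union, Finset.mem_filter] at hw ⊢
          tauto
      _ ≤ _ := (Finset.card_union_le _ _).trans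
          (add_le_add k1 ((Finset.card_union_le _ _).trans (add_le_add k2 k3)))
  have h2 : ((J ×ˢ J).filter fun w => w.2 = 0).card ≤ 1 * J.card := by
    refine card_filter_product_le_left _ _ _ _ fun a _ => ?_
    exact Finset.card_le_one.2 fun x hx y hy =>
      (Finset.mem_filter.1 hx).2.trans (Finset.mem_filter.1 hy).2.symm
  calc _ ≤ (((J ×ˢ J).filter fun w => w.2 ≠ 0 ∧ (w.1 = 0 ∨ diffConicDisc α γ δ w.1 w.2 = 0 ∨
      diffConicDet α γ δ a₁ a₂ a₃ b₁ b₂ w.1 w.2 = 0)) ∪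
      ((J ×ˢ J).filter fun w => w.2 = 0)).card := by
        refine Finset.card_le_card fun w hw => ?_
        simp only [Finset.mem_union, Finset.mem_filter] at hw ⊢
        tauto
    _ ≤ _ := (Finset.card_union_le _ _).trans (by omega)

/-- The additive energy of the values of a binary cubic polynomial in a box. -/
theorem exists_card_binCubic_coincidence_le {α γ δ : ℤ} (hα : α ≠ 0) (hγδ : γ ≠ 0 ∨ δ ≠ 0)
    (κ : ℝ) (hκ : 1 ≤ κ) (ε : ℝ) (hε : 0 < ε) :
    ∃ K : ℝ, 0 < K ∧ ∀ (U : ℕ), 1 ≤ U → ∀ a₁ a₂ a₃ b₁ b₂ d : ℤ,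
      |(a₁ : ℝ)| ≤ κ * U → |(a₂ : ℝ)| ≤ κ * U → |(a₃ : ℝ)| ≤ κ * U →
      |(b₁ : ℝ)| ≤ κ * U ^ 2 → |(b₂ : ℝ)| ≤ κ * U ^ 2 →
      let I : Finset ℤ := Finset.Icc (-U : ℤ) U
      (((((I ×ˢ I) ×ˢ (I ×ˢ I)).filter fun z => binCubic α γ δ a₁ a₂ a₃ b₁ b₂ d z.1 =
        binCubic α γ δ a₁ a₂ a₃ b₁ b₂ d z.2).card : ℕ) : ℝ) ≤ K * (U : ℝ) ^ (2 + ε) := by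
  classical
  obtain ⟨K₁, hK₁, hconic⟩ := exists_card_conic_le (ε / 3) (by positivity)
  set C : ℝ := 20 * (|(α : ℝ)| + |(γ : ℝ)| + |(δ : ℝ)| + κ + 1) with hC
  have hC1 : 20 ≤ C := by
    have := abs_nonneg (α : ℝ); have := abs_nonneg (γ : ℝ); have := abs_nonneg (δ : ℝ)
    rw [hC]; linarith
  refine ⟨25 * (K₁ * C ^ (ε / 3)) + 73 * 25, by positivity, ?_⟩
  intro U hU a₁ a₂ a₃ b₁ b₂ d ha₁ ha₂ ha₃ hb₁ hb₂ I
  have hU1 : (1 : ℝ) ≤ U := by exact_mod_cast hU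
  set J : Finset ℤ := Finset.Icc (-(2 * U) : ℤ) (2 * U) with hJ
  have hJcard : J.card = 4 * U + 1 := by rw [hJ, Int.card_Icc]; omega
  set c : ℤ × ℤ → ℕ := fun ab => ((J ×ˢ J).filter fun w =>
    diffConic α γ δ a₁ a₂ a₃ b₁ b₂ ab.1 ab.2 w.1 w.2 = 0).card with hc
  have hstep : (((I ×ˢ I) ×ˢ (I ×ˢ I)).filter fun z => binCubic α γ δ a₁ a₂ a₃ b₁ b₂ d z.1 =
      binCubic α γ δ a₁ a₂ a₃ b₁ b₂ d z.2).card ≤ ∑ ab ∈ J ×ˢ J, c ab := by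
    rw [hc, ← Finset.card_sigma]
    refine Finset.card_le_card_of_injOn
      (fun z => ⟨(z.1.1 - z.2.1, z.1.2 - z.2.2), (z.1.1 + z.2.1, z.1.2 + z.2.2)⟩) ?_ ?_
    · rintro ⟨⟨u, v⟩, ⟨u', v'⟩⟩ hz
      simp only [Finset.coe_filter, Finset.mem_product, Set.mem_ofPred_eq, I, Finset.mem_Icc] at hz
      have h := binCubic_sub_binCubic α γ δ a₁ a₂ a₃ b₁ b₂ d u v u' v'
      rw [hz.2, sub_self, mul_zero] at h
      simp only [Finset.coe_sigma, Set.mem_sigma_iff, Finset.mem_coe, Finset.mem_product, hJ,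
        Finset.mem_Icc, Finset.mem_filter]
      refine ⟨by omega, by omega, h.symm⟩
    · rintro ⟨⟨u, v⟩, ⟨u', v'⟩⟩ _ ⟨⟨x, y⟩, ⟨x', y'⟩⟩ _ h
      simp only [Sigma.mk.injEq, Prod.mk.injEq, heq_eq_eq] at h ⊢
      omega
  set L : ℝ := K₁ * (C * U ^ 3) ^ (ε / 3) with hL
  have hL0 : 0 ≤ L := by positivity
  set bad : ℤ × ℤ → Prop := fun w => w.1 = 0 ∨ diffConicDisc α γ δ w.1 w.2 = 0 ∨
      diffConicDet α γ δ a₁ a₂ a₃ b₁ b₂ w.1 w.2 = 0 with hbad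
  have hJabs : ∀ x ∈ J, |(x : ℝ)| ≤ 2 * U := by
    intro x hx
    rw [hJ, Finset.mem_Icc] at hx
    rw [abs_le]
    constructor
    · have : ((-(2 * U) : ℤ) : ℝ) ≤ x := by exact_mod_cast hx.1
      push_cast at this; linarith
    · exact_mod_cast hx.2
  have hgood : ∀ ab ∈ J ×ˢ J, ¬ bad ab → (c ab : ℝ) ≤ L := by
    rintro ⟨a, b⟩ hab hnb
    simp only [hbad, not_or] at hnb
    obtain ⟨ha, hdisc, hdet⟩ := hnb
    have ha' := hJabs a (Finset.mem_product.1 hab).1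
    have hb' := hJabs b (Finset.mem_product.1 hab).2
    have hUU : (U : ℝ) ≤ U ^ 3 := by nlinarith [sq_nonneg (U : ℝ)]
    have hUU2 : (U : ℝ) ^ 2 ≤ U ^ 3 := by nlinarith [sq_nonneg (U : ℝ)]
    have n2 : |(2 : ℝ)| ≤ 2 := by norm_num
    have n3 : |(3 : ℝ)| ≤ 3 := by norm_num
    have n4 : |(4 : ℝ)| ≤ 4 := by norm_num
    have pα := abs_nonneg (α : ℝ)
    have pγ := abs_nonneg (γ : ℝ)
    have pδ := abs_nonneg (δ : ℝ)
    have hpow : ∀ {x : ℝ} (k : ℕ), |x| ≤ 2 * U → |x ^ k| ≤ (2 * U) ^ k := fun k hx => by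
      rw [abs_pow]; gcongr
    have hU3 : (0 : ℝ) < U ^ 3 := by positivity
    have q1 : |(α : ℝ)| * U ≤ |(α : ℝ)| * U ^ 3 := by gcongr
    have q2 : |(γ : ℝ)| * U ≤ |(γ : ℝ)| * U ^ 3 := by gcongr
    have q3 : |(δ : ℝ)| * U ≤ |(δ : ℝ)| * U ^ 3 := by gcongr
    have q4 : κ * U ^ 2 ≤ κ * U ^ 3 := by gcongr
    have q5 : 0 ≤ |(α : ℝ)| * U ^ 3 := by positivity
    have q6 : 0 ≤ |(γ : ℝ)| * U ^ 3 := by positivity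
    have q7 : 0 ≤ |(δ : ℝ)| * U ^ 3 := by positivity
    have q8 : 0 ≤ κ * U ^ 3 := by positivity
    have hCe : C * U ^ 3 = 20 * (|(α : ℝ)| * U ^ 3) + 20 * (|(γ : ℝ)| * U ^ 3) +
      20 * (|(δ : ℝ)| * U ^ 3) + 20 * (κ * U ^ 3) + 20 * U ^ 3 := by rw [hC]; ring
    refine hconic (3 * α * a) (2 * γ * b) (γ * a + 3 * δ * b) (4 * a₁ * a + 2 * a₂ * b)
      (2 * a₂ * a + 4 * a₃ * b) (α * a ^ 3 + γ * a * b ^ 2 + δ * b ^ 3 + 4 * b₁ * a + 4 * b₂ * b)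
      (C * U ^ 3) ?_ ?_ ?_ ?_ ?_ ?_ ?_ ?_ hdisc hdet _ ?_ ?_
    · rw [hCe]; nlinarith
    · push_cast
      have := abs_mul_bound (abs_mul_bound n3 (le_refl |(α : ℝ)|)) ha'
      linarith
    · push_cast
      have := abs_mul_bound (abs_mul_bound n2 (le_refl |(γ : ℝ)|)) hb'
      linarith
    · push_cast
      have := (abs_add_sub_bound (abs_mul_bound (le_refl |(γ : ℝ)|) ha')
        (abs_mul_bound (abs_mul_bound n3 (le_refl |(δ : ℝ)|)) hb')).1
      linarith
    · push_cast
      have := (abs_add_sub_bound (abs_mul_bound (abs_mul_bound n4 ha₁) ha')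
        (abs_mul_bound (abs_mul_bound n2 ha₂) hb')).1
      linarith
    · push_cast
      have := (abs_add_sub_bound (abs_mul_bound (abs_mul_bound n2 ha₂) ha')
        (abs_mul_bound (abs_mul_bound n4 ha₃) hb')).1
      linarith
    · push_cast
      have := (abs_add_sub_bound (abs_add_sub_bound (abs_add_sub_bound (abs_add_sub_bound
        (abs_mul_bound (le_refl |(α : ℝ)|) (hpow 3 ha'))
        (abs_mul_bound (abs_mul_bound (le_refl |(γ : ℝ)|) ha') (hpow 2 hb'))).1
        (abs_mul_bound (le_refl |(δ : ℝ)|) (hpow 3 hb'))).1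
        (abs_mul_bound (abs_mul_bound n4 hb₁) ha')).1
        (abs_mul_bound (abs_mul_bound n4 hb₂) hb')).1
      linarith
    · simp [hα, ha]
    · intro z hz
      have hz := Finset.mem_product.1 (Finset.mem_filter.1 hz).1
      have h1 := hJabs _ hz.1
      have h2 := hJabs _ hz.2
      constructor <;> linarith
    · intro z hz
      have := (Finset.mem_filter.1 hz).2
      simp only [diffConic] at this
      exact this
  have hpt : ∀ ab ∈ J ×ˢ J, (c ab : ℝ) ≤ L + (if bad ab then 6 * (J.card : ℝ) else 0) +
      (if ab = 0 then (J.card : ℝ) ^ 2 else 0) := by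
    intro ab hab
    by_cases h0 : ab = 0
    · have : c ab ≤ J.card ^ 2 := by
        rw [sq, ← Finset.card_product]; exact Finset.card_filter_le _ _
      have h2 : (c ab : ℝ) ≤ (J.card : ℝ) ^ 2 := by exact_mod_cast this
      rw [if_pos h0]
      split_ifs <;> linarith [(Nat.cast_nonneg J.card : (0:ℝ) ≤ J.card)]
    · rw [if_neg h0]
      by_cases hb : bad ab
      · have : c ab ≤ 6 * J.card := by
          refine card_diffConic_zeros_le hα hγδ a₁ a₂ a₃ b₁ b₂ J ?_
          by_contra! h
          exact h0 (Prod.ext h.1 h.2)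
        have h2 : (c ab : ℝ) ≤ 6 * (J.card : ℝ) := by exact_mod_cast this
        rw [if_pos hb]; linarith
      · rw [if_neg hb]
        have := hgood ab hab hb
        linarith
  have hbadcard : (((J ×ˢ J).filter bad).card : ℝ) ≤ 12 * J.card := by
    exact_mod_cast card_degenerate_diffConic_le hα hγδ a₁ a₂ a₃ b₁ b₂ J
  have hsum : (∑ ab ∈ J ×ˢ J, (c ab : ℝ)) ≤ (J.card : ℝ) ^ 2 * L + 73 * (J.card : ℝ) ^ 2 := by
    refine (Finset.sum_le_sum hpt).trans ?_
    rw [Finset.sum_add_distrib, Finset.sum_add_distrib, Finset.sum_const, Finset.card_product,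
      nsmul_eq_mul, ← Finset.sum_filter, Finset.sum_const, nsmul_eq_mul]
    have h1 : (∑ ab ∈ J ×ˢ J, if ab = 0 then (J.card : ℝ) ^ 2 else 0) ≤ (J.card : ℝ) ^ 2 := by
      rw [Finset.sum_ite_eq']
      split_ifs
      · exact le_rfl
      · positivity
    have h2 : (((J ×ˢ J).filter bad).card : ℝ) * (6 * J.card) ≤ 12 * J.card * (6 * J.card) := by
      gcongr
    push_cast
    nlinarith
  have hn5 : (J.card : ℝ) ^ 2 ≤ 25 * U ^ 2 := by
    rw [hJcard]; push_cast; nlinarith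
  have hLe : L = K₁ * C ^ (ε / 3) * (U : ℝ) ^ ε := by
    rw [hL, Real.mul_rpow (by positivity) (by positivity), ← Real.rpow_natCast (U : ℝ) 3,
      ← Real.rpow_mul (by positivity)]
    push_cast
    rw [show 3 * (ε / 3) = ε by ring]; ring
  have hUε : 1 ≤ (U : ℝ) ^ ε := Real.one_le_rpow hU1 hε.le
  calc _ ≤ (∑ ab ∈ J ×ˢ J, (c ab : ℝ)) := by exact_mod_cast hstep
    _ ≤ (J.card : ℝ) ^ 2 * L + 73 * (J.card : ℝ) ^ 2 := hsum
    _ ≤ (25 * U ^ 2) * L + 73 * (25 * U ^ 2) * (U : ℝ) ^ ε := by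
        refine add_le_add (by gcongr) ?_
        have : 73 * (J.card : ℝ) ^ 2 ≤ 73 * (25 * U ^ 2) := by linarith
        refine this.trans (le_mul_of_one_le_right (by positivity) hUε)
    _ = _ := by
        rw [hLe, Real.rpow_add (by linarith), Real.rpow_two]; ring

theorem sq_dvd_sub_or_add {q : ℕ} (hq : q.Prime) (hq2 : q ≠ 2) {a b : ℤ} (ha : ¬ (q : ℤ) ∣ a)
    (h : (q : ℤ) ^ 2 ∣ a ^ 2 - b ^ 2) : (q : ℤ) ^ 2 ∣ a - b ∨ (q : ℤ) ^ 2 ∣ a + b := by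
  have hqp : Prime (q : ℤ) := Nat.prime_iff_prime_int.1 hq
  have hf : (q : ℤ) ^ 2 ∣ (a - b) * (a + b) := h.trans (dvd_of_eq (by ring))
  by_cases h1 : (q : ℤ) ∣ a - b
  · left
    have h2 : ¬ (q : ℤ) ∣ a + b := by
      intro h2
      have : (q : ℤ) ∣ 2 * a := (dvd_add h1 h2).trans (dvd_of_eq (by ring))
      rcases hqp.dvd_or_dvd this with h3 | h3
      · have : q ∣ 2 := by exact_mod_cast h3
        exact hq2 ((Nat.prime_dvd_prime_iff_eq hq Nat.prime_two).1 this)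
      · exact ha h3
    exact (hqp.coprime_iff_not_dvd.2 h2).pow_left.dvd_of_dvd_mul_right hf
  · right
    exact (hqp.coprime_iff_not_dvd.2 h1).pow_left.dvd_of_dvd_mul_left hf

/-- The primes in `[R, 2 * R)`. -/
def dyadicPrimes (R : ℕ) : Finset ℕ := (Finset.Ico R (2 * R)).filter Nat.Prime

/-- The nonzero integers of absolute value at most `M`. -/
noncomputable def nonzeroIcc (M : ℕ) : Finset ℤ := (Finset.Icc (-M : ℤ) M).erase 0

theorem mem_dyadicPrimes {R p : ℕ} : p ∈ dyadicPrimes R ↔ (R ≤ p ∧ p < 2 * R) ∧ p.Prime := by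
  simp [dyadicPrimes]

theorem card_dyadicPrimes_le (R : ℕ) : (dyadicPrimes R).card ≤ R := by
  refine (Finset.card_filter_le _ _).trans ?_
  simp; omega

theorem mem_nonzeroIcc {M : ℕ} {m : ℤ} : m ∈ nonzeroIcc M ↔ m ≠ 0 ∧ -(M : ℤ) ≤ m ∧ m ≤ M := by
  simp [nonzeroIcc]

theorem card_nonzeroIcc (M : ℕ) : (nonzeroIcc M).card = 2 * M := by
  rw [nonzeroIcc, Finset.card_erase_of_mem (by simp), Int.card_Icc]; omega

theorem not_dvd_of_ne {q p : ℕ} (hq : q.Prime) (hp : p.Prime) (h : p ≠ q) : ¬ (q : ℤ) ∣ p := by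
  intro hd
  exact h ((Nat.prime_dvd_prime_iff_eq hq hp).1 (by exact_mod_cast hd)).symm

theorem card_unit_pairs_le {q R : ℕ} (hR : 3 ≤ R) (hq : q ∈ dyadicPrimes R) {m m' : ℤ}
    (hm : ¬ (q : ℤ) ∣ m) (hm' : ¬ (q : ℤ) ∣ m') :
    ((dyadicPrimes R ×ˢ dyadicPrimes R).filter fun z => z.1 ≠ z.2 ∧ z.1 ≠ q ∧ z.2 ≠ q ∧
      (q : ℤ) ^ 2 ∣ m * (z.1 : ℤ) ^ 2 - m' * (z.2 : ℤ) ^ 2).card ≤ 12 := by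
  classical
  set S := (dyadicPrimes R ×ˢ dyadicPrimes R).filter fun z => z.1 ≠ z.2 ∧ z.1 ≠ q ∧ z.2 ≠ q ∧
      (q : ℤ) ^ 2 ∣ m * (z.1 : ℤ) ^ 2 - m' * (z.2 : ℤ) ^ 2 with hS
  rcases S.eq_empty_or_nonempty with h | ⟨z₀, hz₀⟩
  · simp [h]
  obtain ⟨⟨hRq, hqR⟩, hqp⟩ := mem_dyadicPrimes.1 hq
  have hqi : Prime (q : ℤ) := Nat.prime_iff_prime_int.1 hqp
  have hmem : ∀ z ∈ S, (R ≤ z.1 ∧ z.1 < 2 * R) ∧ (R ≤ z.2 ∧ z.2 < 2 * R) ∧ z.1.Prime ∧ z.2.Prime ∧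
      z.1 ≠ z.2 ∧ z.1 ≠ q ∧ z.2 ≠ q ∧
      (q : ℤ) ^ 2 ∣ m * (z.1 : ℤ) ^ 2 - m' * (z.2 : ℤ) ^ 2 := by
    intro z hz
    obtain ⟨h1, h2⟩ := Finset.mem_filter.1 hz
    obtain ⟨h3, h4⟩ := Finset.mem_product.1 h1
    obtain ⟨h3, h5⟩ := mem_dyadicPrimes.1 h3
    obtain ⟨h4, h6⟩ := mem_dyadicPrimes.1 h4
    exact ⟨h3, h4, h5, h6, h2⟩
  have hsign : ∀ z ∈ S, (q : ℤ) ^ 2 ∣ (z₀.1 : ℤ) * z.2 - z₀.2 * z.1 ∨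
      (q : ℤ) ^ 2 ∣ (z₀.1 : ℤ) * z.2 + z₀.2 * z.1 := by
    intro z hz
    obtain ⟨-, -, p1, p2, -, n1, n2, hd⟩ := hmem z hz
    obtain ⟨-, -, p1', p2', -, n1', n2', hd'⟩ := hmem z₀ hz₀
    refine sq_dvd_sub_or_add hqp (by omega) ?_ ?_
    · intro h
      rcases hqi.dvd_or_dvd h with h | h
      · exact not_dvd_of_ne hqp p1' n1' h
      · exact not_dvd_of_ne hqp p2 n2 h
    · have h1 : (q : ℤ) ^ 2 ∣ (m * m') * (((z₀.1 : ℤ) * z.2) ^ 2 - (z₀.2 * z.1) ^ 2) :=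
        ((hd'.mul_left (m' * z.2 ^ 2)).sub (hd.mul_left (m' * z₀.2 ^ 2))).trans
          (dvd_of_eq (by ring))
      refine IsCoprime.dvd_of_dvd_mul_left ?_ h1
      exact (IsCoprime.mul_right (hqi.coprime_iff_not_dvd.2 hm)
        (hqi.coprime_iff_not_dvd.2 hm')).pow_left
  set F : ℕ × ℕ → Bool × ℕ := fun z =>
    (decide ((q : ℤ) ^ 2 ∣ (z₀.1 : ℤ) * z.2 - z₀.2 * z.1), 4 * z.2 / z.1) with hF
  have hmaps : Set.MapsTo F S ((Finset.univ : Finset Bool) ×ˢ Finset.Icc 2 7 : Finset _) := by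
    intro z hz
    obtain ⟨h1, h2, p1, p2, -⟩ := hmem z hz
    simp only [hF, Finset.coe_product, Set.mem_prod, Finset.mem_coe, Finset.mem_univ, true_and,
      Finset.mem_Icc]
    rw [Nat.le_div_iff_mul_le p1.pos]
    refine ⟨by omega, Nat.lt_succ_iff.1 ((Nat.div_lt_iff_lt_mul p1.pos).2 (by omega))⟩
  have hinj : Set.InjOn F S := by
    intro z hz z' hz' h
    simp only [hF, Prod.mk.injEq, decide_eq_decide] at h
    obtain ⟨hσ, hk⟩ := h
    obtain ⟨h1, h2, p1, p2, hne, n1, n2, -⟩ := hmem z hz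
    obtain ⟨h1', h2', p1', p2', hne', n1', n2', -⟩ := hmem z' hz'
    obtain ⟨-, -, p10, p20, -, n10, n20, -⟩ := hmem z₀ hz₀
    have hdv : (q : ℤ) ^ 2 ∣ z₀.1 * ((z'.1 : ℤ) * z.2 - z.1 * z'.2) := by
      by_cases hs : (q : ℤ) ^ 2 ∣ (z₀.1 : ℤ) * z.2 - z₀.2 * z.1
      · exact ((hs.mul_left (z'.1 : ℤ)).sub ((hσ.1 hs).mul_left (z.1 : ℤ))).trans
          (dvd_of_eq (by ring))
      · have hs1 := (hsign z hz).resolve_left hs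
        have hs2 := (hsign z' hz').resolve_left (fun h => hs (hσ.2 h))
        exact ((hs1.mul_left (z'.1 : ℤ)).sub (hs2.mul_left (z.1 : ℤ))).trans
          (dvd_of_eq (by ring))
    have hdv2 : (q : ℤ) ^ 2 ∣ (z'.1 : ℤ) * z.2 - z.1 * z'.2 :=
      ((hqi.coprime_iff_not_dvd.2 (not_dvd_of_ne hqp p10 n10)).pow_left).dvd_of_dvd_mul_left hdv
    have hz0 : (z'.1 : ℤ) * z.2 - z.1 * z'.2 = 0 := by
      refine Int.eq_zero_of_abs_lt_dvd hdv2 ?_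
      set k := 4 * z.2 / z.1 with hkdef
      have a1 : k * z.1 ≤ 4 * z.2 := Nat.div_mul_le_self _ _
      have a2 : 4 * z.2 < (k + 1) * z.1 := (Nat.div_lt_iff_lt_mul p1.pos).1 (Nat.lt_succ_self _)
      have a3 : k * z'.1 ≤ 4 * z'.2 := by rw [hk]; exact Nat.div_mul_le_self _ _
      have a4 : 4 * z'.2 < (k + 1) * z'.1 := (Nat.div_lt_iff_lt_mul p1'.pos).1 (by rw [← hk]; exact Nat.lt_succ_self _)
      zify at a1 a2 a3 a4
      have b1 : (z.1 : ℤ) < 2 * R := by exact_mod_cast h1.2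
      have b2 : (z'.1 : ℤ) < 2 * R := by exact_mod_cast h1'.2
      have b3 : (R : ℤ) ≤ q := by exact_mod_cast hRq
      have b4 : (0 : ℤ) < z.1 := by exact_mod_cast p1.pos
      have b5 : (0 : ℤ) < z'.1 := by exact_mod_cast p1'.pos
      have b6 : (z.1 : ℤ) * z'.1 < 4 * q ^ 2 := by nlinarith
      rw [abs_lt]
      constructor <;> nlinarith
    have hmul : z'.1 * z.2 = z.1 * z'.2 := by
      have : (z'.1 : ℤ) * z.2 = z.1 * z'.2 := by linarith
      exact_mod_cast this
    have hd1 : z.1 ∣ z'.1 * z.2 := ⟨_, hmul⟩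
    have e1 : z.1 = z'.1 := by
      rcases p1.dvd_mul.1 hd1 with h | h
      · exact (Nat.prime_dvd_prime_iff_eq p1 p1').1 h
      · exact absurd ((Nat.prime_dvd_prime_iff_eq p1 p2).1 h) hne
    have e2 : z.2 = z'.2 := by
      rw [e1] at hmul
      exact Nat.eq_of_mul_eq_mul_left p1'.pos hmul
    exact Prod.ext e1 e2
  exact (Finset.card_le_card_of_injOn F hmaps hinj).trans (by simp)

theorem card_translates_le {q M : ℕ} (hM : M < q ^ 2) (m : ℤ) (hm : m ∈ nonzeroIcc M) :
    ((nonzeroIcc M).filter fun m' => (q : ℤ) ^ 2 ∣ m - m').card ≤ 3 := by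
  classical
  have hq : (0 : ℤ) < q ^ 2 := by
    have : 0 < q ^ 2 := by omega
    exact_mod_cast this
  have hMq : (M : ℤ) < q ^ 2 := by exact_mod_cast hM
  obtain ⟨-, hm1, hm2⟩ := mem_nonzeroIcc.1 hm
  refine (Finset.card_le_card_of_injOn (t := Finset.Icc (-1 : ℤ) 1)
    (fun m' => (m - m') / (q : ℤ) ^ 2) ?_ ?_).trans (by simp)
  · intro m' hm'
    obtain ⟨h1, k, hk⟩ := Finset.mem_filter.1 hm'
    obtain ⟨-, h2, h3⟩ := mem_nonzeroIcc.1 h1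
    simp only [Finset.coe_Icc, Set.mem_Icc, hk, Int.mul_ediv_cancel_left _ hq.ne']
    constructor <;> by_contra! h <;> nlinarith
  · intro a ha b hb h
    obtain ⟨h1, k, hk⟩ := Finset.mem_filter.1 ha
    obtain ⟨h1', k', hk'⟩ := Finset.mem_filter.1 hb
    simp only [hk, hk', Int.mul_ediv_cancel_left _ hq.ne'] at h
    rw [h] at hk
    linarith

theorem card_sqrt_pairs_le {q R : ℕ} (hq : q ∈ dyadicPrimes R) {m m' : ℤ}
    (hm' : ¬ (q : ℤ) ∣ m') :
    ((dyadicPrimes R ×ˢ dyadicPrimes R).filter fun z =>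
      (q : ℤ) ∣ m * (z.1 : ℤ) ^ 2 - m' * (z.2 : ℤ) ^ 2).card ≤ 2 * (dyadicPrimes R).card := by
  classical
  obtain ⟨⟨hRq, hqR⟩, hqp⟩ := mem_dyadicPrimes.1 hq
  have hqi : Prime (q : ℤ) := Nat.prime_iff_prime_int.1 hqp
  refine card_filter_product_le_left _ _ _ _ fun p _ => ?_
  by_contra! hcon
  obtain ⟨a, b, c, ha, hb, hc, hab, hac, hbc⟩ := Finset.two_lt_card_iff.1 hcon
  have key : ∀ x y : ℕ, x ∈ (dyadicPrimes R).filter (fun b : ℕ =>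
      (q : ℤ) ∣ m * (p : ℤ) ^ 2 - m' * (b : ℤ) ^ 2) → y ∈ (dyadicPrimes R).filter (fun b : ℕ =>
      (q : ℤ) ∣ m * (p : ℤ) ^ 2 - m' * (b : ℤ) ^ 2) → x ≠ y → (q : ℤ) ∣ x + y := by
    intro x y hx hy hxy
    obtain ⟨h1, h2⟩ := Finset.mem_filter.1 hx
    obtain ⟨h3, h4⟩ := Finset.mem_filter.1 hy
    have h1 := (mem_dyadicPrimes.1 h1).1
    have h3 := (mem_dyadicPrimes.1 h3).1
    have : (q : ℤ) ∣ m' * (((x : ℤ) - y) * (x + y)) :=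
      (h4.sub h2).trans (dvd_of_eq (by ring))
    rcases hqi.dvd_or_dvd ((hqi.dvd_or_dvd this).resolve_left hm') with h | h
    · exfalso
      apply hxy
      have : (x : ℤ) - y = 0 := Int.eq_zero_of_abs_lt_dvd h (by rw [abs_lt]; omega)
      omega
    · exact h
  have h := (key a b ha hb hab).sub (key a c ha hc hac)
  have h1 := (mem_dyadicPrimes.1 (Finset.mem_filter.1 hb).1).1
  have h2 := (mem_dyadicPrimes.1 (Finset.mem_filter.1 hc).1).1
  have : (b : ℤ) - c = 0 := Int.eq_zero_of_abs_lt_dvd (h.trans (dvd_of_eq (by ring)))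
    (by rw [abs_lt]; omega)
  omega

theorem card_multiples_le {q M : ℕ} (hq : 0 < q) :
    ((nonzeroIcc M).filter fun m => (q : ℤ) ∣ m).card ≤ 2 * (M / q) := by
  classical
  rw [← card_nonzeroIcc (M / q)]
  have hq0 : (0 : ℤ) < q := by exact_mod_cast hq
  refine Finset.card_le_card_of_injOn (fun m => m / q) ?_ ?_
  · intro m hm
    obtain ⟨h1, k, rfl⟩ := Finset.mem_filter.1 hm
    obtain ⟨h2, h3, h4⟩ := mem_nonzeroIcc.1 h1
    rw [Finset.mem_coe]
    simp only [Int.mul_ediv_cancel_left _ hq0.ne']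
    rw [mem_nonzeroIcc]
    refine ⟨right_ne_zero_of_mul h2, ?_, ?_⟩
    · rw [neg_le]
      push_cast
      rw [Int.le_ediv_iff_mul_le hq0]; linarith
    · push_cast
      rw [Int.le_ediv_iff_mul_le hq0]; linarith
  · intro a ha b hb h
    obtain ⟨-, k, rfl⟩ := Finset.mem_filter.1 ha
    obtain ⟨-, k', rfl⟩ := Finset.mem_filter.1 hb
    simp only [Int.mul_ediv_cancel_left _ hq0.ne'] at h
    rw [h]

/-- The number of congruences `m p² ≡ m' p'²` modulo `q²`, for `q`, `p`, `p'` primes of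
comparable size. -/
theorem card_mul_sq_coincidence_le {q R M : ℕ} (hR : 3 ≤ R) (hq : q ∈ dyadicPrimes R)
    (hM : M < R ^ 2) :
    (((nonzeroIcc M ×ˢ dyadicPrimes R) ×ˢ (nonzeroIcc M ×ˢ dyadicPrimes R)).filter fun z =>
      (q : ℤ) ^ 2 ∣ z.1.1 * (z.1.2 : ℤ) ^ 2 - z.2.1 * (z.2.2 : ℤ) ^ 2).card ≤
      60 * M ^ 2 + 6 * M * R := by
  classical
  obtain ⟨⟨hRq, hqR⟩, hqp⟩ := mem_dyadicPrimes.1 hq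
  have hqi : Prime (q : ℤ) := Nat.prime_iff_prime_int.1 hqp
  have hMq : M < q ^ 2 := hM.trans_le (Nat.pow_le_pow_left hRq 2)
  set V := dyadicPrimes R with hV
  set N := nonzeroIcc M with hN
  set W := (N ×ˢ V) ×ˢ (N ×ˢ V) with hW
  have hNc : N.card = 2 * M := card_nonzeroIcc M
  have hVc : V.card ≤ R := card_dyadicPrimes_le R
  have hVp : ∀ p ∈ V, p.Prime := fun p hp => (mem_dyadicPrimes.1 hp).2
  have hbig : ∀ m ∈ N, ¬ (q : ℤ) ^ 2 ∣ m := by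
    intro m hm h
    obtain ⟨h1, h2, h3⟩ := mem_nonzeroIcc.1 hm
    refine h1 (Int.eq_zero_of_abs_lt_dvd h ?_)
    have : (M : ℤ) < q ^ 2 := by exact_mod_cast hMq
    rw [abs_lt]; constructor <;> linarith
  set S₁ := W.filter fun z => z.1.2 = q ∧ z.2.2 = q with hS₁
  set S₂ := W.filter fun z => (q : ℤ) ^ 2 ∣ z.1.1 - z.2.1 ∧ z.1.2 = z.2.2 with hS₂
  set S₃ := W.filter fun z => (¬ (q : ℤ) ∣ z.1.1 ∧ ¬ (q : ℤ) ∣ z.2.1) ∧ z.1.2 ≠ z.2.2 ∧ z.1.2 ≠ q ∧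
    z.2.2 ≠ q ∧ (q : ℤ) ^ 2 ∣ z.1.1 * (z.1.2 : ℤ) ^ 2 - z.2.1 * (z.2.2 : ℤ) ^ 2 with hS₃
  set S₄ := W.filter fun z => ((q : ℤ) ∣ z.1.1 ∧ (q : ℤ) ∣ z.2.1) ∧
    (q : ℤ) ^ 2 ∣ z.1.1 * (z.1.2 : ℤ) ^ 2 - z.2.1 * (z.2.2 : ℤ) ^ 2 with hS₄
  have c₁ : S₁.card ≤ 4 * M ^ 2 := by
    calc S₁.card ≤ (N ×ˢ N).card := by
          refine Finset.card_le_card_of_injOn (fun z => (z.1.1, z.2.1)) ?_ ?_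
          · intro z hz
            have := (Finset.mem_filter.1 hz).1
            simp only [hW, Finset.mem_product] at this
            exact Finset.mem_product.2 ⟨this.1.1, this.2.1⟩
          · rintro ⟨⟨a, b⟩, ⟨a', b'⟩⟩ hz ⟨⟨x, y⟩, ⟨x', y'⟩⟩ hz' h
            have h1 := (Finset.mem_filter.1 hz).2
            have h2 := (Finset.mem_filter.1 hz').2
            simp only [Prod.mk.injEq] at h h1 h2 ⊢
            omega
      _ = 4 * M ^ 2 := by rw [Finset.card_product, hNc]; ring
  have c₂ : S₂.card ≤ 6 * M * R := by
    have h1 : S₂.card ≤ 3 * (N ×ˢ V).card := by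
      refine card_filter_product_le_left _ _ _ _ fun z hz => ?_
      refine le_trans ?_ (card_translates_le hMq z.1 (Finset.mem_product.1 hz).1)
      refine Finset.card_le_card_of_injOn Prod.fst ?_ ?_
      · rintro ⟨a, b⟩ h
        obtain ⟨h1, h2, h3⟩ := Finset.mem_filter.1 h
        exact Finset.mem_coe.2 (Finset.mem_filter.2 ⟨(Finset.mem_product.1 h1).1, h2⟩)
      · rintro ⟨a, b⟩ h ⟨a', b'⟩ h' haa
        have h1 := (Finset.mem_filter.1 h).2.2
        have h2 := (Finset.mem_filter.1 h').2.2
        simp only at h1 h2 haa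
        rw [haa, ← h1, h2]
    rw [Finset.card_product, hNc] at h1
    calc S₂.card ≤ 3 * (2 * M * V.card) := h1
      _ ≤ 3 * (2 * M * R) := by gcongr
      _ = _ := by ring
  have c₃ : S₃.card ≤ 48 * M ^ 2 := by
    have h1 : S₃.card ≤ 12 * (N ×ˢ N).card := by
      refine Finset.card_le_mul_card_image_of_maps_to (f := fun z => (z.1.1, z.2.1)) ?_ _ ?_
      · intro z hz
        have := (Finset.mem_filter.1 hz).1
        simp only [hW, Finset.mem_product] at this
        exact Finset.mem_product.2 ⟨this.1.1, this.2.1⟩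
      · rintro ⟨m, m'⟩ _
        by_cases hmm : ¬ (q : ℤ) ∣ m ∧ ¬ (q : ℤ) ∣ m'
        · refine le_trans ?_ (card_unit_pairs_le hR hq hmm.1 hmm.2)
          refine Finset.card_le_card_of_injOn (fun z => (z.1.2, z.2.2)) ?_ ?_
          · rintro ⟨⟨a, b⟩, ⟨a', b'⟩⟩ h
            obtain ⟨h3, he⟩ := Finset.mem_filter.1 h
            obtain ⟨hw, -, h2⟩ := Finset.mem_filter.1 h3
            simp only [hW, Finset.mem_product, Prod.mk.injEq] at hw he
            rw [he.1, he.2] at h2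
            exact Finset.mem_coe.2 (Finset.mem_filter.2
              ⟨Finset.mem_product.2 ⟨hw.1.2, hw.2.2⟩, h2⟩)
          · rintro ⟨⟨a, b⟩, ⟨a', b'⟩⟩ h ⟨⟨x, y⟩, ⟨x', y'⟩⟩ h' hb
            have h1 := (Finset.mem_filter.1 h).2
            have h2 := (Finset.mem_filter.1 h').2
            simp only [Prod.mk.injEq] at h1 h2 hb ⊢
            omega
        · rw [Finset.card_eq_zero.2]
          · exact Nat.zero_le _
          · refine Finset.filter_eq_empty_iff.2 fun z hz he => hmm ?_
            have := (Finset.mem_filter.1 hz).2.1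
            simp only [Prod.mk.injEq] at he
            rwa [he.1, he.2] at this
    rw [Finset.card_product, hNc] at h1
    calc S₃.card ≤ 12 * (2 * M * (2 * M)) := h1
      _ = _ := by ring
  have c₄ : S₄.card ≤ 8 * M ^ 2 := by
    set N' := N.filter fun m => (q : ℤ) ∣ m with hN'
    have hN'c : N'.card ≤ 2 * (M / q) := card_multiples_le hqp.pos
    have h1 : S₄.card ≤ (2 * V.card) * (N' ×ˢ N').card := by
      refine Finset.card_le_mul_card_image_of_maps_to (f := fun z => (z.1.1, z.2.1)) ?_ _ ?_
      · intro z hz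
        obtain ⟨h1, h2, -⟩ := Finset.mem_filter.1 hz
        simp only [hW, Finset.mem_product] at h1
        exact Finset.mem_product.2 ⟨Finset.mem_filter.2 ⟨h1.1.1, h2.1⟩,
          Finset.mem_filter.2 ⟨h1.2.1, h2.2⟩⟩
      · rintro ⟨m, m'⟩ hmm
        obtain ⟨hm, hm'⟩ := Finset.mem_product.1 hmm
        obtain ⟨hm, m₀, rfl⟩ := Finset.mem_filter.1 hm
        obtain ⟨hm', m₀', rfl⟩ := Finset.mem_filter.1 hm'
        have hnd : ¬ (q : ℤ) ∣ m₀' := fun h => hbig _ hm' (by rw [sq]; exact mul_dvd_mul_left _ h)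
        refine le_trans ?_ (card_sqrt_pairs_le hq (m := m₀) hnd)
        refine Finset.card_le_card_of_injOn (fun z => (z.1.2, z.2.2)) ?_ ?_
        · rintro ⟨⟨a, b⟩, ⟨a', b'⟩⟩ h
          obtain ⟨h, he⟩ := Finset.mem_filter.1 h
          obtain ⟨h, -, h2⟩ := Finset.mem_filter.1 h
          simp only [hW, Finset.mem_product, Prod.mk.injEq] at h he h2
          obtain ⟨rfl, rfl⟩ := he
          refine Finset.mem_coe.2 (Finset.mem_filter.2
            ⟨Finset.mem_product.2 ⟨h.1.2, h.2.2⟩, ?_⟩)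
          refine Int.dvd_of_mul_dvd_mul_left hqi.ne_zero ?_
          rw [← sq]
          exact h2.trans (dvd_of_eq (by ring))
        · rintro ⟨⟨a, b⟩, ⟨a', b'⟩⟩ h ⟨⟨x, y⟩, ⟨x', y'⟩⟩ h' hb
          have h1 := (Finset.mem_filter.1 h).2
          have h2 := (Finset.mem_filter.1 h').2
          simp only [Prod.mk.injEq] at h1 h2 hb ⊢
          refine ⟨⟨h1.1.trans h2.1.symm, hb.1⟩, h1.2.trans h2.2.symm, hb.2⟩
    rw [Finset.card_product] at h1
    have h2 : M / q * q ≤ M := Nat.div_mul_le_self _ _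
    have h3 : M / q ≤ M := Nat.div_le_self _ _
    calc S₄.card ≤ 2 * V.card * (N'.card * N'.card) := h1
      _ ≤ 2 * q * (2 * (M / q) * (2 * (M / q))) := by
          gcongr
          exact hVc.trans hRq
      _ = 8 * (M / q * q) * (M / q) := by ring
      _ ≤ 8 * M * M := by gcongr
      _ = _ := by ring
  calc _ ≤ (S₁ ∪ (S₂ ∪ (S₃ ∪ S₄))).card := by
        refine Finset.card_le_card ?_
        rintro ⟨⟨m, p⟩, ⟨m', p'⟩⟩ hz
        obtain ⟨hz, hd⟩ := Finset.mem_filter.1 hz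
        have hz' := hz
        simp only [hW, Finset.mem_product] at hz
        obtain ⟨⟨hm, hp⟩, ⟨hm', hp'⟩⟩ := hz
        simp only [Finset.mem_union, hS₁, hS₂, hS₃, hS₄, Finset.mem_filter, hz', true_and]
        simp only at hd hm hp hm' hp'
        have hcop : ∀ {p : ℕ}, p ∈ V → p ≠ q → IsCoprime ((q : ℤ) ^ 2) ((p : ℤ) ^ 2) :=
          fun hp h => (hqi.coprime_iff_not_dvd.2 (not_dvd_of_ne hqp (hVp _ hp) h)).pow
        have hndvd : ∀ {p : ℕ}, p ∈ V → p ≠ q → ¬ (q : ℤ) ∣ (p : ℤ) ^ 2 :=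
          fun hp h h' => not_dvd_of_ne hqp (hVp _ hp) h (hqi.dvd_of_dvd_pow h')
        by_cases e : p = q
        · by_cases e' : p' = q
          · exact Or.inl ⟨e, e'⟩
          · exfalso
            subst e
            refine hbig _ hm' ((hcop hp' e').dvd_of_dvd_mul_right ?_)
            exact ((Dvd.intro_left m rfl).sub hd).trans (dvd_of_eq (by ring))
        · by_cases e' : p' = q
          · exfalso
            subst e'
            refine hbig _ hm ((hcop hp e).dvd_of_dvd_mul_right ?_)
            exact (hd.add (Dvd.intro_left m' rfl)).trans (dvd_of_eq (by ring))
          · have hd1 : (q : ℤ) ∣ m * (p : ℤ) ^ 2 - m' * (p' : ℤ) ^ 2 :=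
              (dvd_pow_self _ two_ne_zero).trans hd
            by_cases hqm : (q : ℤ) ∣ m
            · have : (q : ℤ) ∣ m' * (p' : ℤ) ^ 2 :=
                ((hqm.mul_right ((p : ℤ) ^ 2)).sub hd1).trans (dvd_of_eq (by ring))
              have := (hqi.dvd_or_dvd this).resolve_right (hndvd hp' e')
              exact Or.inr (Or.inr (Or.inr ⟨⟨hqm, this⟩, hd⟩))
            · have hqm' : ¬ (q : ℤ) ∣ m' := by
                intro h
                have : (q : ℤ) ∣ m * (p : ℤ) ^ 2 :=
                  (hd1.add (h.mul_right ((p' : ℤ) ^ 2))).trans (dvd_of_eq (by ring))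
                exact hqm ((hqi.dvd_or_dvd this).resolve_right (hndvd hp e))
              by_cases hpp : p = p'
              · subst hpp
                refine Or.inr (Or.inl ⟨(hcop hp e).dvd_of_dvd_mul_right ?_, rfl⟩)
                exact hd.trans (dvd_of_eq (by ring))
              · exact Or.inr (Or.inr (Or.inl ⟨⟨hqm, hqm'⟩, hpp, e, e', hd⟩))
    _ ≤ S₁.card + (S₂.card + (S₃.card + S₄.card)) :=
        (Finset.card_union_le _ _).trans (add_le_add le_rfl ((Finset.card_union_le _ _).trans
          (add_le_add le_rfl (Finset.card_union_le _ _))))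
    _ ≤ _ := by omega

theorem card_fourth_roots_le {q X : ℕ} (hq : q.Prime) (hX : 2 * X + 1 ≤ q) (k : ℤ) :
    ((Finset.Icc (-X : ℤ) X).filter fun x => (q : ℤ) ∣ k - x ^ 4).card ≤ 4 := by
  classical
  have := Fact.mk hq
  refine (Finset.card_le_card_of_injOn (t := (Polynomial.nthRoots 4 (k : ZMod q)).toFinset)
    (fun x : ℤ => (x : ZMod q)) ?_ ?_).trans
    ((Multiset.toFinset_card_le _).trans (Polynomial.card_nthRoots 4 _))
  · intro x hx
    have h := (Finset.mem_filter.1 hx).2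
    rw [Finset.mem_coe, Multiset.mem_toFinset, Polynomial.mem_nthRoots (by norm_num)]
    have := (ZMod.intCast_eq_intCast_iff_dvd_sub (x ^ 4) k q).2 h
    push_cast at this
    exact this
  · intro x hx y hy h
    have h1 := (Finset.mem_filter.1 hx).1
    have h2 := (Finset.mem_filter.1 hy).1
    rw [Finset.mem_Icc] at h1 h2
    have h3 := (ZMod.intCast_eq_intCast_iff_dvd_sub x y q).1 h
    have : y - x = 0 := Int.eq_zero_of_abs_lt_dvd h3 (by rw [abs_lt]; omega)
    omega

theorem card_fourth_coincidence_le {q X : ℕ} (hq : q.Prime) (hX : 2 * X + 1 ≤ q) {c : ℤ}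
    (hc : ¬ (q : ℤ) ∣ c) :
    let B : Finset ℤ := Finset.Icc (-X : ℤ) X
    (((B ×ˢ B) ×ˢ (B ×ˢ B)).filter fun z =>
      ((c * (z.1.1 ^ 4 - z.1.2 ^ 4) : ℤ) : ZMod (q ^ 2)) =
        ((c * (z.2.1 ^ 4 - z.2.2 ^ 4) : ℤ) : ZMod (q ^ 2))).card ≤ 4 * (2 * X + 1) ^ 3 := by
  classical
  intro B
  have hB : B.card = 2 * X + 1 := by simp only [B, Int.card_Icc]; omega
  have hqi : Prime (q : ℤ) := Nat.prime_iff_prime_int.1 hq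
  calc _ ≤ 4 * ((B ×ˢ B) ×ˢ B).card := by
        refine Finset.card_le_mul_card_image_of_maps_to (f := fun z => (z.1, z.2.1)) ?_ _ ?_
        · intro z hz
          have := (Finset.mem_filter.1 hz).1
          simp only [Finset.mem_product] at this ⊢
          exact ⟨this.1, this.2.1⟩
        · rintro ⟨⟨x₁, x₂⟩, x₃⟩ _
          refine le_trans ?_ (card_fourth_roots_le hq hX (x₃ ^ 4 - (x₁ ^ 4 - x₂ ^ 4)))
          refine Finset.card_le_card_of_injOn (fun z => z.2.2) ?_ ?_
          · rintro ⟨⟨a, b⟩, ⟨a', b'⟩⟩ h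
            obtain ⟨h1, he⟩ := Finset.mem_filter.1 h
            obtain ⟨h2, h3⟩ := Finset.mem_filter.1 h1
            simp only [Prod.mk.injEq] at he
            obtain ⟨⟨rfl, rfl⟩, rfl⟩ := he
            simp only [Finset.mem_product] at h2
            refine Finset.mem_coe.2 (Finset.mem_filter.2 ⟨h2.2.2, ?_⟩)
            have h4 := (ZMod.intCast_eq_intCast_iff_dvd_sub _ _ _).1 h3
            push_cast at h4
            have h5 : (q : ℤ) ∣ c * (a' ^ 4 - (a ^ 4 - b ^ 4) - b' ^ 4) :=
              ((dvd_pow_self _ two_ne_zero).trans h4).trans (dvd_of_eq (by ring))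
            exact (hqi.dvd_or_dvd h5).resolve_left hc
          · rintro ⟨⟨a, b⟩, ⟨a', b'⟩⟩ h ⟨⟨x, y⟩, ⟨x', y'⟩⟩ h' hb
            have h1 := (Finset.mem_filter.1 h).2
            have h2 := (Finset.mem_filter.1 h').2
            simp only [Prod.mk.injEq] at h1 h2 hb ⊢
            omega
    _ = _ := by rw [Finset.card_product, Finset.card_product, hB]; ring

/-- The additive energy of the values `m p² - c x⁴`. -/
theorem card_quartic_coincidence_le {X R M : ℕ} (hR : 3 ≤ R) (hX : 2 * X + 1 ≤ R) (hM : M < R ^ 2)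
    {c : ℤ} (hc : c ≠ 0) (hcR : c.natAbs < R) :
    let B := Finset.Icc (-X : ℤ) X ×ˢ (nonzeroIcc M ×ˢ dyadicPrimes R)
    let f : ℤ × ℤ × ℕ → ℤ := fun z => z.2.1 * (z.2.2 : ℤ) ^ 2 - c * z.1 ^ 4
    (((B ×ˢ B).filter fun z => f z.1 = f z.2).card : ℝ) ≤
      R * √(4 * (2 * X + 1) ^ 3 * (60 * M ^ 2 + 6 * M * R)) := by
  classical
  intro B f
  set V := dyadicPrimes R with hV
  set I : Finset ℤ := Finset.Icc (-X : ℤ) X with hI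
  set G : ℕ → Finset ((ℤ × ℤ) × (ℤ × ℕ)) := fun q =>
    ((I ×ˢ I) ×ˢ (nonzeroIcc M ×ˢ V)).filter fun z =>
      ((c * (z.1.1 ^ 4 - z.1.2 ^ 4) : ℤ) : ZMod (q ^ 2)) =
        ((-(z.2.1 * (z.2.2 : ℤ) ^ 2) : ℤ) : ZMod (q ^ 2)) with hG
  have hG1 : ∀ q ∈ V, ((G q).card : ℝ) ≤ √(4 * (2 * X + 1) ^ 3 * (60 * M ^ 2 + 6 * M * R)) := by
    intro q hq
    obtain ⟨⟨hRq, hqR⟩, hqp⟩ := mem_dyadicPrimes.1 hq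
    refine Real.le_sqrt_of_sq_le ?_
    have h1 := card_coincidence_sq_le (I ×ˢ I) (nonzeroIcc M ×ˢ V)
      (fun z => ((c * (z.1 ^ 4 - z.2 ^ 4) : ℤ) : ZMod (q ^ 2)))
      (fun z => ((-(z.1 * (z.2 : ℤ) ^ 2) : ℤ) : ZMod (q ^ 2)))
    have hqc : ¬ (q : ℤ) ∣ c := by
      intro h
      have := Nat.le_of_dvd (Int.natAbs_pos.2 hc) (Int.natCast_dvd.1 h)
      omega
    have h2 := card_fourth_coincidence_le hqp (hX.trans hRq) hqc
    have h3 : (((nonzeroIcc M ×ˢ V) ×ˢ (nonzeroIcc M ×ˢ V)).filter fun z =>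
        ((-(z.1.1 * (z.1.2 : ℤ) ^ 2) : ℤ) : ZMod (q ^ 2)) =
          ((-(z.2.1 * (z.2.2 : ℤ) ^ 2) : ℤ) : ZMod (q ^ 2))).card ≤ 60 * M ^ 2 + 6 * M * R := by
      refine le_trans (Finset.card_le_card ?_) (card_mul_sq_coincidence_le hR hq hM)
      intro z hz
      obtain ⟨h4, h5⟩ := Finset.mem_filter.1 hz
      refine Finset.mem_filter.2 ⟨h4, ?_⟩
      have := (ZMod.intCast_eq_intCast_iff_dvd_sub _ _ _).1 h5
      push_cast at this
      exact this.trans (dvd_of_eq (by ring))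
    have h4 : (G q).card ^ 2 ≤ (4 * (2 * X + 1) ^ 3) * (60 * M ^ 2 + 6 * M * R) :=
      h1.trans (Nat.mul_le_mul h2 h3)
    exact_mod_cast h4
  have hstep : ((B ×ˢ B).filter fun z => f z.1 = f z.2).card ≤ ∑ q ∈ V, (G q).card := by
    rw [← Finset.card_sigma]
    refine Finset.card_le_card_of_injOn
      (fun z => ⟨z.1.2.2, ((z.1.1, z.2.1), z.2.2)⟩) ?_ ?_
    · rintro ⟨⟨x, m, p⟩, ⟨x', m', p'⟩⟩ hz
      obtain ⟨h1, h2⟩ := Finset.mem_filter.1 hz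
      simp only [B, Finset.mem_product] at h1
      simp only [Finset.coe_sigma, Set.mem_sigma_iff, Finset.mem_coe, hG, Finset.mem_filter,
        Finset.mem_product]
      refine ⟨h1.1.2.2, ⟨⟨h1.1.1, h1.2.1⟩, h1.2.2.1, h1.2.2.2⟩, ?_⟩
      rw [ZMod.intCast_eq_intCast_iff_dvd_sub]
      refine ⟨-m, ?_⟩
      simp only [f] at h2
      push_cast
      linear_combination h2
    · rintro ⟨⟨x, m, p⟩, ⟨x', m', p'⟩⟩ hz ⟨⟨y, l, r⟩, ⟨y', l', r'⟩⟩ hz' h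
      simp only [Sigma.mk.injEq, Prod.mk.injEq, heq_eq_eq] at h
      obtain ⟨rfl, ⟨rfl, rfl⟩, rfl, rfl⟩ := h
      obtain ⟨h1, h2⟩ := Finset.mem_filter.1 hz
      obtain ⟨h1', h2'⟩ := Finset.mem_filter.1 hz'
      simp only [B, Finset.mem_product] at h1
      have hp : (p : ℤ) ^ 2 ≠ 0 := by
        have := (mem_dyadicPrimes.1 h1.1.2.2).2.pos
        positivity
      simp only [f] at h2 h2'
      have : m = l := mul_right_cancel₀ hp (by linarith)
      rw [this]
  calc _ ≤ (∑ q ∈ V, ((G q).card : ℝ)) := by exact_mod_cast hstep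
    _ ≤ ∑ q ∈ V, √(4 * (2 * X + 1) ^ 3 * (60 * M ^ 2 + 6 * M * R)) := Finset.sum_le_sum hG1
    _ = V.card * √(4 * (2 * X + 1) ^ 3 * (60 * M ^ 2 + 6 * M * R)) := by
        rw [Finset.sum_const, nsmul_eq_mul]
    _ ≤ _ := by
        gcongr
        exact card_dyadicPrimes_le R

/-- Representations of `c x⁴ + g w` as `m p²` with `p` a prime in a dyadic range, in terms of the
additive energy of `g`. -/
theorem card_large_prime_sq_le {ι : Type*} [DecidableEq ι] (S : Finset ι) (g : ι → ℤ) {X R M : ℕ}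
    (hR : 3 ≤ R) (hX : 2 * X + 1 ≤ R) (hM : M < R ^ 2) {c : ℤ} (hc : c ≠ 0) (hcR : c.natAbs < R)
    (A : Finset (ℤ × ι)) (hA : A ⊆ Finset.Icc (-X : ℤ) X ×ˢ S)
    (hAp : ∀ z ∈ A, ∃ m ∈ nonzeroIcc M, ∃ p ∈ dyadicPrimes R,
      c * z.1 ^ 4 + g z.2 = m * (p : ℤ) ^ 2) :
    (A.card : ℝ) ^ 2 ≤ (((S ×ˢ S).filter fun z => g z.1 = g z.2).card : ℝ) *
      (R * √(4 * (2 * X + 1) ^ 3 * (60 * M ^ 2 + 6 * M * R))) := by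
  classical
  set B := Finset.Icc (-X : ℤ) X ×ˢ (nonzeroIcc M ×ˢ dyadicPrimes R) with hB
  set f : ℤ × ℤ × ℕ → ℤ := fun z => z.2.1 * (z.2.2 : ℤ) ^ 2 - c * z.1 ^ 4 with hf
  choose! m hm p hp hmp using hAp
  have h1 : A.card ≤ ((S ×ˢ B).filter fun z => g z.1 = f z.2).card := by
    refine Finset.card_le_card_of_injOn (fun z => (z.2, z.1, m z, p z)) ?_ ?_
    · intro z hz
      have h2 := Finset.mem_product.1 (hA hz)
      simp only [Finset.coe_filter, Finset.mem_product, Set.mem_ofPred_eq, hB, hf]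
      refine ⟨⟨h2.2, h2.1, hm z hz, hp z hz⟩, ?_⟩
      linarith [hmp z hz]
    · intro z _ z' _ h
      simp only [Prod.mk.injEq] at h
      exact Prod.ext h.2.1 h.1
  have h2 := card_coincidence_sq_le S B g f
  calc (A.card : ℝ) ^ 2 ≤ ((((S ×ˢ B).filter fun z => g z.1 = f z.2).card : ℕ) : ℝ) ^ 2 := by
        gcongr
    _ ≤ (((S ×ˢ S).filter fun z => g z.1 = g z.2).card : ℝ) *
        (((B ×ˢ B).filter fun z => f z.1 = f z.2).card : ℝ) := by exact_mod_cast h2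
    _ ≤ _ := by
        gcongr
        exact card_quartic_coincidence_le hR hX hM hc hcR

theorem dyadic_size_bounds {U X R K₁ c : ℕ} (hK₁ : 1 ≤ K₁) (hc : 1 ≤ c)
    (hU : 10 ^ 9 * K₁ ^ 2 * (2 * c) ^ 8 ≤ U) (hX : X ^ 4 ≤ (U + 1) ^ 3) (hR : U ^ 7 < (2 * R) ^ 8) :
    3 ≤ R ∧ 2 * X + 1 ≤ R ∧ K₁ * U ^ 3 < R ^ 4 ∧ c < R := by
  have h1 : 1 ≤ K₁ ^ 2 := Nat.one_le_pow _ _ hK₁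
  have h2 : 1 ≤ (2 * c) ^ 8 := Nat.one_le_pow _ _ (by omega)
  have hU9 : 10 ^ 9 ≤ U := by
    calc 10 ^ 9 = 10 ^ 9 * 1 * 1 := by norm_num
      _ ≤ 10 ^ 9 * K₁ ^ 2 * (2 * c) ^ 8 := by gcongr
      _ ≤ U := hU
  have hUK : 256 * K₁ ^ 2 ≤ U := by
    calc 256 * K₁ ^ 2 = 256 * K₁ ^ 2 * 1 := by ring
      _ ≤ 10 ^ 9 * K₁ ^ 2 * (2 * c) ^ 8 := by gcongr; norm_num
      _ ≤ U := hU
  have hUc : (2 * c) ^ 8 ≤ U := by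
    calc (2 * c) ^ 8 = 1 * 1 * (2 * c) ^ 8 := by ring
      _ ≤ 10 ^ 9 * K₁ ^ 2 * (2 * c) ^ 8 := by gcongr; norm_num
      _ ≤ U := hU
  have hUpos : 1 ≤ U := by omega
  have hUU : U ≤ U ^ 7 := Nat.le_self_pow (by norm_num) U
  have hR3 : 3 < R := by
    have : 2 * 3 < 2 * R := by
      refine lt_of_pow_lt_pow_left₀ 8 (by omega) ?_
      calc (2 * 3) ^ 8 ≤ U := by omega
        _ ≤ U ^ 7 := hUU
        _ < _ := hR
    omega
  refine ⟨hR3.le, ?_, ?_, ?_⟩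
  · rcases Nat.eq_zero_or_pos X with rfl | hXp
    · omega
    have : 6 * X < 2 * R := by
      refine lt_of_pow_lt_pow_left₀ 8 (by omega) ?_
      calc (6 * X) ^ 8 = 6 ^ 8 * (X ^ 4) ^ 2 := by ring
        _ ≤ 6 ^ 8 * ((U + 1) ^ 3) ^ 2 := by gcongr
        _ ≤ 6 ^ 8 * ((U + U) ^ 3) ^ 2 := by gcongr
        _ = (6 ^ 8 * 64) * U ^ 6 := by ring
        _ ≤ U * U ^ 6 := by gcongr; omega
        _ = U ^ 7 := by ring
        _ < _ := hR
    omega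
  · have : 16 * (K₁ * U ^ 3) < (2 * R) ^ 4 := by
      refine lt_of_pow_lt_pow_left₀ 2 (by positivity) ?_
      calc (16 * (K₁ * U ^ 3)) ^ 2 = 256 * K₁ ^ 2 * U ^ 6 := by ring
        _ ≤ U * U ^ 6 := by gcongr
        _ = U ^ 7 := by ring
        _ < (2 * R) ^ 8 := hR
        _ = ((2 * R) ^ 4) ^ 2 := by ring
    have h : (2 * R) ^ 4 = 16 * R ^ 4 := by ring
    omega
  · have : 2 * c < 2 * R := by
      refine lt_of_pow_lt_pow_left₀ 8 (by omega) ?_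
      calc (2 * c) ^ 8 ≤ U := hUc
        _ ≤ U ^ 7 := hUU
        _ < _ := hR
    omega

theorem dyadic_main_le {U X R K₁ : ℕ} (hU : 1 ≤ U) (hX : X ^ 4 ≤ (U + 1) ^ 3)
    (hK₁ : 1 ≤ K₁) (hR : U ^ 7 < (2 * R) ^ 8) (hRK : R ^ 2 ≤ K₁ * U ^ 3) {M : ℕ}
    (hM : M * R ^ 2 ≤ K₁ * U ^ 3) :
    (R : ℝ) * √(4 * (2 * X + 1) ^ 3 * (60 * M ^ 2 + 6 * M * R)) ≤
      400 * K₁ * (U : ℝ) ^ (27 / 8 : ℝ) := by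
  have hU1 : (1 : ℝ) ≤ U := by exact_mod_cast hU
  have hU0 : (0 : ℝ) < U := by linarith
  have hK : (1 : ℝ) ≤ K₁ := by exact_mod_cast hK₁
  have hRpos : 0 < R := by
    rcases Nat.eq_zero_or_pos R with rfl | h
    · simp at hR
    · exact h
  have hR0 : (0 : ℝ) < R := by exact_mod_cast hRpos
  set t : ℝ := (U : ℝ) ^ (1 / 8 : ℝ) with ht
  have ht0 : 0 < t := by positivity
  have ht1 : 1 ≤ t := Real.one_le_rpow hU1 (by norm_num)
  have ht8 : (U : ℝ) = t ^ 8 := by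
    rw [ht, ← Real.rpow_natCast, ← Real.rpow_mul hU0.le]; norm_num
  have hX' : (2 * (X : ℝ) + 1) ≤ 5 * t ^ 6 := by
    have h1 : (X : ℝ) ^ 4 ≤ (U + 1) ^ 3 := by exact_mod_cast hX
    have h2 : (X : ℝ) ≤ 2 * t ^ 6 := by
      refine le_of_pow_le_pow_left₀ (n := 4) (by norm_num) (by positivity) (h1.trans ?_)
      calc ((U : ℝ) + 1) ^ 3 ≤ (U + U) ^ 3 := by gcongr
        _ = 8 * t ^ 24 := by rw [ht8]; ring
        _ ≤ 16 * t ^ 24 := by gcongr; norm_num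
        _ = (2 * t ^ 6) ^ 4 := by ring
    have h3 : 1 ≤ t ^ 6 := one_le_pow₀ ht1
    linarith
  have hRl : t ^ 7 ≤ 2 * R := by
    refine le_of_pow_le_pow_left₀ (n := 8) (by norm_num) (by positivity) ?_
    have : (U : ℝ) ^ 7 ≤ (2 * R) ^ 8 := by exact_mod_cast hR.le
    calc (t ^ 7) ^ 8 = (U : ℝ) ^ 7 := by rw [ht8]; ring
      _ ≤ _ := this
  have hRu : (R : ℝ) ≤ K₁ * t ^ 12 := by
    refine le_of_pow_le_pow_left₀ (n := 2) (by norm_num) (by positivity) ?_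
    have h1 : (R : ℝ) ^ 2 ≤ K₁ * U ^ 3 := by exact_mod_cast hRK
    calc (R : ℝ) ^ 2 ≤ K₁ * U ^ 3 := h1
      _ = K₁ * 1 * t ^ 24 := by rw [ht8]; ring
      _ ≤ K₁ * K₁ * t ^ 24 := by gcongr
      _ = (K₁ * t ^ 12) ^ 2 := by ring
  have hM' : (M : ℝ) * R ^ 2 ≤ K₁ * t ^ 24 := by
    have h1 : (M : ℝ) * R ^ 2 ≤ K₁ * U ^ 3 := by exact_mod_cast hM
    rw [ht8] at h1
    exact h1.trans (le_of_eq (by ring))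
  have hMR : (M : ℝ) * R ≤ 2 * K₁ * t ^ 17 := by
    have h1 : (M : ℝ) * R * t ^ 7 ≤ (2 * K₁ * t ^ 17) * t ^ 7 := by
      calc (M : ℝ) * R * t ^ 7 ≤ M * R * (2 * R) := by gcongr
        _ = 2 * (M * R ^ 2) := by ring
        _ ≤ 2 * (K₁ * t ^ 24) := by gcongr
        _ = _ := by ring
    exact le_of_mul_le_mul_right h1 (by positivity)
  have hA : (R : ℝ) ^ 2 * (60 * M ^ 2 + 6 * M * R) ≤ 246 * K₁ ^ 2 * t ^ 36 := by
    calc (R : ℝ) ^ 2 * (60 * M ^ 2 + 6 * M * R) = 60 * (M * R) ^ 2 + 6 * (M * R ^ 2) * R := by ring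
      _ ≤ 60 * (2 * K₁ * t ^ 17) ^ 2 + 6 * (K₁ * t ^ 24) * (K₁ * t ^ 12) := by gcongr
      _ = 240 * K₁ ^ 2 * t ^ 34 + 6 * K₁ ^ 2 * t ^ 36 := by ring
      _ ≤ 240 * K₁ ^ 2 * t ^ 36 + 6 * K₁ ^ 2 * t ^ 36 := by
          gcongr
          norm_num
      _ = _ := by ring
  have h27 : (U : ℝ) ^ (27 / 8 : ℝ) = t ^ 27 := by
    rw [ht, ← Real.rpow_natCast, ← Real.rpow_mul hU0.le]; norm_num
  rw [h27]
  refine le_of_pow_le_pow_left₀ (n := 2) (by norm_num) (by positivity) ?_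
  rw [mul_pow, Real.sq_sqrt (by positivity)]
  calc (R : ℝ) ^ 2 * (4 * (2 * X + 1) ^ 3 * (60 * M ^ 2 + 6 * M * R))
      = 4 * (2 * X + 1) ^ 3 * (R ^ 2 * (60 * M ^ 2 + 6 * M * R)) := by ring
    _ ≤ 4 * (5 * t ^ 6) ^ 3 * (246 * K₁ ^ 2 * t ^ 36) := by gcongr
    _ = 123000 * (K₁ ^ 2 * t ^ 54) := by ring
    _ ≤ 160000 * (K₁ ^ 2 * t ^ 54) := by gcongr; norm_num
    _ = _ := by ring

theorem card_large_prime_dyadic_le {ι : Type*} [DecidableEq ι] (S : Finset ι) (g : ι → ℤ)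
    {U X K₁ i : ℕ} {c : ℤ} {K₂ : ℝ} (hc : c ≠ 0) (hK₁ : 1 ≤ K₁)
    (hU : 10 ^ 9 * K₁ ^ 2 * (2 * c.natAbs) ^ 8 ≤ U) (hX : X ^ 4 ≤ (U + 1) ^ 3)
    (hE : (((S ×ˢ S).filter fun z => g z.1 = g z.2).card : ℝ) ≤ K₂ * (U : ℝ) ^ (33 / 16 : ℝ))
    (A : Finset (ℤ × ι)) (hA : A ⊆ Finset.Icc (-X : ℤ) X ×ˢ S)
    (hAb : ∀ z ∈ A, (c * z.1 ^ 4 + g z.2).natAbs ≤ K₁ * U ^ 3)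
    (hA0 : ∀ z ∈ A, c * z.1 ^ 4 + g z.2 ≠ 0)
    (hAp : ∀ z ∈ A, ∃ p : ℕ, p.Prime ∧ Nat.log 2 p = i ∧ U ^ 7 < p ^ 8 ∧
      (p : ℤ) ^ 2 ∣ c * z.1 ^ 4 + g z.2) :
    (A.card : ℝ) ≤ √(400 * K₁ * K₂) * (U : ℝ) ^ (87 / 32 : ℝ) := by
  classical
  have hK₂ : 0 ≤ K₂ := by
    by_contra h
    push Not at h
    have h0 : (0 : ℝ) ≤ K₂ * (U : ℝ) ^ (33 / 16 : ℝ) := le_trans (Nat.cast_nonneg _) hE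
    have h1 : 0 < (U : ℝ) ^ (33 / 16 : ℝ) := by
      have : 0 < U := lt_of_lt_of_le (by
        have := Int.natAbs_pos.2 hc
        positivity) hU
      positivity
    nlinarith
  rcases A.eq_empty_or_nonempty with rfl | ⟨z₀, hz₀⟩
  · simp only [Finset.card_empty, Nat.cast_zero]; positivity
  set R := 2 ^ i with hRdef
  have hdy : ∀ p : ℕ, p.Prime → Nat.log 2 p = i → R ≤ p ∧ p < 2 * R := by
    intro p hp h
    refine ⟨?_, ?_⟩
    · rw [hRdef, ← h]; exact Nat.pow_log_le_self 2 hp.ne_zero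
    · have := Nat.lt_pow_succ_log_self (b := 2) (by norm_num) p
      rw [h, pow_succ] at this
      omega
  have hsq : ∀ z ∈ A, ∀ p : ℕ, (p : ℤ) ^ 2 ∣ c * z.1 ^ 4 + g z.2 → p ^ 2 ≤ K₁ * U ^ 3 := by
    intro z hz p hp
    refine le_trans ?_ (hAb z hz)
    have := Int.natAbs_dvd_natAbs.2 hp
    rw [Int.natAbs_pow, Int.natAbs_natCast] at this
    exact Nat.le_of_dvd (Int.natAbs_pos.2 (hA0 z hz)) this
  obtain ⟨p₀, hp₀, hi₀, hU₀, hd₀⟩ := hAp z₀ hz₀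
  have hUR : U ^ 7 < (2 * R) ^ 8 := by
    refine hU₀.trans_le ?_
    have := (hdy p₀ hp₀ hi₀).2.le
    gcongr
  have hRK : R ^ 2 ≤ K₁ * U ^ 3 := by
    refine le_trans ?_ (hsq z₀ hz₀ p₀ hd₀)
    have := (hdy p₀ hp₀ hi₀).1
    gcongr
  obtain ⟨hR3, hXR, hR4, hcR⟩ := dyadic_size_bounds hK₁ (Int.natAbs_pos.2 hc) hU hX hUR
  have hUpos : 1 ≤ U := by
    rcases Nat.eq_zero_or_pos U with rfl | h
    · simp only [ne_eq, OfNat.ofNat_ne_zero, not_false_eq_true, zero_pow, mul_zero] at hRK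
      have : 0 < R ^ 2 := by positivity
      omega
    · exact h
  set M := K₁ * U ^ 3 / R ^ 2 with hMdef
  have hR2 : 0 < R ^ 2 := by positivity
  have hMR : M * R ^ 2 ≤ K₁ * U ^ 3 := Nat.div_mul_le_self _ _
  have hM : M < R ^ 2 := by
    rw [hMdef, Nat.div_lt_iff_lt_mul hR2]
    calc K₁ * U ^ 3 < R ^ 4 := hR4
      _ = R ^ 2 * R ^ 2 := by ring
  have hmain := card_large_prime_sq_le S g hR3 hXR hM hc hcR A hA (by
    intro z hz
    obtain ⟨p, hp, hpi, _, m, hm⟩ := hAp z hz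
    have hpR := hdy p hp hpi
    have hm0 : m ≠ 0 := by
      rintro rfl
      exact hA0 z hz (by rw [hm, mul_zero])
    have hmM : m.natAbs ≤ M := by
      rw [hMdef, Nat.le_div_iff_mul_le hR2]
      refine le_trans ?_ (hAb z hz)
      rw [hm, Int.natAbs_mul, Int.natAbs_pow, Int.natAbs_natCast, mul_comm]
      gcongr
      exact hpR.1
    refine ⟨m, mem_nonzeroIcc.2 ⟨hm0, by omega, by omega⟩, p, mem_dyadicPrimes.2 ⟨hpR, hp⟩, ?_⟩
    rw [hm]; ring)
  have hU0 : (0 : ℝ) < U := by exact_mod_cast hUpos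
  refine le_of_pow_le_pow_left₀ (n := 2) (by norm_num) (by positivity) (hmain.trans ?_)
  rw [mul_pow, Real.sq_sqrt (by positivity)]
  calc _ ≤ (K₂ * (U : ℝ) ^ (33 / 16 : ℝ)) * (400 * K₁ * (U : ℝ) ^ (27 / 8 : ℝ)) := by
        refine mul_le_mul hE ?_ (by positivity) (by positivity)
        exact dyadic_main_le hUpos hX hK₁ hUR hRK hMR
    _ = 400 * K₁ * K₂ * ((U : ℝ) ^ (33 / 16 : ℝ) * (U : ℝ) ^ (27 / 8 : ℝ)) := by ring
    _ = _ := by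
        rw [← Real.rpow_add hU0, ← Real.rpow_natCast ((U : ℝ) ^ (87 / 32 : ℝ)),
          ← Real.rpow_mul hU0.le]
        norm_num

theorem exists_natLog_le (K₁ : ℕ) (hK₁ : 1 ≤ K₁) : ∃ K : ℝ, 0 < K ∧ ∀ U : ℕ, 1 ≤ U →
    ((Nat.log 2 (K₁ * U ^ 3) + 1 : ℕ) : ℝ) ≤ K * (U : ℝ) ^ (1 / 64 : ℝ) := by
  refine ⟨(192 * (K₁ : ℝ) ^ (1 / 192 : ℝ)) / Real.log 2 + 1, by positivity, ?_⟩
  intro U hU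
  have hU1 : (1 : ℝ) ≤ U := by exact_mod_cast hU
  have hU64 : (1 : ℝ) ≤ (U : ℝ) ^ (1 / 64 : ℝ) := Real.one_le_rpow hU1 (by norm_num)
  have h1 : ((Nat.log 2 (K₁ * U ^ 3) : ℕ) : ℝ) ≤
      192 * (K₁ : ℝ) ^ (1 / 192 : ℝ) / Real.log 2 * (U : ℝ) ^ (1 / 64 : ℝ) := by
    refine (Real.natLog_le_logb _ _).trans ?_
    rw [Real.logb, div_mul_eq_mul_div]
    push_cast
    gcongr
    refine (Real.log_le_rpow_div (ε := 1 / 192) (by positivity) (by norm_num)).trans (le_of_eq ?_)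
    rw [Real.mul_rpow (by positivity) (by positivity), ← Real.rpow_natCast, ← Real.rpow_mul
      (by positivity)]
    norm_num
    ring
  push_cast
  linarith

/-- The points of a two-dimensional slice where the form is divisible by the square of a large
prime. -/
theorem exists_card_large_prime_slice_le {α γ δ c : ℤ} (hα : α ≠ 0) (hγδ : γ ≠ 0 ∨ δ ≠ 0)
    (hc : c ≠ 0) (κ : ℝ) (hκ : 1 ≤ κ) (K₁ : ℕ) (hK₁ : 1 ≤ K₁) :
    ∃ K : ℝ, 0 < K ∧ ∀ (U X : ℕ), 1 ≤ U → X ^ 4 ≤ (U + 1) ^ 3 → ∀ a₁ a₂ a₃ b₁ b₂ d : ℤ,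
      |(a₁ : ℝ)| ≤ κ * U → |(a₂ : ℝ)| ≤ κ * U → |(a₃ : ℝ)| ≤ κ * U →
      |(b₁ : ℝ)| ≤ κ * U ^ 2 → |(b₂ : ℝ)| ≤ κ * U ^ 2 →
      let I : Finset ℤ := Finset.Icc (-U : ℤ) U
      let F : ℤ × (ℤ × ℤ) → ℤ := fun z => c * z.1 ^ 4 + binCubic α γ δ a₁ a₂ a₃ b₁ b₂ d z.2
      ∀ A ⊆ Finset.Icc (-X : ℤ) X ×ˢ (I ×ˢ I), (∀ z ∈ A, (F z).natAbs ≤ K₁ * U ^ 3) →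
        (∀ z ∈ A, F z ≠ 0 ∧ ∃ p : ℕ, p.Prime ∧ U ^ 7 < p ^ 8 ∧ (p : ℤ) ^ 2 ∣ F z) →
        (A.card : ℝ) ≤ K * (U : ℝ) ^ (175 / 64 : ℝ) := by
  classical
  obtain ⟨K₂, hK₂, hE⟩ := exists_card_binCubic_coincidence_le hα hγδ κ hκ (1 / 16) (by norm_num)
  obtain ⟨L, hL, hlog⟩ := exists_natLog_le K₁ hK₁
  set U₀ : ℕ := 10 ^ 9 * K₁ ^ 2 * (2 * c.natAbs) ^ 8 with hU₀
  refine ⟨L * √(400 * K₁ * K₂) + (2 * (U₀ + 1) ^ 3 + 1) * (2 * U₀ + 1) ^ 2, by positivity, ?_⟩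
  intro U X hU hX a₁ a₂ a₃ b₁ b₂ d ha₁ ha₂ ha₃ hb₁ hb₂ I F A hA hAb hAp
  have hU1 : (1 : ℝ) ≤ U := by exact_mod_cast hU
  have hUp : (1 : ℝ) ≤ (U : ℝ) ^ (175 / 64 : ℝ) := Real.one_le_rpow hU1 (by norm_num)
  rcases lt_or_ge U U₀ with hlt | hge
  · have h1 : A.card ≤ (2 * (U₀ + 1) ^ 3 + 1) * (2 * U₀ + 1) ^ 2 := by
      refine (Finset.card_le_card hA).trans ?_
      have hX' : X ≤ (U₀ + 1) ^ 3 :=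
        (Nat.le_self_pow (by norm_num) X).trans (hX.trans (by gcongr))
      rw [Finset.card_product, Finset.card_product, Int.card_Icc, Int.card_Icc, ← pow_two]
      gcongr <;> omega
    have h2 : (A.card : ℝ) ≤ (2 * (U₀ + 1) ^ 3 + 1) * (2 * U₀ + 1) ^ 2 := by exact_mod_cast h1
    calc (A.card : ℝ) ≤ (2 * (U₀ + 1) ^ 3 + 1) * (2 * U₀ + 1) ^ 2 * 1 := by rwa [mul_one]
      _ ≤ _ := by
        gcongr
        have : 0 ≤ L * √(400 * K₁ * K₂) := by positivity
        linarith
  · set N := Nat.log 2 (K₁ * U ^ 3) + 1 with hN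
    set B : ℕ → Finset (ℤ × (ℤ × ℤ)) := fun i => A.filter fun z => ∃ p : ℕ, p.Prime ∧
      Nat.log 2 p = i ∧ U ^ 7 < p ^ 8 ∧ (p : ℤ) ^ 2 ∣ F z with hB
    have hcov : A ⊆ (Finset.range N).biUnion B := by
      intro z hz
      obtain ⟨h0, p, hp, hUp, hd⟩ := hAp z hz
      refine Finset.mem_biUnion.2 ⟨Nat.log 2 p, ?_, Finset.mem_filter.2 ⟨hz, p, hp, rfl, hUp, hd⟩⟩
      rw [Finset.mem_range, hN, Nat.lt_succ_iff]
      refine Nat.log_mono_right ?_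
      have h1 := Int.natAbs_dvd_natAbs.2 hd
      rw [Int.natAbs_pow, Int.natAbs_natCast] at h1
      exact (Nat.le_self_pow two_ne_zero p).trans
        ((Nat.le_of_dvd (Int.natAbs_pos.2 h0) h1).trans (hAb z hz))
    have hBi : ∀ i, ((B i).card : ℝ) ≤ √(400 * K₁ * K₂) * (U : ℝ) ^ (87 / 32 : ℝ) := by
      intro i
      refine card_large_prime_dyadic_le (I ×ˢ I) (binCubic α γ δ a₁ a₂ a₃ b₁ b₂ d) (i := i)
        (X := X) hc hK₁ hge hX ?_ (B i) ((Finset.filter_subset _ _).trans hA) ?_ ?_ ?_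
      · refine (hE U hU a₁ a₂ a₃ b₁ b₂ d ha₁ ha₂ ha₃ hb₁ hb₂).trans (le_of_eq ?_)
        norm_num
      · exact fun z hz => hAb z (Finset.mem_filter.1 hz).1
      · exact fun z hz => (hAp z (Finset.mem_filter.1 hz).1).1
      · exact fun z hz => (Finset.mem_filter.1 hz).2
    have hU0 : (0 : ℝ) < U := by linarith
    calc (A.card : ℝ) ≤ ∑ i ∈ Finset.range N, ((B i).card : ℝ) := by
          exact_mod_cast (Finset.card_le_card hcov).trans Finset.card_biUnion_le
      _ ≤ ∑ i ∈ Finset.range N, √(400 * K₁ * K₂) * (U : ℝ) ^ (87 / 32 : ℝ) :=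
          Finset.sum_le_sum fun i _ => hBi i
      _ = N * (√(400 * K₁ * K₂) * (U : ℝ) ^ (87 / 32 : ℝ)) := by
          rw [Finset.sum_const, Finset.card_range, nsmul_eq_mul]
      _ ≤ (L * (U : ℝ) ^ (1 / 64 : ℝ)) * (√(400 * K₁ * K₂) * (U : ℝ) ^ (87 / 32 : ℝ)) := by
          gcongr
          exact hlog U hU
      _ = L * √(400 * K₁ * K₂) * ((U : ℝ) ^ (1 / 64 : ℝ) * (U : ℝ) ^ (87 / 32 : ℝ)) := by ring
      _ = L * √(400 * K₁ * K₂) * (U : ℝ) ^ (175 / 64 : ℝ) := by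
          rw [← Real.rpow_add hU0]; norm_num
      _ ≤ _ := by
          gcongr
          have : (0 : ℝ) ≤ (2 * (U₀ + 1) ^ 3 + 1) * (2 * U₀ + 1) ^ 2 := by positivity
          linarith

theorem card_residue_class_le {m Z : ℕ} (hm : 0 < m) (S : Finset ℤ)
    (hS : ∀ t ∈ S, -(Z : ℤ) ≤ t ∧ t ≤ Z) (hSm : ∀ t ∈ S, ∀ t' ∈ S, (m : ℤ) ∣ t - t') :
    S.card ≤ 2 * Z / m + 1 := by
  have hm' : (0 : ℤ) < m := by exact_mod_cast hm
  refine (Finset.card_le_card_of_injOn (t := Finset.range (2 * Z / m + 1))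
    (fun t : ℤ => ((t + Z) / m).toNat) ?_ ?_).trans (Finset.card_range _).le
  · intro t ht
    have h := hS t ht
    simp only [Finset.coe_range, Set.mem_Iio, Nat.lt_succ_iff]
    refine Int.toNat_le.2 ?_
    rw [Int.natCast_div]
    exact Int.ediv_le_ediv hm' (by push_cast; omega)
  · intro t ht t' ht' h
    have h1 := hS t ht
    have h2 := hS t' ht'
    have h3 : 0 ≤ (t + Z) / (m : ℤ) := Int.ediv_nonneg (by omega) hm'.le
    have h4 : 0 ≤ (t' + Z) / (m : ℤ) := Int.ediv_nonneg (by omega) hm'.le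
    have h5 : (t + Z) / (m : ℤ) = (t' + Z) / (m : ℤ) := by
      simp only at h
      omega
    obtain ⟨j, hj⟩ := hSm t ht t' ht'
    have h6 : t + Z = (t' + Z) + m * j := by linarith
    rw [h6, Int.add_mul_ediv_left _ _ hm'.ne'] at h5
    have : j = 0 := by omega
    rw [this] at hj
    linarith

/-- A set of integers in an interval on which `f` vanishes modulo `p` and such that elements
congruent modulo `p` are congruent modulo `m`. -/
theorem card_roots_lift_le {p m Z k : ℕ} (hp : p.Prime) (hm : 0 < m) (f : Polynomial ℤ)
    (hf : f.map (Int.castRingHom (ZMod p)) ≠ 0) (hk : f.natDegree ≤ k) (S : Finset ℤ)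
    (hS : ∀ t ∈ S, -(Z : ℤ) ≤ t ∧ t ≤ Z) (hSf : ∀ t ∈ S, (p : ℤ) ∣ f.eval t)
    (hSm : ∀ t ∈ S, ∀ t' ∈ S, (p : ℤ) ∣ t' - t → (m : ℤ) ∣ t' - t) :
    S.card ≤ (2 * Z / m + 1) * k := by
  classical
  have := Fact.mk hp
  set g := f.map (Int.castRingHom (ZMod p)) with hg
  refine (Finset.card_le_mul_card_image_of_maps_to (f := fun t : ℤ => (t : ZMod p))
    (t := g.roots.toFinset) ?_ (2 * Z / m + 1) ?_).trans ?_
  · intro t ht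
    rw [Multiset.mem_toFinset, Polynomial.mem_roots hf, Polynomial.IsRoot, hg,
      show (t : ZMod p) = Int.castRingHom (ZMod p) t from rfl, Polynomial.eval_map_apply]
    exact (ZMod.intCast_zmod_eq_zero_iff_dvd _ _).2 (hSf t ht)
  · intro r _
    refine card_residue_class_le hm _ (fun t ht => hS t (Finset.mem_filter.1 ht).1) ?_
    intro t ht t' ht'
    obtain ⟨h1, h2⟩ := Finset.mem_filter.1 ht
    obtain ⟨h3, h4⟩ := Finset.mem_filter.1 ht'
    exact hSm t' h3 t h1 ((ZMod.intCast_eq_intCast_iff_dvd_sub _ _ _).1 (h4.trans h2.symm))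
  · gcongr
    exact (Multiset.toFinset_card_le _).trans
      ((Polynomial.card_roots' g).trans (Polynomial.natDegree_map_le.trans hk))

theorem card_roots_mod_le {p Z k : ℕ} (hp : p.Prime) (f : Polynomial ℤ)
    (hf : f.map (Int.castRingHom (ZMod p)) ≠ 0) (hk : f.natDegree ≤ k) (S : Finset ℤ)
    (hS : ∀ t ∈ S, -(Z : ℤ) ≤ t ∧ t ≤ Z) (hSf : ∀ t ∈ S, (p : ℤ) ∣ f.eval t) :
    S.card ≤ (2 * Z / p + 1) * k :=
  card_roots_lift_le hp hp.pos f hf hk S hS hSf fun _ _ _ _ h => h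

/-- Simple roots modulo `p` lift uniquely to roots modulo `p²`. -/
theorem card_simple_roots_mod_sq_le {p Z k : ℕ} (hp : p.Prime) (f : Polynomial ℤ)
    (hf : f.map (Int.castRingHom (ZMod p)) ≠ 0) (hk : f.natDegree ≤ k) (S : Finset ℤ)
    (hS : ∀ t ∈ S, -(Z : ℤ) ≤ t ∧ t ≤ Z) (hSf : ∀ t ∈ S, (p : ℤ) ^ 2 ∣ f.eval t)
    (hS' : ∀ t ∈ S, ¬ (p : ℤ) ∣ f.derivative.eval t) :
    S.card ≤ (2 * Z / p ^ 2 + 1) * k := by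
  have hpi : Prime (p : ℤ) := Nat.prime_iff_prime_int.1 hp
  refine card_roots_lift_le hp (by have := hp.pos; positivity) f hf hk S hS
    (fun t ht => (dvd_pow_self _ two_ne_zero).trans (hSf t ht)) ?_
  intro t ht t' ht' h
  obtain ⟨l, hl⟩ := f.binomExpansion t (t' - t)
  rw [add_sub_cancel] at hl
  have h1 : (p : ℤ) ^ 2 ∣ (t' - t) * (f.derivative.eval t + l * (t' - t)) := by
    have : (t' - t) * (f.derivative.eval t + l * (t' - t)) = f.eval t' - f.eval t := by
      rw [hl]; ring
    rw [this]
    exact dvd_sub (hSf t' ht') (hSf t ht)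
  have h2 : ¬ (p : ℤ) ∣ f.derivative.eval t + l * (t' - t) := fun h3 =>
    hS' t ht ((Int.dvd_add_left (h.mul_left l)).1 h3)
  push_cast
  exact IsCoprime.dvd_of_dvd_mul_right
    (IsCoprime.pow_left ((Prime.coprime_iff_not_dvd hpi).2 h2)) h1

open Polynomial in
theorem card_quartic_add_cubic_sq_dvd_le {p X Y : ℕ} (hp : p.Prime) {c α a b d : ℤ}
    (hpc : ¬ (p : ℤ) ∣ 6 * α * c) (S : Finset (ℤ × ℤ))
    (hS : S ⊆ Finset.Icc (-X : ℤ) X ×ˢ Finset.Icc (-Y : ℤ) Y)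
    (hSp : ∀ z ∈ S, (p : ℤ) ^ 2 ∣ c * z.1 ^ 4 + (α * z.2 ^ 3 + a * z.2 ^ 2 + b * z.2 + d)) :
    S.card ≤ (2 * Y / p ^ 2 + 1) * 3 * (2 * X + 1) +
      ((2 * X / p ^ 2 + 1) * 4 + (2 * X / p + 1)) * ((2 * Y / p + 1) * 2) := by
  classical
  have hpi : Prime (p : ℤ) := Nat.prime_iff_prime_int.1 hp
  have hmem : ∀ z ∈ S, (-(X : ℤ) ≤ z.1 ∧ z.1 ≤ X) ∧ (-(Y : ℤ) ≤ z.2 ∧ z.2 ≤ Y) := by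
    intro z hz
    have := Finset.mem_product.1 (hS hz)
    exact ⟨Finset.mem_Icc.1 this.1, Finset.mem_Icc.1 this.2⟩
  have hα : ¬ (p : ℤ) ∣ 3 * α := fun h => hpc (h.trans ⟨2 * c, by ring⟩)
  have hα1 : ¬ (p : ℤ) ∣ α := fun h => hpc (h.trans ⟨6 * c, by ring⟩)
  have hc4 : ¬ (p : ℤ) ∣ 4 * c := by
    intro h
    rcases hpi.dvd_or_dvd h with h | h
    · refine hpc (Dvd.dvd.trans (?_ : (p : ℤ) ∣ 2) ⟨3 * α * c, by ring⟩)
      exact hpi.dvd_of_dvd_pow (n := 2) (by norm_num; exact h)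
    · exact hpc (h.trans ⟨6 * α, by ring⟩)
  have hc1 : ¬ (p : ℤ) ∣ c := fun h => hpc (h.trans ⟨6 * α, by ring⟩)
  have hcast : ∀ k : ℤ, ¬ (p : ℤ) ∣ k → (Int.castRingHom (ZMod p)) k ≠ 0 := fun k hk h =>
    hk ((ZMod.intCast_zmod_eq_zero_iff_dvd _ _).1 h)
  rw [← Finset.card_filter_add_card_filter_not
    (s := S) (fun z => ¬ (p : ℤ) ∣ 3 * α * z.2 ^ 2 + 2 * a * z.2 + b)]
  refine add_le_add ?_ ?_
  · have hX : (Finset.Icc (-X : ℤ) X).card = 2 * X + 1 := by rw [Int.card_Icc]; omega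
    rw [← hX]
    refine Finset.card_le_mul_card_image_of_maps_to (f := Prod.fst) ?_ _ ?_
    · exact fun z hz => (Finset.mem_product.1 (hS (Finset.mem_filter.1 hz).1)).1
    · intro x _
      set f : ℤ[X] := C α * Polynomial.X ^ 3 + C a * Polynomial.X ^ 2 + C b * Polynomial.X +
        C (d + c * x ^ 4) with hf
      rw [← Finset.card_image_of_injOn (f := Prod.snd)]
      · refine card_simple_roots_mod_sq_le hp f ?_ ?_ _ ?_ ?_ ?_
        · refine fun h => hcast α hα1 ?_
          have := congrArg (fun g => coeff g 3) h
          simp only [coeff_map, coeff_zero] at this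
          rwa [show f.coeff 3 = α by simp only [hf, coeff_add, coeff_C_mul, coeff_X_pow, coeff_X, coeff_C]; norm_num] at this
        · rw [hf]; compute_degree
        · intro t ht
          obtain ⟨z, hz, rfl⟩ := Finset.mem_image.1 ht
          exact (hmem z (Finset.mem_filter.1 (Finset.mem_filter.1 hz).1).1).2
        · intro t ht
          obtain ⟨z, hz, rfl⟩ := Finset.mem_image.1 ht
          obtain ⟨h1, rfl⟩ := Finset.mem_filter.1 hz
          refine (hSp z (Finset.mem_filter.1 h1).1).trans (dvd_of_eq ?_)
          simp [hf]; ring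
        · intro t ht
          obtain ⟨z, hz, rfl⟩ := Finset.mem_image.1 ht
          obtain ⟨h1, rfl⟩ := Finset.mem_filter.1 hz
          have h2 := (Finset.mem_filter.1 h1).2
          refine fun h3 => h2 (h3.trans (dvd_of_eq ?_))
          simp only [hf, derivative_add, derivative_C_mul, derivative_X_pow, derivative_X,
            derivative_C, eval_add, eval_mul, eval_C, eval_pow, eval_X, eval_one, eval_zero]
          push_cast
          ring
      · intro z hz z' hz' h
        exact Prod.ext ((Finset.mem_filter.1 hz).2.trans (Finset.mem_filter.1 hz').2.symm) h
  · set T := (Finset.Icc (-Y : ℤ) Y).filter fun u => (p : ℤ) ∣ 3 * α * u ^ 2 + 2 * a * u + b with hT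
    have hTc : T.card ≤ (2 * Y / p + 1) * 2 := by
      set f : ℤ[X] := C (3 * α) * Polynomial.X ^ 2 + C (2 * a) * Polynomial.X + C b with hf
      refine card_roots_mod_le hp f ?_ ?_ _ ?_ ?_
      · refine fun h => hcast _ hα ?_
        have := congrArg (fun g => coeff g 2) h
        simp only [coeff_map, coeff_zero] at this
        rwa [show f.coeff 2 = 3 * α by simp only [hf, coeff_add, coeff_C_mul, coeff_X_pow, coeff_X, coeff_C]; norm_num] at this
      · rw [hf]; compute_degree
      · exact fun t ht => Finset.mem_Icc.1 (Finset.mem_filter.1 ht).1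
      · intro t ht
        refine (Finset.mem_filter.1 ht).2.trans (dvd_of_eq ?_)
        simp [hf]
    refine le_trans (Finset.card_le_mul_card_image_of_maps_to (f := Prod.snd) (t := T) ?_
      ((2 * X / p ^ 2 + 1) * 4 + (2 * X / p + 1)) ?_) (Nat.mul_le_mul_left _ hTc)
    · intro z hz
      obtain ⟨h1, h2⟩ := Finset.mem_filter.1 hz
      exact Finset.mem_filter.2 ⟨(Finset.mem_product.1 (hS h1)).2, not_not.1 h2⟩
    · intro u _
      set k := α * u ^ 3 + a * u ^ 2 + b * u + d with hk
      set f : ℤ[X] := C c * Polynomial.X ^ 4 + C k with hf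
      set S' := (((S.filter fun z => ¬ ¬ (p : ℤ) ∣ 3 * α * z.2 ^ 2 + 2 * a * z.2 + b).filter
        fun z => z.2 = u)).image Prod.fst with hS'
      rw [← Finset.card_image_of_injOn (f := Prod.fst)]
      swap
      · intro z hz z' hz' h
        exact Prod.ext h ((Finset.mem_filter.1 hz).2.trans (Finset.mem_filter.1 hz').2.symm)
      rw [← hS']
      have hS'm : ∀ t ∈ S', (-(X : ℤ) ≤ t ∧ t ≤ X) ∧ (p : ℤ) ^ 2 ∣ c * t ^ 4 + k := by
        intro t ht
        obtain ⟨z, hz, rfl⟩ := Finset.mem_image.1 ht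
        obtain ⟨h1, rfl⟩ := Finset.mem_filter.1 hz
        have h2 := (Finset.mem_filter.1 h1).1
        exact ⟨(hmem z h2).1, hSp z h2⟩
      rw [← Finset.card_filter_add_card_filter_not (s := S') (fun t => ¬ (p : ℤ) ∣ t)]
      refine add_le_add ?_ ?_
      · refine card_simple_roots_mod_sq_le hp f ?_ ?_ _ ?_ ?_ ?_
        · refine fun h => hcast c hc1 ?_
          have := congrArg (fun g => coeff g 4) h
          simp only [coeff_map, coeff_zero] at this
          rwa [show f.coeff 4 = c by simp only [hf, coeff_add, coeff_C_mul, coeff_X_pow, coeff_C]; norm_num] at this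
        · rw [hf]; compute_degree
        · exact fun t ht => (hS'm t (Finset.mem_filter.1 ht).1).1
        · intro t ht
          refine (hS'm t (Finset.mem_filter.1 ht).1).2.trans (dvd_of_eq ?_)
          simp [hf]
        · intro t ht h
          have h1 : (p : ℤ) ∣ 4 * c * t ^ 3 := h.trans (dvd_of_eq (by simp [hf]; ring))
          rcases hpi.dvd_or_dvd h1 with h2 | h2
          · exact hc4 h2
          · exact (Finset.mem_filter.1 ht).2 (hpi.dvd_of_dvd_pow h2)
      · refine card_residue_class_le hp.pos _ (fun t ht => (hS'm t (Finset.mem_filter.1 ht).1).1) ?_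
        intro t ht t' ht'
        exact dvd_sub (not_not.1 (Finset.mem_filter.1 ht).2) (not_not.1 (Finset.mem_filter.1 ht').2)

theorem quartic_cubic_count_le {p X Y N : ℕ} (hp : p.Prime) (hX : 1 ≤ X)
    (hXY : Y ≤ 4 * X ^ 2)
    (h : N ≤ (2 * Y / p ^ 2 + 1) * 3 * (2 * X + 1) +
      ((2 * X / p ^ 2 + 1) * 4 + (2 * X / p + 1)) * ((2 * Y / p + 1) * 2)) :
    (N : ℝ) ≤ 1000 * (X * Y / (p : ℝ) ^ 2 + X) := by
  have hp0 : (0 : ℝ) < p := by exact_mod_cast hp.pos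
  have hp1 : (1 : ℝ) ≤ p := by exact_mod_cast hp.one_le
  have hX1 : (1 : ℝ) ≤ X := by exact_mod_cast hX
  have hXY' : (Y : ℝ) ≤ 4 * X ^ 2 := by exact_mod_cast hXY
  have hd : ∀ a b : ℕ, ((a / b : ℕ) : ℝ) ≤ (a : ℝ) / b := fun a b => Nat.cast_div_le
  have h' : (N : ℝ) ≤ ((2 * Y / p ^ 2 : ℕ) + 1) * 3 * (2 * X + 1) +
      (((2 * X / p ^ 2 : ℕ) + 1) * 4 + ((2 * X / p : ℕ) + 1)) * (((2 * Y / p : ℕ) + 1) * 2) := by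
    exact_mod_cast h
  have h1 := hd (2 * Y) (p ^ 2)
  have h2 := hd (2 * X) (p ^ 2)
  have h3 := hd (2 * X) p
  have h4 := hd (2 * Y) p
  push_cast at h1 h2 h3 h4
  have hYp : (Y : ℝ) / p ≤ X * Y / (p : ℝ) ^ 2 + 4 * X := by
    rcases le_total (p : ℝ) X with hpX | hpX
    · have : (Y : ℝ) / p ≤ X * Y / (p : ℝ) ^ 2 := by
        rw [div_le_div_iff₀ hp0 (by positivity)]
        calc (Y : ℝ) * p ^ 2 = p * Y * p := by ring
          _ ≤ X * Y * p := by gcongr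
      linarith
    · have : (Y : ℝ) / p ≤ 4 * X := by
        rw [div_le_iff₀ hp0]
        calc (Y : ℝ) ≤ 4 * X ^ 2 := hXY'
          _ = 4 * X * X := by ring
          _ ≤ 4 * X * p := by gcongr
      have : 0 ≤ X * Y / (p : ℝ) ^ 2 := by positivity
      linarith
  set A : ℝ := X * Y / (p : ℝ) ^ 2 with hA
  have hXp : (X : ℝ) / p ≤ X := div_le_self (by positivity) hp1
  have hXp2 : 2 * (X : ℝ) / p ^ 2 ≤ 2 * (X / p) := by
    rw [mul_div_assoc]
    gcongr
    exact le_self_pow₀ hp1 two_ne_zero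
  have hAe : (X : ℝ) / p * (Y / p) = A := by rw [hA]; field_simp
  have hY2 : 2 * (Y : ℝ) / p ^ 2 * X = 2 * A := by rw [hA]; ring
  have hA0 : 0 ≤ A := by positivity
  have hY20 : 0 ≤ 2 * (Y : ℝ) / p ^ 2 := by positivity
  calc (N : ℝ) ≤ (2 * Y / (p : ℝ) ^ 2 + 1) * 3 * (2 * X + 1) +
      ((2 * X / (p : ℝ) ^ 2 + 1) * 4 + (2 * X / p + 1)) * ((2 * Y / p + 1) * 2) := by
        refine h'.trans ?_
        gcongr
    _ ≤ (2 * Y / (p : ℝ) ^ 2 + 1) * 3 * (3 * X) +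
      ((2 * (X / p) + 1) * 4 + (2 * (X / p) + 1)) * ((2 * (Y / p) + 1) * 2) := by
        rw [mul_div_assoc 2 (Y : ℝ) (p : ℝ), mul_div_assoc 2 (X : ℝ) (p : ℝ)]
        gcongr
        linarith
    _ = 9 * (2 * Y / (p : ℝ) ^ 2 * X) + 9 * X + 40 * (X / p * (Y / p)) + 20 * (X / p) +
        20 * (Y / p) + 10 := by ring
    _ ≤ 1000 * (A + X) := by
        rw [hY2, hAe]
        linarith

section Forms

open MvPolynomial

variable {n : ℕ}

theorem exists_trilinear_monomial (m : Fin n →₀ ℕ) (hm : Finsupp.degree m = 3) (r : ℤ) :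
    ∃ (T : (Fin n → ℤ) →ₗ[ℤ] (Fin n → ℤ) →ₗ[ℤ] (Fin n → ℤ) →ₗ[ℤ] ℤ) (τ : ℝ), 0 ≤ τ ∧
      (∀ y, eval y (monomial m r) = T y y y) ∧
      ∀ (A B C : ℝ) (a b c : Fin n → ℤ), (∀ j, |(a j : ℝ)| ≤ A) → (∀ j, |(b j : ℝ)| ≤ B) →
        (∀ j, |(c j : ℝ)| ≤ C) → |(T a b c : ℝ)| ≤ τ * A * B * C := by
  classical
  have hcard : (Finsupp.toMultiset m).card = 3 := by
    rw [Finsupp.card_toMultiset, ← hm]; rfl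
  obtain ⟨i, j, k, hijk⟩ := Multiset.card_eq_three.1 hcard
  refine ⟨(r • LinearMap.proj i).smulRight ((LinearMap.proj j).smulRight (LinearMap.proj k)),
    |(r : ℝ)|, abs_nonneg _, ?_, ?_⟩
  · intro y
    have h : (m.prod fun a e => y a ^ e) = ((Finsupp.toMultiset m).map y).prod := by
      rw [Finsupp.toMultiset_map, Finsupp.prod_toMultiset, Finsupp.prod_mapDomain_index] <;>
        simp [pow_add]
    rw [eval_monomial, h, hijk]
    simp
    ring
  · intro A B C a b c ha hb hc
    have : (((r • LinearMap.proj i).smulRight ((LinearMap.proj j).smulRight (LinearMap.proj k)) :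
        (Fin n → ℤ) →ₗ[ℤ] (Fin n → ℤ) →ₗ[ℤ] (Fin n → ℤ) →ₗ[ℤ] ℤ) a b c : ℤ) =
        r * a i * b j * c k := by
      simp; ring
    rw [this]
    push_cast
    rw [abs_mul, abs_mul, abs_mul]
    have := (abs_nonneg _).trans (ha i)
    have := (abs_nonneg _).trans (hb j)
    have := (abs_nonneg _).trans (hc k)
    have := ha i
    have := hb j
    have := hc k
    gcongr

/-- A cubic form comes from a (bounded) trilinear map. -/
theorem exists_trilinear (𝒞 : MvPolynomial (Fin n) ℤ) (h𝒞 : 𝒞.IsHomogeneous 3) :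
    ∃ (T : (Fin n → ℤ) →ₗ[ℤ] (Fin n → ℤ) →ₗ[ℤ] (Fin n → ℤ) →ₗ[ℤ] ℤ) (τ : ℝ), 0 ≤ τ ∧
      (∀ y, eval y 𝒞 = T y y y) ∧
      ∀ (A B C : ℝ) (a b c : Fin n → ℤ), (∀ j, |(a j : ℝ)| ≤ A) → (∀ j, |(b j : ℝ)| ≤ B) →
        (∀ j, |(c j : ℝ)| ≤ C) → |(T a b c : ℝ)| ≤ τ * A * B * C := by
  classical
  have key : ∀ s : Finset (Fin n →₀ ℕ), (∀ m ∈ s, Finsupp.degree m = 3) →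
      ∃ (T : (Fin n → ℤ) →ₗ[ℤ] (Fin n → ℤ) →ₗ[ℤ] (Fin n → ℤ) →ₗ[ℤ] ℤ) (τ : ℝ), 0 ≤ τ ∧
      (∀ y, eval y (∑ m ∈ s, monomial m (𝒞.coeff m)) = T y y y) ∧
      ∀ (A B C : ℝ) (a b c : Fin n → ℤ), (∀ j, |(a j : ℝ)| ≤ A) → (∀ j, |(b j : ℝ)| ≤ B) →
        (∀ j, |(c j : ℝ)| ≤ C) → |(T a b c : ℝ)| ≤ τ * A * B * C := by
    intro s
    induction s using Finset.induction_on with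
    | empty => exact fun _ => ⟨0, 0, le_rfl, by simp, by simp⟩
    | insert m s hms ih =>
      intro hs
      obtain ⟨T, τ, hτ, hT, hb⟩ := ih fun l hl => hs l (Finset.mem_insert_of_mem hl)
      obtain ⟨T', τ', hτ', hT', hb'⟩ :=
        exists_trilinear_monomial m (hs m (Finset.mem_insert_self _ _)) (𝒞.coeff m)
      refine ⟨T' + T, τ' + τ, add_nonneg hτ' hτ, ?_, ?_⟩
      · intro y
        rw [Finset.sum_insert hms, map_add, hT, hT']
        rfl
      · intro A B C a b c hA hB hC
        have h1 := hb A B C a b c hA hB hC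
        have h2 := hb' A B C a b c hA hB hC
        have h3 : ((T' + T) a b c : ℝ) = (T' a b c : ℝ) + T a b c := by
          simp only [LinearMap.add_apply]; push_cast; rfl
        rw [h3]
        refine (abs_add_le _ _).trans ?_
        linarith
  obtain ⟨T, τ, hτ, hT, hb⟩ := key 𝒞.support fun m hm => by
    have := h𝒞 (mem_support_iff.1 hm)
    rw [Finsupp.degree_eq_weight_one (R := ℕ)]
    exact this
  refine ⟨T, τ, hτ, ?_, hb⟩
  intro y
  rw [← hT y, ← 𝒞.as_sum]

theorem trilinear_expand (T : (Fin n → ℤ) →ₗ[ℤ] (Fin n → ℤ) →ₗ[ℤ] (Fin n → ℤ) →ₗ[ℤ] ℤ)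
    (y e f : Fin n → ℤ) (u v : ℤ) :
    T (y + (u • e + v • f)) (y + (u • e + v • f)) (y + (u • e + v • f)) =
      T e e e * u ^ 3 + (T e e f + T e f e + T f e e) * (u ^ 2 * v) +
        (T e f f + T f e f + T f f e) * (u * v ^ 2) + T f f f * v ^ 3 +
        (T e e y + T e y e + T y e e) * u ^ 2 +
        (T e f y + T e y f + T f e y + T f y e + T y e f + T y f e) * (u * v) +
        (T f f y + T f y f + T y f f) * v ^ 2 +
        (T e y y + T y e y + T y y e) * u + (T f y y + T y f y + T y y f) * v + T y y y := by
  simp only [map_add, map_smul, LinearMap.add_apply, LinearMap.smul_apply, smul_eq_mul]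
  ring

/-- If a cubic form is not proportional to the cube of a linear form, it has a binary slice of the
shape `α u³ + γ u v² + δ v³` depending on both variables. -/
theorem exists_slice_directions (𝒞 : MvPolynomial (Fin n) ℤ)
    (hdeg : ¬ ∃ (a : ℚ) (b : Fin n → ℚ), MvPolynomial.map (Int.castRingHom ℚ) 𝒞 =
        MvPolynomial.C a * (∑ i, MvPolynomial.C (b i) * MvPolynomial.X i) ^ 3)
    (T : (Fin n → ℤ) →ₗ[ℤ] (Fin n → ℤ) →ₗ[ℤ] (Fin n → ℤ) →ₗ[ℤ] ℤ)
    (hT : ∀ y, eval y 𝒞 = T y y y) :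
    ∃ e f : Fin n → ℤ, T e e e ≠ 0 ∧ T e e f + T e f e + T f e e = 0 ∧
      (T e f f + T f e f + T f f e ≠ 0 ∨ T f f f ≠ 0) := by
  classical
  by_contra! hcon
  refine hdeg ?_
  by_cases h0 : ∀ y, eval y 𝒞 = 0
  · have : 𝒞 = 0 := MvPolynomial.funext fun y => by rw [h0, map_zero]
    exact ⟨0, 0, by simp [this]⟩
  push Not at h0
  obtain ⟨e, he⟩ := h0
  rw [hT] at he
  set α := T e e e with hα
  set β : (Fin n → ℤ) → ℤ := fun y => T e e y + T e y e + T y e e with hβ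
  have hβlin : ∀ y, β y = ∑ i, y i * β (Pi.single i 1) := by
    have h1 : ∀ y, β y = (T e e + (T e).flip e + (T.flip e).flip e) y := fun y => rfl
    intro y
    simp only [h1]
    rw [LinearMap.pi_apply_eq_sum_univ]
    simp only [smul_eq_mul]
    refine Finset.sum_congr rfl fun i _ => ?_
    congr 2
    ext j
    simp [Pi.single_apply, eq_comm]
  have hkey : ∀ y, 27 * α ^ 2 * eval y 𝒞 = β y ^ 3 := by
    intro y
    set f := (3 * α) • y - (β y) • e with hf
    have hβf : T e e f + T e f e + T f e e = 0 := by
      simp only [hf, map_sub, map_smul, LinearMap.sub_apply, LinearMap.smul_apply, smul_eq_mul,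
        ← hα]
      simp only [hβ]
      ring
    obtain ⟨hγ, hδ⟩ := hcon e f he hβf
    have h1 := trilinear_expand T 0 e f (β y) 1
    rw [hβf, hγ, hδ, ← hα] at h1
    have h2 : (0 : Fin n → ℤ) + (β y • e + (1 : ℤ) • f) = (3 * α) • y := by
      rw [hf, one_smul]; abel
    rw [h2] at h1
    simp only [map_smul, map_zero, LinearMap.smul_apply, smul_eq_mul, LinearMap.zero_apply] at h1
    rw [hT]
    refine mul_left_cancel₀ he ?_
    linarith
  have hpoly : C (27 * α ^ 2) * 𝒞 = (∑ i, C (β (Pi.single i 1)) * X i) ^ 3 := by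
    refine MvPolynomial.funext fun y => ?_
    rw [map_mul, eval_C, hkey, hβlin]
    simp only [map_pow, map_sum, map_mul, eval_C, eval_X]
    congr 1
    exact Finset.sum_congr rfl fun i _ => mul_comm _ _
  refine ⟨1 / (27 * (α : ℚ) ^ 2), fun i => (β (Pi.single i 1) : ℚ), ?_⟩
  have h := congrArg (MvPolynomial.map (Int.castRingHom ℚ)) hpoly
  simp only [map_mul, map_pow, map_sum, MvPolynomial.map_C, MvPolynomial.map_X] at h
  have hα0 : (27 * (α : ℚ) ^ 2) ≠ 0 := by
    have : (α : ℚ) ≠ 0 := by exact_mod_cast he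
    positivity
  have hcancel : (C (1 / (27 * (α : ℚ) ^ 2)) * C (27 * (α : ℚ) ^ 2) : MvPolynomial (Fin n) ℚ) =
      1 := by
    rw [← C_mul, one_div, inv_mul_cancel₀ hα0, C_1]
  have h' : (C (27 * (α : ℚ) ^ 2) : MvPolynomial (Fin n) ℚ) *
      MvPolynomial.map (Int.castRingHom ℚ) 𝒞 =
        (∑ i, C (β (Pi.single i 1) : ℚ) * X i) ^ 3 := by
    rw [← map_pow] at h
    simpa using h
  rw [← h', ← mul_assoc, hcancel, one_mul]

/-- Two-dimensional slices of a nondegenerate cubic form. -/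
theorem exists_slices (𝒞 : MvPolynomial (Fin n) ℤ) (h𝒞 : 𝒞.IsHomogeneous 3)
    (hdeg : ¬ ∃ (a : ℚ) (b : Fin n → ℚ), MvPolynomial.map (Int.castRingHom ℚ) 𝒞 =
        MvPolynomial.C a * (∑ i, MvPolynomial.C (b i) * MvPolynomial.X i) ^ 3) :
    ∃ (e f : Fin n → ℤ) (α γ δ : ℤ) (κ : ℝ), α ≠ 0 ∧ (γ ≠ 0 ∨ δ ≠ 0) ∧ 1 ≤ κ ∧
      (∀ (V : ℝ) (y : Fin n → ℤ), (∀ j, |(y j : ℝ)| ≤ V) → |(eval y 𝒞 : ℝ)| ≤ κ * V ^ 3) ∧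
      ∀ (V : ℝ) (y : Fin n → ℤ), (∀ j, |(y j : ℝ)| ≤ V) → ∃ a₁ a₂ a₃ b₁ b₂ d : ℤ,
        |(a₁ : ℝ)| ≤ κ * V ∧ |(a₂ : ℝ)| ≤ κ * V ∧ |(a₃ : ℝ)| ≤ κ * V ∧
        |(b₁ : ℝ)| ≤ κ * V ^ 2 ∧ |(b₂ : ℝ)| ≤ κ * V ^ 2 ∧
        ∀ u v : ℤ, eval (y + (u • e + v • f)) 𝒞 = binCubic α γ δ a₁ a₂ a₃ b₁ b₂ d (u, v) := by
  obtain ⟨T, τ, hτ, hT, hb⟩ := exists_trilinear 𝒞 h𝒞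
  obtain ⟨e, f, hα, hβ, hγδ⟩ := exists_slice_directions 𝒞 hdeg T hT
  obtain ⟨E, hE1, hEe, hEf⟩ : ∃ E : ℝ, 1 ≤ E ∧ (∀ j, |(e j : ℝ)| ≤ E) ∧ ∀ j, |(f j : ℝ)| ≤ E := by
    refine ⟨1 + ∑ j, (|(e j : ℝ)| + |(f j : ℝ)|), ?_, fun j => ?_, fun j => ?_⟩
    · have : 0 ≤ ∑ j, (|(e j : ℝ)| + |(f j : ℝ)|) := Finset.sum_nonneg fun _ _ => by positivity
      linarith
    all_goals
      have := Finset.single_le_sum (f := fun j => |(e j : ℝ)| + |(f j : ℝ)|)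
        (fun _ _ => by positivity) (Finset.mem_univ j)
      have := abs_nonneg (e j : ℝ)
      have := abs_nonneg (f j : ℝ)
      linarith
  have hV0 : ∀ (V : ℝ) (y : Fin n → ℤ), (∀ j, |(y j : ℝ)| ≤ V) → 0 ≤ V := by
    intro V y hy
    rcases isEmpty_or_nonempty (Fin n) with hn | ⟨⟨j⟩⟩
    · exact absurd (by rw [Subsingleton.elim e 0]; simp) hα
    · exact (abs_nonneg _).trans (hy j)
  refine ⟨e, f, _, _, _, 1 + 6 * τ * E ^ 2, hα, hγδ, ?_, ?_, ?_⟩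
  · have : 0 ≤ 6 * τ * E ^ 2 := by positivity
    linarith
  · intro V y hy
    rw [hT]
    have hV := hV0 V y hy
    refine (hb V V V y y y hy hy hy).trans ?_
    have : τ ≤ 1 + 6 * τ * E ^ 2 := by nlinarith [one_le_pow₀ (n := 2) hE1]
    calc τ * V * V * V = τ * V ^ 3 := by ring
      _ ≤ _ := by gcongr
  · intro V y hy
    have hV := hV0 V y hy
    have hEV : τ * E * V * V ≤ τ * E ^ 2 * V ^ 2 := by
      calc τ * E * V * V = τ * (E * 1) * V ^ 2 := by ring
        _ ≤ τ * (E * E) * V ^ 2 := by gcongr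
        _ = _ := by ring
    have h₁ : ∀ a b, (∀ j, |(a j : ℝ)| ≤ E) → (∀ j, |(b j : ℝ)| ≤ E) →
        |(T a b y : ℝ)| ≤ τ * E ^ 2 * V ∧ |(T a y b : ℝ)| ≤ τ * E ^ 2 * V ∧
        |(T y a b : ℝ)| ≤ τ * E ^ 2 * V := fun a b ha hb' =>
      ⟨(hb E E V a b y ha hb' hy).trans (le_of_eq (by ring)),
        (hb E V E a y b ha hy hb').trans (le_of_eq (by ring)),
        (hb V E E y a b hy ha hb').trans (le_of_eq (by ring))⟩
    have h₂ : ∀ a, (∀ j, |(a j : ℝ)| ≤ E) → |(T a y y : ℝ)| ≤ τ * E ^ 2 * V ^ 2 ∧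
        |(T y a y : ℝ)| ≤ τ * E ^ 2 * V ^ 2 ∧ |(T y y a : ℝ)| ≤ τ * E ^ 2 * V ^ 2 := fun a ha =>
      ⟨(hb E V V a y y ha hy hy).trans hEV,
        (hb V E V y a y hy ha hy).trans (le_trans (le_of_eq (by ring)) hEV),
        (hb V V E y y a hy hy ha).trans (le_trans (le_of_eq (by ring)) hEV)⟩
    have hV1 : 0 ≤ τ * E ^ 2 * V := by positivity
    have hV2 : 0 ≤ τ * E ^ 2 * V ^ 2 := by positivity
    have hV3 : 0 ≤ V ^ 2 := by positivity
    have h3 : ∀ {p q r B W : ℝ}, |p| ≤ B ∧ |q| ≤ B ∧ |r| ≤ B → 0 ≤ B → 0 ≤ W →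
        B = τ * E ^ 2 * W → |p + q + r| ≤ (1 + 6 * τ * E ^ 2) * W := by
      intro p q r B W h hB hW hBW
      have h4 := abs_add_three p q r
      nlinarith
    have hee := h₁ e e hEe hEe
    have hff := h₁ f f hEf hEf
    have hef := h₁ e f hEe hEf
    have hfe := h₁ f e hEf hEe
    refine ⟨T e e y + T e y e + T y e e,
      T e f y + T e y f + T f e y + T f y e + T y e f + T y f e,
      T f f y + T f y f + T y f f, T e y y + T y e y + T y y e, T f y y + T y f y + T y y f,
      T y y y, ?_, ?_, ?_, ?_, ?_, ?_⟩
    · push_cast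
      exact h3 hee hV1 hV rfl
    · push_cast
      have h4 := abs_add_three (T e f y : ℝ) (T e y f) (T y e f)
      have h5 := abs_add_three (T f e y : ℝ) (T f y e) (T y f e)
      have h6 := abs_add_le ((T e f y : ℝ) + T e y f + T y e f) (T f e y + T f y e + T y f e)
      have h7 : (T e f y : ℝ) + T e y f + T f e y + T f y e + T y e f + T y f e =
        T e f y + T e y f + T y e f + (T f e y + T f y e + T y f e) := by ring
      rw [h7]
      nlinarith
    · push_cast
      exact h3 hff hV1 hV rfl
    · push_cast
      exact h3 (h₂ e hEe) hV2 hV3 rfl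
    · push_cast
      exact h3 (h₂ f hEf) hV2 hV3 rfl
    · intro u v
      rw [hT, trilinear_expand, hβ, binCubic]
      ring

/-- The integer points of the box `|y_j| ≤ U`. -/
noncomputable def intBox (n U : ℕ) : Finset (Fin n → ℤ) :=
  Fintype.piFinset fun _ => Finset.Icc (-U : ℤ) U

theorem mem_intBox {U : ℕ} {y : Fin n → ℤ} : y ∈ intBox n U ↔ ∀ j, |y j| ≤ U := by
  simp [intBox, abs_le]

theorem card_Icc_neg (U : ℕ) : (Finset.Icc (-U : ℤ) U).card = 2 * U + 1 := by
  rw [Int.card_Icc]; omega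

theorem card_intBox (n U : ℕ) : (intBox n U).card = (2 * U + 1) ^ n := by
  rw [intBox, Fintype.card_piFinset]
  simp only [card_Icc_neg]
  simp

/-- Counting points of a box by averaging over translated slices. -/
theorem card_mul_card_le_of_slices {τ : Type*} [DecidableEq τ] (I : Finset ℤ) (J : Finset τ)
    (φ : τ → Fin n → ℤ) {U V W : ℕ} (hφ : ∀ t ∈ J, ∀ j, |φ t j| ≤ W) (hV : U + W ≤ V)
    (A : Finset (ℤ × (Fin n → ℤ))) (hA : A ⊆ I ×ˢ intBox n U) {B : ℝ}
    (hB : ∀ y ∈ intBox n V,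
      (((I ×ˢ J).filter fun z => (z.1, y + φ z.2) ∈ A).card : ℝ) ≤ B) :
    (A.card : ℝ) * J.card ≤ (2 * V + 1 : ℝ) ^ n * B := by
  classical
  have h1 : A.card * J.card ≤
      ∑ y ∈ intBox n V, ((I ×ˢ J).filter fun z => (z.1, y + φ z.2) ∈ A).card := by
    rw [← Finset.card_product, ← Finset.card_sigma]
    refine Finset.card_le_card_of_injOn (fun z => ⟨z.1.2 - φ z.2, (z.1.1, z.2)⟩) ?_ ?_
    · rintro ⟨⟨x, y⟩, t⟩ hz
      obtain ⟨h1, h2⟩ := Finset.mem_product.1 hz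
      have h3 := Finset.mem_product.1 (hA h1)
      have h4 := mem_intBox.1 h3.2
      refine Finset.mem_coe.2 (Finset.mem_sigma.2 ⟨mem_intBox.2 fun j => ?_,
        Finset.mem_filter.2 ⟨Finset.mem_product.2 ⟨h3.1, h2⟩, ?_⟩⟩)
      · have h5 := hφ t h2 j
        have h6 := h4 j
        change |y j - φ t j| ≤ _
        change |y j| ≤ _ at h6
        rw [abs_le] at h5 h6 ⊢
        omega
      · simpa using h1
    · rintro ⟨⟨x, y⟩, t⟩ _ ⟨⟨x', y'⟩, t'⟩ _ h
      simp only [Sigma.mk.injEq, Prod.mk.injEq, heq_eq_eq] at h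
      obtain ⟨h1, rfl, rfl⟩ := h
      rw [sub_left_inj.1 h1]
  calc (A.card : ℝ) * J.card ≤
      ∑ y ∈ intBox n V, (((I ×ˢ J).filter fun z => (z.1, y + φ z.2) ∈ A).card : ℝ) := by
        exact_mod_cast h1
    _ ≤ ∑ y ∈ intBox n V, B := Finset.sum_le_sum hB
    _ = _ := by
        rw [Finset.sum_const, card_intBox, nsmul_eq_mul]
        push_cast
        rfl

theorem cast_bounds_of_mem_intBox {V : ℕ} {y : Fin n → ℤ} (hy : y ∈ intBox n V) (j : Fin n) :
    |(y j : ℝ)| ≤ V := by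
  have := mem_intBox.1 hy j
  exact_mod_cast this

theorem exists_direction_bound (e f : Fin n → ℤ) : ∃ E : ℕ, ∀ (U : ℕ) (u v : ℤ), |u| ≤ U →
    |v| ≤ U → ∀ j, |(u • e + v • f) j| ≤ (E * U : ℕ) := by
  refine ⟨∑ j, ((e j).natAbs + (f j).natAbs), fun U u v hu hv j => ?_⟩
  have h1 : (e j).natAbs + (f j).natAbs ≤ ∑ j, ((e j).natAbs + (f j).natAbs) :=
    Finset.single_le_sum (f := fun j => (e j).natAbs + (f j).natAbs)
      (fun _ _ => Nat.zero_le _) (Finset.mem_univ j)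
  have h2 : |e j| + |f j| ≤ ((∑ j, ((e j).natAbs + (f j).natAbs) : ℕ) : ℤ) := by
    rw [Int.abs_eq_natAbs, Int.abs_eq_natAbs]
    exact_mod_cast h1
  simp only [Pi.add_apply, Pi.smul_apply, smul_eq_mul]
  push_cast at h2 ⊢
  calc |u * e j + v * f j| ≤ |u| * |e j| + |v| * |f j| := by
        rw [← abs_mul, ← abs_mul]; exact abs_add_le _ _
    _ ≤ U * |e j| + U * |f j| := by gcongr
    _ = (|e j| + |f j|) * U := by ring
    _ ≤ _ := by gcongr

/-- Points of a box at which the polynomial is divisible by a given `p²`. -/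
theorem exists_card_sq_dvd_le (𝒞 : MvPolynomial (Fin n) ℤ) (h𝒞 : 𝒞.IsHomogeneous 3)
    (hdeg : ¬ ∃ (a : ℚ) (b : Fin n → ℚ), MvPolynomial.map (Int.castRingHom ℚ) 𝒞 =
        MvPolynomial.C a * (∑ i, MvPolynomial.C (b i) * MvPolynomial.X i) ^ 3)
    {c : ℤ} (hc : c ≠ 0) :
    ∃ (K : ℝ) (N : ℕ), 0 < K ∧ ∀ X U p : ℕ, 1 ≤ X → 1 ≤ U → U ≤ 4 * X ^ 2 → p.Prime → N < p →
      ∀ A ⊆ Finset.Icc (-X : ℤ) X ×ˢ intBox n U,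
        (∀ z ∈ A, (p : ℤ) ^ 2 ∣ c * z.1 ^ 4 + eval z.2 𝒞) →
        (A.card : ℝ) * U ≤ K * (U : ℝ) ^ n * (X * U / (p : ℝ) ^ 2 + X) := by
  classical
  obtain ⟨e, f, α, γ, δ, κ, hα, -, -, -, hsl⟩ := exists_slices 𝒞 h𝒞 hdeg
  obtain ⟨E, hE⟩ := exists_direction_bound e f
  refine ⟨(2 * E + 3 : ℝ) ^ n * 1000, (6 * α * c).natAbs, by positivity, ?_⟩
  intro X U p hX hU hUX hp hpN A hA hAp
  have hpc : ¬ (p : ℤ) ∣ 6 * α * c := by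
    intro h
    have := Nat.le_of_dvd (Int.natAbs_pos.2 (by positivity)) (Int.natCast_dvd.1 h)
    omega
  have hU1 : (1 : ℝ) ≤ U := by exact_mod_cast hU
  have hmain := card_mul_card_le_of_slices (Finset.Icc (-X : ℤ) X) (Finset.Icc (-U : ℤ) U)
    (fun u => u • e + (0 : ℤ) • f) (U := U) (V := U + E * U) (W := E * U)
    (fun u hu => hE U u 0 (abs_le.2 (Finset.mem_Icc.1 hu)) (by simp)) le_rfl A hA
    (B := 1000 * (X * U / (p : ℝ) ^ 2 + X)) (by
      intro y hy
      obtain ⟨a₁, a₂, a₃, b₁, b₂, d, -, -, -, -, -, hb⟩ :=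
        hsl _ y fun j => cast_bounds_of_mem_intBox hy j
      refine quartic_cubic_count_le hp hX hUX
        (card_quartic_add_cubic_sq_dvd_le hp (a := a₁) (b := b₁) (d := d) hpc _
          (Finset.filter_subset _ _) ?_)
      intro z hz
      refine (hAp _ (Finset.mem_filter.1 hz).2).trans (dvd_of_eq ?_)
      simp only [hb, binCubic]
      ring)
  calc (A.card : ℝ) * U ≤ A.card * (Finset.Icc (-U : ℤ) U).card := by
        gcongr
        rw [card_Icc_neg]
        omega
    _ ≤ _ := hmain
    _ ≤ ((2 * E + 3) * U) ^ n * (1000 * (X * U / (p : ℝ) ^ 2 + X)) := by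
        gcongr
        push_cast
        nlinarith
    _ = _ := by rw [mul_pow]; ring

/-- Points of a box at which the polynomial is divisible by the square of a large prime. -/
theorem exists_card_large_sq_dvd_le (𝒞 : MvPolynomial (Fin n) ℤ) (h𝒞 : 𝒞.IsHomogeneous 3)
    (hdeg : ¬ ∃ (a : ℚ) (b : Fin n → ℚ), MvPolynomial.map (Int.castRingHom ℚ) 𝒞 =
        MvPolynomial.C a * (∑ i, MvPolynomial.C (b i) * MvPolynomial.X i) ^ 3)
    {c : ℤ} (hc : c ≠ 0) :
    ∃ K : ℝ, 0 < K ∧ ∀ X U : ℕ, 1 ≤ U → X ^ 4 ≤ (U + 1) ^ 3 →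
      ∀ A ⊆ Finset.Icc (-X : ℤ) X ×ˢ intBox n U,
        (∀ z ∈ A, c * z.1 ^ 4 + eval z.2 𝒞 ≠ 0 ∧
          ∃ p : ℕ, p.Prime ∧ U ^ 7 < p ^ 8 ∧ (p : ℤ) ^ 2 ∣ c * z.1 ^ 4 + eval z.2 𝒞) →
        (A.card : ℝ) * U ^ 2 ≤ K * (U : ℝ) ^ n * (U : ℝ) ^ (175 / 64 : ℝ) := by
  classical
  obtain ⟨e, f, α, γ, δ, κ, hα, hγδ, hκ, hval, hsl⟩ := exists_slices 𝒞 h𝒞 hdeg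
  obtain ⟨E, hE⟩ := exists_direction_bound e f
  obtain ⟨K, hK, hlarge⟩ := exists_card_large_prime_slice_le hα hγδ hc (κ * (1 + E) ^ 2)
    (by nlinarith [one_le_pow₀ (n := 2) (show (1 : ℝ) ≤ 1 + E by
      have : (0 : ℝ) ≤ E := Nat.cast_nonneg _
      linarith)]) (8 * c.natAbs + ⌈κ⌉₊) (by
      have := Int.natAbs_pos.2 hc
      omega)
  refine ⟨(2 * E + 3 : ℝ) ^ n * K, by positivity, ?_⟩
  intro X U hU hXU A hA hAp
  have hU1 : (1 : ℝ) ≤ U := by exact_mod_cast hU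
  have hE0 : (0 : ℝ) ≤ E := Nat.cast_nonneg _
  have hAb : ∀ z ∈ A, (c * z.1 ^ 4 + eval z.2 𝒞).natAbs ≤ (8 * c.natAbs + ⌈κ⌉₊) * U ^ 3 := by
    intro z hz
    obtain ⟨h1, h2⟩ := Finset.mem_product.1 (hA hz)
    have h3 : z.1.natAbs ≤ X := by
      have := Finset.mem_Icc.1 h1
      omega
    have h4 : (eval z.2 𝒞).natAbs ≤ ⌈κ⌉₊ * U ^ 3 := by
      have h5 := hval U z.2 fun j => cast_bounds_of_mem_intBox h2 j
      have h6 : ((eval z.2 𝒞).natAbs : ℝ) ≤ (⌈κ⌉₊ * U ^ 3 : ℕ) := by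
        rw [Nat.cast_natAbs]
        push_cast
        refine h5.trans ?_
        gcongr
        exact Nat.le_ceil κ
      exact_mod_cast h6
    calc (c * z.1 ^ 4 + eval z.2 𝒞).natAbs ≤ (c * z.1 ^ 4).natAbs + (eval z.2 𝒞).natAbs :=
          Int.natAbs_add_le _ _
      _ ≤ c.natAbs * X ^ 4 + ⌈κ⌉₊ * U ^ 3 := by
          rw [Int.natAbs_mul, Int.natAbs_pow]
          gcongr
      _ ≤ c.natAbs * (U + U) ^ 3 + ⌈κ⌉₊ * U ^ 3 := by
          have hX8 : X ^ 4 ≤ (U + U) ^ 3 := hXU.trans (by gcongr)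
          gcongr
      _ = _ := by ring
  have hmain := card_mul_card_le_of_slices (Finset.Icc (-X : ℤ) X)
    (Finset.Icc (-U : ℤ) U ×ˢ Finset.Icc (-U : ℤ) U)
    (fun w => w.1 • e + w.2 • f) (U := U) (V := U + E * U) (W := E * U)
    (fun w hw => hE U w.1 w.2 (abs_le.2 (Finset.mem_Icc.1 (Finset.mem_product.1 hw).1))
      (abs_le.2 (Finset.mem_Icc.1 (Finset.mem_product.1 hw).2))) le_rfl A hA
    (B := K * (U : ℝ) ^ (175 / 64 : ℝ)) (by
      intro y hy
      obtain ⟨a₁, a₂, a₃, b₁, b₂, d, h1, h2, h3, h4, h5, hb⟩ :=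
        hsl _ y fun j => cast_bounds_of_mem_intBox hy j
      have hV1 : κ * ((U + E * U : ℕ) : ℝ) ≤ κ * (1 + E) ^ 2 * U := by
        push_cast
        rw [mul_assoc]
        gcongr
        nlinarith [mul_nonneg hE0 (zero_le_one.trans hU1),
          mul_nonneg (mul_nonneg hE0 hE0) (zero_le_one.trans hU1)]
      have hV2 : κ * ((U + E * U : ℕ) : ℝ) ^ 2 ≤ κ * (1 + E) ^ 2 * U ^ 2 := by
        push_cast
        exact le_of_eq (by ring)
      have heq : ∀ w : ℤ × ℤ, eval (y + (w.1 • e + w.2 • f)) 𝒞 =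
          binCubic α γ δ a₁ a₂ a₃ b₁ b₂ d w := fun w => hb w.1 w.2
      refine hlarge U X hU hXU a₁ a₂ a₃ b₁ b₂ d (h1.trans hV1) (h2.trans hV1) (h3.trans hV1)
        (h4.trans hV2) (h5.trans hV2) _ (Finset.filter_subset _ _) ?_ ?_
      · intro z hz
        simp only [← heq]
        exact hAb _ (Finset.mem_filter.1 hz).2
      · intro z hz
        simp only [← heq]
        exact hAp _ (Finset.mem_filter.1 hz).2)
  calc (A.card : ℝ) * U ^ 2 ≤
      A.card * (Finset.Icc (-U : ℤ) U ×ˢ Finset.Icc (-U : ℤ) U).card := by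
        rw [Finset.card_product, card_Icc_neg]
        push_cast
        gcongr
        nlinarith
    _ ≤ _ := hmain
    _ ≤ ((2 * E + 3) * U) ^ n * (K * (U : ℝ) ^ (175 / 64 : ℝ)) := by
        gcongr
        push_cast
        nlinarith
    _ = _ := by rw [mul_pow]; ring

theorem one_sub_sum_le_prod {ι : Type*} (s : Finset ι) (a : ι → ℝ) (h0 : ∀ i, 0 ≤ a i)
    (h1 : ∀ i, a i ≤ 1) : 1 - ∑ i ∈ s, a i ≤ ∏ i ∈ s, (1 - a i) := by
  classical
  induction s using Finset.induction_on with
  | empty => simp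
  | insert i s hi ih =>
    rw [Finset.sum_insert hi, Finset.prod_insert hi]
    have h2 : 0 ≤ ∑ i ∈ s, a i := Finset.sum_nonneg fun i _ => h0 i
    nlinarith [mul_le_mul_of_nonneg_left ih (sub_nonneg.2 (h1 i)), mul_nonneg (h0 i) h2]

theorem abs_prod_sub_tprod_le {ι : Type*} (a : ι → ℝ) (h0 : ∀ i, 0 ≤ a i) (h1 : ∀ i, a i ≤ 1)
    (ha : Summable a) (S : Finset ι) {ε : ℝ}
    (hε : ∀ T : Finset ι, Disjoint T S → ∑ i ∈ T, a i ≤ ε) :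
    |∏ i ∈ S, (1 - a i) - ∏' i, (1 - a i)| ≤ ε := by
  classical
  have hm : Multipliable fun i => 1 - a i := by
    simpa only [sub_eq_add_neg] using Real.multipliable_one_add_of_summable ha.neg
  have hlim := hm.hasProd
  have hge : ∀ S' : Finset ι, S ≤ S' →
      |∏ i ∈ S, (1 - a i) - ∏ i ∈ S', (1 - a i)| ≤ ε := by
    intro S' hS
    have h2 := hε (S' \ S) Finset.sdiff_disjoint
    have h3 := one_sub_sum_le_prod (S' \ S) a h0 h1
    have h4 : ∏ i ∈ S' \ S, (1 - a i) ≤ 1 := Finset.prod_le_one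
      (fun i _ => sub_nonneg.2 (h1 i)) fun i _ => by linarith [h0 i]
    have h5 : ∏ i ∈ S, (1 - a i) ≤ 1 := Finset.prod_le_one
      (fun i _ => sub_nonneg.2 (h1 i)) fun i _ => by linarith [h0 i]
    have h6 : 0 ≤ ∏ i ∈ S, (1 - a i) := Finset.prod_nonneg fun i _ => sub_nonneg.2 (h1 i)
    rw [← Finset.prod_sdiff hS, abs_le]
    constructor <;> nlinarith
  refine le_of_tendsto ((tendsto_const_nhds.sub hlim).abs) ?_
  exact Filter.eventually_atTop.2 ⟨S, hge⟩

theorem primeCounting_floor_le {x : ℝ} (hx : 2 ≤ x) :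
    (Nat.primeCounting ⌊x⌋₊ : ℝ) ≤ 5 * x / Real.log x := by
  have h1 := Chebyshev.pi_le_log4_mul_div (x := x) (by linarith)
  have hl : 0 < Real.log x := Real.log_pos (by linarith)
  have h2 : Real.log √x = Real.log x / 2 := Real.log_sqrt (by linarith)
  have h4 : Real.log 4 ≤ 3 / 2 := by
    have : Real.log 4 = 2 * Real.log 2 := by
      rw [show (4 : ℝ) = 2 ^ 2 by norm_num, Real.log_pow]; norm_num
    linarith [Real.log_two_lt_d9]
  have h5 : Real.log x ≤ 2 * √x := by
    have := Real.log_le_rpow_div (x := x) (by linarith) (ε := 1 / 2) (by norm_num)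
    rw [← Real.sqrt_eq_rpow] at this
    linarith
  have h6 : √x * √x = x := Real.mul_self_sqrt (by linarith)
  rw [h2] at h1
  refine h1.trans ?_
  rw [le_div_iff₀ hl, add_mul]
  have h7 : Real.log 4 * x / (Real.log x / 2) * Real.log x = 2 * Real.log 4 * x := by
    field_simp
  rw [h7]
  nlinarith [Real.sqrt_nonneg x]

/-- Chebyshev's upper bound for the tail of `∑ 1 / p²` over primes. -/
theorem sum_primes_inv_sq_le {N : ℕ} (hN : 2 ≤ N) (T : Finset ℕ)
    (hT : ∀ p ∈ T, p.Prime ∧ N < p) :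
    ∑ p ∈ T, (1 / (p : ℝ) ^ 2) ≤ 20 / (N * Real.log N) := by
  have hN2 : (2 : ℝ) ≤ N := by exact_mod_cast hN
  have hl : 0 < Real.log N := Real.log_pos (by linarith)
  have key : ∀ k : ℕ, ∑ p ∈ T with p ≤ N * 2 ^ k, (1 / (p : ℝ) ^ 2) ≤
      20 / (N * Real.log N) * (1 - 1 / 2 ^ k) := by
    intro k
    induction k with
    | zero =>
      rw [Finset.filter_false_of_mem]
      · simp
      · intro p hp
        have := (hT p hp).2
        simp only [pow_zero, mul_one]
        omega
    | succ k ih =>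
      have hsplit : ∑ p ∈ T with p ≤ N * 2 ^ (k + 1), (1 / (p : ℝ) ^ 2) ≤
          ∑ p ∈ T with p ≤ N * 2 ^ k, (1 / (p : ℝ) ^ 2) +
          ∑ p ∈ T with N * 2 ^ k < p ∧ p ≤ N * 2 ^ (k + 1), (1 / (p : ℝ) ^ 2) := by
        rw [← Finset.sum_union]
        · refine Finset.sum_le_sum_of_subset_of_nonneg ?_ fun _ _ _ => by positivity
          intro p hp
          simp only [Finset.mem_union, Finset.mem_filter] at hp ⊢
          by_cases h : p ≤ N * 2 ^ k
          · exact Or.inl ⟨hp.1, h⟩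
          · exact Or.inr ⟨hp.1, by omega, hp.2⟩
        · refine Finset.disjoint_filter.2 fun p _ h1 h2 => ?_
          omega
      have hM : (2 : ℝ) ≤ N * 2 ^ (k + 1) := by
        nlinarith [one_le_pow₀ (M₀ := ℝ) (n := k + 1) one_le_two]
      have hcard : ((T.filter fun p => N * 2 ^ k < p ∧ p ≤ N * 2 ^ (k + 1)).card : ℝ) ≤
          5 * (N * 2 ^ (k + 1)) / Real.log N := by
        have h1 := primeCounting_floor_le hM
        have h2 : ⌊(N : ℝ) * 2 ^ (k + 1)⌋₊ = N * 2 ^ (k + 1) := by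
          have : (N : ℝ) * 2 ^ (k + 1) = ((N * 2 ^ (k + 1) : ℕ) : ℝ) := by push_cast; ring
          rw [this, Nat.floor_natCast]
        rw [h2, Nat.primeCounting, Nat.primeCounting', Nat.count_eq_card_filter_range] at h1
        have h3 : (T.filter fun p => N * 2 ^ k < p ∧ p ≤ N * 2 ^ (k + 1)).card ≤
            ((Finset.range (N * 2 ^ (k + 1) + 1)).filter Nat.Prime).card := by
          refine Finset.card_le_card fun p hp => ?_
          obtain ⟨h4, h5, h6⟩ := Finset.mem_filter.1 hp
          exact Finset.mem_filter.2 ⟨Finset.mem_range.2 (by omega), (hT p h4).1⟩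
        calc _ ≤ _ := Nat.cast_le.2 h3
          _ ≤ _ := h1
          _ ≤ _ := by
            gcongr
            nlinarith [one_le_pow₀ (M₀ := ℝ) (n := k + 1) one_le_two]
      have hlast : ∑ p ∈ T with N * 2 ^ k < p ∧ p ≤ N * 2 ^ (k + 1), (1 / (p : ℝ) ^ 2) ≤
          20 / (N * Real.log N) * (1 / 2 ^ (k + 1)) := by
        calc _ ≤ ∑ p ∈ T with N * 2 ^ k < p ∧ p ≤ N * 2 ^ (k + 1),
              (1 / ((N : ℝ) * 2 ^ k) ^ 2) := by
              refine Finset.sum_le_sum fun p hp => ?_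
              have h1 := (Finset.mem_filter.1 hp).2.1.le
              have h2 : (N : ℝ) * 2 ^ k ≤ p := by exact_mod_cast h1
              gcongr
          _ ≤ 5 * (N * 2 ^ (k + 1)) / Real.log N * (1 / ((N : ℝ) * 2 ^ k) ^ 2) := by
              rw [Finset.sum_const, nsmul_eq_mul]
              gcongr
          _ = _ := by
              rw [pow_succ]
              field_simp
              norm_num
      calc _ ≤ _ := hsplit
        _ ≤ _ := add_le_add ih hlast
        _ = _ := by
          rw [pow_succ]
          field_simp
          ring
  have hall : T.filter (fun p => p ≤ N * 2 ^ (T.sup id)) = T := by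
    refine Finset.filter_true_of_mem fun p hp => ?_
    have h1 : p ≤ T.sup id := Finset.le_sup (f := id) hp
    have h2 : T.sup id < 2 ^ (T.sup id) := Nat.lt_two_pow_self
    nlinarith
  have := key (T.sup id)
  rw [hall] at this
  refine this.trans (mul_le_of_le_one_right (by positivity) ?_)
  have : (0 : ℝ) ≤ 1 / 2 ^ (T.sup id) := by positivity
  linarith

/-- The number of zeros of `c x⁴ + 𝒞(y)` modulo `m`. -/
noncomputable def zeroCount (c : ℤ) (𝒞 : MvPolynomial (Fin n) ℤ) (m : ℕ) : ℕ :=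
  Nat.card {y : ZMod m × (Fin n → ZMod m) // (c : ZMod m) * y.1 ^ 4 + aeval y.2 𝒞 = 0}

theorem cast_quartic_add_eval {R : Type*} [CommRing R] (c : ℤ) (𝒞 : MvPolynomial (Fin n) ℤ)
    (x : ℤ) (y : Fin n → ℤ) :
    ((c * x ^ 4 + eval y 𝒞 : ℤ) : R) = c * (x : R) ^ 4 + aeval (fun j => (y j : R)) 𝒞 := by
  have h := aeval_algebraMap_apply (R := ℤ) (A := ℤ) R y 𝒞
  have h2 : (fun j => (y j : R)) = algebraMap ℤ R ∘ y := by ext j; simp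
  have h3 : aeval y 𝒞 = eval y 𝒞 := DFunLike.congr_fun (coe_aeval_eq_eval y) 𝒞
  rw [h2, h, h3]
  simp

theorem zeroCount_le (c : ℤ) (𝒞 : MvPolynomial (Fin n) ℤ) (m : ℕ) [NeZero m] :
    zeroCount c 𝒞 m ≤ m ^ (n + 1) := by
  classical
  refine (Finite.card_subtype_le _).trans ?_
  rw [Nat.card_prod, Nat.card_fun, Nat.card_zmod, Nat.card_fin, pow_succ']

/-- The density of zeros modulo `p²` is `O(1 / p²)`. -/
theorem exists_zeroCount_le (𝒞 : MvPolynomial (Fin n) ℤ) (h𝒞 : 𝒞.IsHomogeneous 3)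
    (hdeg : ¬ ∃ (a : ℚ) (b : Fin n → ℚ), MvPolynomial.map (Int.castRingHom ℚ) 𝒞 =
        MvPolynomial.C a * (∑ i, MvPolynomial.C (b i) * MvPolynomial.X i) ^ 3)
    {c : ℤ} (hc : c ≠ 0) :
    ∃ K : ℝ, 0 < K ∧ ∀ p : ℕ, p.Prime →
      (zeroCount c 𝒞 (p ^ 2) : ℝ) / (p : ℝ) ^ (2 * (n + 1)) ≤ K * (1 / (p : ℝ) ^ 2) := by
  classical
  obtain ⟨K, N, hK, h⟩ := exists_card_sq_dvd_le 𝒞 h𝒞 hdeg hc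
  refine ⟨2 * K + N ^ 2, by positivity, fun p hp => ?_⟩
  have hp0 : (0 : ℝ) < p := by exact_mod_cast hp.pos
  have hpp : 0 < p ^ 2 := pow_pos hp.pos 2
  have : NeZero (p ^ 2) := ⟨hpp.ne'⟩
  rw [div_le_iff₀ (by positivity), pow_mul, pow_succ ((p : ℝ) ^ 2) n]
  have e1 : (2 * K + (N : ℝ) ^ 2) * (1 / (p : ℝ) ^ 2) * (((p : ℝ) ^ 2) ^ n * (p : ℝ) ^ 2) =
      2 * K * ((p : ℝ) ^ 2) ^ n + N ^ 2 * ((p : ℝ) ^ 2) ^ n := by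
    field_simp
  rw [e1]
  rcases le_or_gt p N with hpN | hpN
  · have h1 : (zeroCount c 𝒞 (p ^ 2) : ℝ) ≤ ((p : ℝ) ^ 2) ^ (n + 1) := by
      exact_mod_cast zeroCount_le c 𝒞 (p ^ 2)
    have h2 : (p : ℝ) ^ 2 ≤ N ^ 2 := by gcongr
    rw [pow_succ' ((p : ℝ) ^ 2) n] at h1
    have h3 : (0 : ℝ) ≤ ((p : ℝ) ^ 2) ^ n := by positivity
    nlinarith [mul_le_mul_of_nonneg_right h2 h3, mul_nonneg hK.le h3]
  · let φ : ZMod (p ^ 2) × (Fin n → ZMod (p ^ 2)) → ℤ × (Fin n → ℤ) :=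
      fun y => (y.1.val, fun j => (y.2 j).val)
    have hφ : Function.Injective φ := by
      rintro ⟨x, y⟩ ⟨x', y'⟩ h
      obtain ⟨h1, h2⟩ := Prod.mk.inj h
      refine Prod.ext (ZMod.val_injective _ (by exact_mod_cast h1)) (funext fun j => ?_)
      exact ZMod.val_injective _ (by exact_mod_cast congrFun h2 j)
    have hb : ∀ t : ZMod (p ^ 2), |((t.val : ℕ) : ℤ)| ≤ (p ^ 2 : ℕ) := by
      intro t
      rw [Nat.abs_cast]
      exact_mod_cast (ZMod.val_lt t).le
    have h1 := h (p ^ 2) (p ^ 2) p hpp hpp (by nlinarith) hp hpN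
      ((Finset.univ.filter fun y : ZMod (p ^ 2) × (Fin n → ZMod (p ^ 2)) =>
        (c : ZMod (p ^ 2)) * y.1 ^ 4 + aeval y.2 𝒞 = 0).image φ) (by
          intro z hz
          obtain ⟨y, -, rfl⟩ := Finset.mem_image.1 hz
          exact Finset.mem_product.2 ⟨Finset.mem_Icc.2 (abs_le.1 (hb y.1)),
            mem_intBox.2 fun j => hb (y.2 j)⟩) (by
          intro z hz
          obtain ⟨y, hy, rfl⟩ := Finset.mem_image.1 hz
          have h2 := (Finset.mem_filter.1 hy).2
          have h3 : ((c * (φ y).1 ^ 4 + eval (φ y).2 𝒞 : ℤ) : ZMod (p ^ 2)) = 0 := by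
            rw [cast_quartic_add_eval, ← h2]
            simp [φ]
          exact_mod_cast (ZMod.intCast_zmod_eq_zero_iff_dvd _ _).1 h3)
    rw [Finset.card_image_of_injective _ hφ, ← Fintype.card_subtype, ← Nat.card_eq_fintype_card]
      at h1
    change (zeroCount c 𝒞 (p ^ 2) : ℝ) * _ ≤ _ at h1
    push_cast at h1
    have e2 : K * ((p : ℝ) ^ 2) ^ n * ((p : ℝ) ^ 2 * (p : ℝ) ^ 2 / (p : ℝ) ^ 2 + (p : ℝ) ^ 2) =
        2 * K * ((p : ℝ) ^ 2) ^ n * (p : ℝ) ^ 2 := by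
      field_simp
      ring
    rw [e2] at h1
    have h4 := le_of_mul_le_mul_right h1 (by positivity)
    have h3 : (0 : ℝ) ≤ N ^ 2 * ((p : ℝ) ^ 2) ^ n := by positivity
    linarith

/-- Residues avoiding zeros modulo pairwise coprime moduli, counted by the Chinese remainder
theorem. -/
theorem card_nonzero_residues {ι : Type*} [Fintype ι] (a : ι → ℕ)
    [∀ i, NeZero (a i)] (ha : Pairwise (Function.onFun Nat.Coprime a)) (c : ℤ)
    (𝒞 : MvPolynomial (Fin n) ℤ) :
    (Nat.card {y : ZMod (∏ i, a i) × (Fin n → ZMod (∏ i, a i)) //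
      ∀ i, (c : ZMod (a i)) * (ZMod.prodEquivPi a ha y.1 i) ^ 4 +
        aeval (fun j => ZMod.prodEquivPi a ha (y.2 j) i) 𝒞 ≠ 0} : ℝ) =
      ((∏ i, a i : ℕ) : ℝ) ^ (n + 1) *
        ∏ i, (1 - (zeroCount c 𝒞 (a i) : ℝ) / (a i : ℝ) ^ (n + 1)) := by
  classical
  let e : ZMod (∏ i, a i) × (Fin n → ZMod (∏ i, a i)) ≃
      ((i : ι) → ZMod (a i) × (Fin n → ZMod (a i))) :=
    { toFun := fun y i => (ZMod.prodEquivPi a ha y.1 i, fun j => ZMod.prodEquivPi a ha (y.2 j) i)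
      invFun := fun z => ((ZMod.prodEquivPi a ha).symm fun i => (z i).1,
        fun j => (ZMod.prodEquivPi a ha).symm fun i => (z i).2 j)
      left_inv := fun y => Prod.ext ((ZMod.prodEquivPi a ha).symm_apply_apply _)
        (funext fun j => (ZMod.prodEquivPi a ha).symm_apply_apply _)
      right_inv := fun z => funext fun i => Prod.ext
        (congrFun ((ZMod.prodEquivPi a ha).apply_symm_apply fun i => (z i).1) i)
        (funext fun j => congrFun ((ZMod.prodEquivPi a ha).apply_symm_apply
          fun i => (z i).2 j) i) }
  let g : (i : ι) → ZMod (a i) × (Fin n → ZMod (a i)) → Prop := fun i w =>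
    (c : ZMod (a i)) * w.1 ^ 4 + aeval w.2 𝒞 ≠ 0
  have e1 : {y : ZMod (∏ i, a i) × (Fin n → ZMod (∏ i, a i)) //
      ∀ i, (c : ZMod (a i)) * (ZMod.prodEquivPi a ha y.1 i) ^ 4 +
        aeval (fun j => ZMod.prodEquivPi a ha (y.2 j) i) 𝒞 ≠ 0} ≃
      ((i : ι) → {w : ZMod (a i) × (Fin n → ZMod (a i)) // g i w}) :=
    (e.subtypeEquiv (q := fun w => ∀ i, g i (w i)) fun y => Iff.rfl).trans
      Equiv.subtypePiEquivPi
  rw [Nat.card_congr e1, Nat.card_pi]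
  push_cast
  rw [← Finset.prod_pow, ← Finset.prod_mul_distrib]
  refine Finset.prod_congr rfl fun i _ => ?_
  have h1 : Nat.card {w : ZMod (a i) × (Fin n → ZMod (a i)) // g i w} + zeroCount c 𝒞 (a i) =
      a i ^ (n + 1) := by
    have h2 : Fintype.card {w : ZMod (a i) × (Fin n → ZMod (a i)) //
        (c : ZMod (a i)) * w.1 ^ 4 + aeval w.2 𝒞 = 0} +
        Fintype.card {w : ZMod (a i) × (Fin n → ZMod (a i)) // g i w} =
        Fintype.card (ZMod (a i) × (Fin n → ZMod (a i))) := by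
      rw [← Fintype.card_congr (Equiv.sumCompl
        fun w : ZMod (a i) × (Fin n → ZMod (a i)) => (c : ZMod (a i)) * w.1 ^ 4 + aeval w.2 𝒞 = 0),
        Fintype.card_sum]
    rw [zeroCount, Nat.card_eq_fintype_card, Nat.card_eq_fintype_card, add_comm, h2]
    simp [ZMod.card, pow_succ']
  have h3 : ((a i : ℕ) : ℝ) ≠ 0 := Nat.cast_ne_zero.2 (NeZero.ne _)
  have h4 : (Nat.card {w : ZMod (a i) × (Fin n → ZMod (a i)) // g i w} : ℝ) +
      zeroCount c 𝒞 (a i) = (a i : ℝ) ^ (n + 1) := by exact_mod_cast h1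
  rw [mul_sub, mul_one, mul_div_cancel₀ _ (pow_ne_zero _ h3)]
  linarith

theorem abs_card_residue_sub_le {m : ℕ} (hm : 0 < m) {Q : ℝ} (hQ : 0 ≤ Q) (r : ZMod m) :
    |(((Finset.Icc (-⌊Q⌋₊ : ℤ) ⌊Q⌋₊).filter fun t : ℤ => (t : ZMod m) = r).card : ℝ) -
      2 / m * Q| ≤ 2 := by
  have : NeZero m := ⟨hm.ne'⟩
  have hm0 : (0 : ℝ) < m := Nat.cast_pos.2 hm
  have hm1 : (1 : ℝ) ≤ m := Nat.one_le_cast.2 hm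
  have h1 : ((Finset.Icc (-⌊Q⌋₊ : ℤ) ⌊Q⌋₊).filter fun t : ℤ => (t : ZMod m) = r) =
      (Finset.Ico (-⌊Q⌋₊ : ℤ) (⌊Q⌋₊ + 1)).filter fun t : ℤ => t ≡ r.val [ZMOD m] := by
    ext t
    simp only [Finset.mem_filter, Finset.mem_Icc, Finset.mem_Ico, Int.lt_add_one_iff]
    rw [← ZMod.intCast_eq_intCast_iff]
    simp
  have h2 := Int.Ico_filter_modEq_card (-⌊Q⌋₊ : ℤ) (⌊Q⌋₊ + 1) (r := m) (by exact_mod_cast hm)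
    r.val
  rw [h1]
  set u : ℚ := (((⌊Q⌋₊ + 1 : ℤ) : ℚ) - ((r.val : ℤ) : ℚ)) / ((m : ℤ) : ℚ) with hu
  set v : ℚ := (((-⌊Q⌋₊ : ℤ) : ℚ) - ((r.val : ℤ) : ℚ)) / ((m : ℤ) : ℚ) with hv
  have huv : (u : ℝ) - v = (2 * ⌊Q⌋₊ + 1) / m := by
    rw [hu, hv]
    push_cast
    ring
  have hvu : v ≤ u := by
    have : (0 : ℝ) ≤ (u : ℝ) - v := by rw [huv]; positivity
    exact_mod_cast sub_nonneg.1 this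
  rw [max_eq_left (sub_nonneg.2 (Int.ceil_mono hvu))] at h2
  have h3 : (((Finset.Ico (-⌊Q⌋₊ : ℤ) (⌊Q⌋₊ + 1)).filter
      fun t : ℤ => t ≡ r.val [ZMOD m]).card : ℝ) = (⌈u⌉ : ℝ) - ⌈v⌉ := by
    exact_mod_cast congrArg (Int.cast : ℤ → ℝ) h2
  rw [h3]
  have c1 : (u : ℝ) ≤ ⌈u⌉ := by exact_mod_cast Int.le_ceil u
  have c2 : (⌈u⌉ : ℝ) < u + 1 := by exact_mod_cast Int.ceil_lt_add_one u
  have c3 : (v : ℝ) ≤ ⌈v⌉ := by exact_mod_cast Int.le_ceil v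
  have c4 : (⌈v⌉ : ℝ) < v + 1 := by exact_mod_cast Int.ceil_lt_add_one v
  have f1 := Nat.floor_le hQ
  have f2 := Nat.lt_floor_add_one Q
  have d1 : (u : ℝ) - v - 2 / m * Q ≤ 1 := by
    rw [huv, div_mul_eq_mul_div, ← sub_div, div_le_one hm0]
    linarith
  have d2 : -1 ≤ (u : ℝ) - v - 2 / m * Q := by
    rw [huv, div_mul_eq_mul_div, ← sub_div, le_div_iff₀ hm0]
    linarith
  rw [abs_le]
  constructor <;> linarith

theorem abs_mul_prod_sub_le {m Q P : ℝ} (hm : 0 < m) (hmQ : m ≤ Q) (hQP : Q ≤ P) {f₀ : ℝ}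
    {f : Fin n → ℝ} (h₀ : |f₀ - 2 / m * Q| ≤ 2) (hf : ∀ j, |f j - 2 / m * P| ≤ 2) :
    |f₀ * ∏ j, f j - (2 / m) ^ (n + 1) * (Q * P ^ n)| ≤
      2 ^ (n + 1) * (m / Q) * ((2 / m) ^ (n + 1) * (Q * P ^ n)) := by
  have hQ : 0 < Q := hm.trans_le hmQ
  have hP : 0 < P := hQ.trans_le hQP
  set η := m / Q with hη
  have hη0 : 0 ≤ η := by positivity
  have hη1 : η ≤ 1 := (div_le_one hQ).2 hmQ
  have key : ∀ R g : ℝ, Q ≤ R → |g - 2 / m * R| ≤ 2 →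
      2 / m * R * (1 - η) ≤ g ∧ g ≤ 2 / m * R * (1 + η) := by
    intro R g hR hg
    have h1 : 2 ≤ 2 / m * R * η := by
      have : 2 / m * R * η = 2 * (R / Q) := by
        rw [hη]; field_simp
      rw [this]
      have := (one_le_div hQ).2 hR
      linarith
    rw [abs_le] at hg
    constructor <;> nlinarith
  have hlow : 0 ≤ 1 - η := by linarith
  obtain ⟨a1, a2⟩ := key Q f₀ le_rfl h₀
  have b1 : (2 / m * P * (1 - η)) ^ n ≤ ∏ j, f j := by
    calc _ = ∏ _j : Fin n, (2 / m * P * (1 - η)) := by simp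
      _ ≤ _ := Finset.prod_le_prod (fun _ _ => by positivity) fun j _ => (key P _ hQP (hf j)).1
  have b2 : ∏ j, f j ≤ (2 / m * P * (1 + η)) ^ n := by
    calc _ ≤ ∏ _j : Fin n, (2 / m * P * (1 + η)) :=
          Finset.prod_le_prod (fun j _ => le_trans (by positivity) (key P _ hQP (hf j)).1)
            fun j _ => (key P _ hQP (hf j)).2
      _ = _ := by simp
  have hM : 0 ≤ (2 / m) ^ (n + 1) * (Q * P ^ n) := by positivity
  have u1 : (1 + η) ^ (n + 1) ≤ 1 + 2 ^ (n + 1) * η := by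
    have : ∀ k : ℕ, (1 + η) ^ k ≤ 1 + (2 ^ k - 1) * η := by
      intro k
      induction k with
      | zero => simp
      | succ k ih =>
        have h2 : (1 : ℝ) ≤ 2 ^ k := one_le_pow₀ one_le_two
        rw [pow_succ, pow_succ]
        nlinarith [mul_le_mul_of_nonneg_right ih (by linarith : 0 ≤ 1 + η),
          mul_nonneg (sub_nonneg.2 h2) hη0, mul_nonneg (mul_nonneg (sub_nonneg.2 h2) hη0)
            (sub_nonneg.2 hη1)]
    nlinarith [this (n + 1)]
  have u2 : 1 - 2 ^ (n + 1) * η ≤ (1 - η) ^ (n + 1) := by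
    have h1 := one_add_mul_le_pow (a := -η) (by linarith) (n + 1)
    have h2 : ((n + 1 : ℕ) : ℝ) ≤ 2 ^ (n + 1) := by
      exact_mod_cast (Nat.lt_two_pow_self (n := n + 1)).le
    rw [← sub_eq_add_neg] at h1
    nlinarith
  have e1 : 2 / m * Q * (1 + η) * (2 / m * P * (1 + η)) ^ n =
      (2 / m) ^ (n + 1) * (Q * P ^ n) * (1 + η) ^ (n + 1) := by
    simp only [mul_pow, pow_succ]; ring
  have e2 : 2 / m * Q * (1 - η) * (2 / m * P * (1 - η)) ^ n =
      (2 / m) ^ (n + 1) * (Q * P ^ n) * (1 - η) ^ (n + 1) := by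
    simp only [mul_pow, pow_succ]; ring
  have hp : 0 ≤ ∏ j, f j := le_trans (by positivity) b1
  have t1 : f₀ * ∏ j, f j ≤ (2 / m) ^ (n + 1) * (Q * P ^ n) * (1 + 2 ^ (n + 1) * η) := by
    calc _ ≤ 2 / m * Q * (1 + η) * (2 / m * P * (1 + η)) ^ n := by gcongr
      _ = _ := e1
      _ ≤ _ := by gcongr
  have t2 : (2 / m) ^ (n + 1) * (Q * P ^ n) * (1 - 2 ^ (n + 1) * η) ≤ f₀ * ∏ j, f j := by
    calc _ ≤ (2 / m) ^ (n + 1) * (Q * P ^ n) * (1 - η) ^ (n + 1) := by gcongr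
      _ = _ := e2.symm
      _ ≤ _ := by
        gcongr
        exact le_trans (by positivity) a1
  rw [abs_le]
  constructor <;> linarith

/-- The integer points with `|x| ≤ Q` and `|y_j| ≤ P`. -/
noncomputable def pointBox (n : ℕ) (Q P : ℝ) : Finset (ℤ × (Fin n → ℤ)) :=
  Finset.Icc (-⌊Q⌋₊ : ℤ) ⌊Q⌋₊ ×ˢ intBox n ⌊P⌋₊

/-- Counting points of a box whose residues lie in a given set. -/
theorem abs_card_residues_sub_le {m : ℕ} (hm : 0 < m) {Q P : ℝ} (hmQ : m ≤ Q) (hQP : Q ≤ P)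
    (G : Finset (ZMod m × (Fin n → ZMod m))) :
    |(((pointBox n Q P).filter
        fun z => ((z.1 : ZMod m), fun j => (z.2 j : ZMod m)) ∈ G).card : ℝ) -
      2 ^ (n + 1) * (Q * P ^ n) * (G.card / (m : ℝ) ^ (n + 1))| ≤
      4 ^ (n + 1) * (m * P ^ n) := by
  classical
  have : NeZero m := ⟨hm.ne'⟩
  have hm0 : (0 : ℝ) < m := Nat.cast_pos.2 hm
  have hQ : 0 < Q := hm0.trans_le hmQ
  have hP : 0 < P := hQ.trans_le hQP
  have h1 : ((pointBox n Q P).filter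
        fun z => ((z.1 : ZMod m), fun j => (z.2 j : ZMod m)) ∈ G).card =
      ∑ r ∈ G, ((Finset.Icc (-⌊Q⌋₊ : ℤ) ⌊Q⌋₊).filter fun t : ℤ => (t : ZMod m) = r.1).card *
        ∏ j, ((Finset.Icc (-⌊P⌋₊ : ℤ) ⌊P⌋₊).filter fun t : ℤ => (t : ZMod m) = r.2 j).card := by
    rw [Finset.card_eq_sum_card_fiberwise (t := G)
      (f := fun z => ((z.1 : ZMod m), fun j => (z.2 j : ZMod m)))]
    · refine Finset.sum_congr rfl fun r hr => ?_
      rw [← Fintype.card_piFinset, ← Finset.card_product]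
      congr 1
      ext z
      simp only [pointBox, intBox, Finset.mem_filter, Finset.mem_product, Fintype.mem_piFinset,
        Prod.ext_iff, funext_iff]
      constructor
      · rintro ⟨⟨⟨h1, h2⟩, -⟩, h3, h4⟩
        exact ⟨⟨h1, h3⟩, fun j => ⟨h2 j, h4 j⟩⟩
      · rintro ⟨⟨h1, h3⟩, h4⟩
        refine ⟨⟨⟨h1, fun j => (h4 j).1⟩, ?_⟩, h3, fun j => (h4 j).2⟩
        have : ((z.1 : ZMod m), fun j => (z.2 j : ZMod m)) = r :=
          Prod.ext h3 (funext fun j => (h4 j).2)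
        rwa [this]
    · intro z hz
      exact (Finset.mem_filter.1 hz).2
  set M : ℝ := (2 / m : ℝ) ^ (n + 1) * (Q * P ^ n) with hM
  have h2 : 2 ^ (n + 1) * (Q * P ^ n) * (G.card / (m : ℝ) ^ (n + 1)) = ∑ r ∈ G, M := by
    rw [Finset.sum_const, nsmul_eq_mul, hM, div_pow]
    ring
  rw [h1, h2]
  push_cast
  rw [← Finset.sum_sub_distrib]
  have hG : (G.card : ℝ) ≤ (m : ℝ) ^ (n + 1) := by
    have := Finset.card_le_univ G
    rw [Fintype.card_prod, Fintype.card_fun, ZMod.card, Fintype.card_fin, ← pow_succ'] at this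
    exact_mod_cast this
  calc _ ≤ ∑ r ∈ G, 2 ^ (n + 1) * (m / Q) * M := by
        refine (Finset.abs_sum_le_sum_abs _ _).trans (Finset.sum_le_sum fun r hr => ?_)
        exact abs_mul_prod_sub_le hm0 hmQ hQP (abs_card_residue_sub_le hm hQ.le r.1)
          fun j => abs_card_residue_sub_le hm hP.le (r.2 j)
    _ = G.card * (2 ^ (n + 1) * (m / Q) * M) := by rw [Finset.sum_const, nsmul_eq_mul]
    _ ≤ (m : ℝ) ^ (n + 1) * (2 ^ (n + 1) * (m / Q) * M) := by
        gcongr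
    _ = _ := by
        rw [hM, div_pow, show (4 : ℝ) = 2 * 2 by norm_num, mul_pow]
        field_simp

/-- The points of a box at which the polynomial is divisible by no `p²` with `p ∈ S`. -/
theorem abs_card_sifted_sub_le (c : ℤ) (𝒞 : MvPolynomial (Fin n) ℤ) (S : Finset Nat.Primes)
    {Q P : ℝ} (hmQ : ((∏ p ∈ S, (p : ℕ) ^ 2 : ℕ) : ℝ) ≤ Q) (hQP : Q ≤ P) :
    |(Finset.card {z ∈ pointBox n Q P |
        ∀ p ∈ S, ¬ ((p : ℕ) : ℤ) ^ 2 ∣ c * z.1 ^ 4 + eval z.2 𝒞} : ℝ) -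
      2 ^ (n + 1) * (Q * P ^ n) *
        ∏ p ∈ S, (1 - (zeroCount c 𝒞 ((p : ℕ) ^ 2) : ℝ) / ((p : ℕ) : ℝ) ^ (2 * (n + 1)))| ≤
      4 ^ (n + 1) * (((∏ p ∈ S, (p : ℕ) ^ 2 : ℕ) : ℝ) * P ^ n) := by
  classical
  let a : S → ℕ := fun i => (i : ℕ) ^ 2
  have ha0 : ∀ i, 0 < a i := fun i => pow_pos i.1.2.pos 2
  have : ∀ i, NeZero (a i) := fun i => ⟨(ha0 i).ne'⟩
  have ha : Pairwise (Function.onFun Nat.Coprime a) := by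
    intro i j hij
    refine Nat.Coprime.pow 2 2 ((Nat.coprime_primes i.1.2 j.1.2).2 fun h => hij ?_)
    exact Subtype.ext (Subtype.ext h)
  have hm : ∏ p ∈ S, (p : ℕ) ^ 2 = ∏ i, a i :=
    (Finset.prod_coe_sort S fun p : Nat.Primes => (p : ℕ) ^ 2).symm
  have hm0 : 0 < ∏ i, a i := Finset.prod_pos fun i _ => ha0 i
  have : NeZero (∏ i, a i) := ⟨hm0.ne'⟩
  rw [hm] at hmQ ⊢
  let good : ZMod (∏ i, a i) × (Fin n → ZMod (∏ i, a i)) → Prop := fun y =>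
    ∀ i, (c : ZMod (a i)) * (ZMod.prodEquivPi a ha y.1 i) ^ 4 +
        aeval (fun j => ZMod.prodEquivPi a ha (y.2 j) i) 𝒞 ≠ 0
  have h1 := abs_card_residues_sub_le hm0 hmQ hQP (Finset.univ.filter good)
  have h2 := card_nonzero_residues a ha c 𝒞
  change (Nat.card {y // good y} : ℝ) = _ at h2
  rw [Nat.card_eq_fintype_card, Fintype.card_subtype] at h2
  have h3 : ((∏ i, a i : ℕ) : ℝ) ^ (n + 1) ≠ 0 := pow_ne_zero _ (Nat.cast_ne_zero.2 hm0.ne')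
  rw [h2, mul_div_cancel_left₀ _ h3] at h1
  have h4 : ∏ i, (1 - (zeroCount c 𝒞 (a i) : ℝ) / (a i : ℝ) ^ (n + 1)) =
      ∏ p ∈ S, (1 - (zeroCount c 𝒞 ((p : ℕ) ^ 2) : ℝ) / ((p : ℕ) : ℝ) ^ (2 * (n + 1))) := by
    rw [← Finset.prod_coe_sort S]
    refine Finset.prod_congr rfl fun i _ => ?_
    simp only [a]
    push_cast
    rw [← pow_mul]
  rw [h4] at h1
  refine Eq.trans_le ?_ h1
  congr 4
  ext z
  refine Finset.mem_filter.trans (Iff.trans (and_congr_right fun _ => ?_) Finset.mem_filter.symm)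
  simp only [Finset.mem_filter, Finset.mem_univ, true_and, good]
  have h5 : ∀ i, ((c : ZMod (a i)) * (ZMod.prodEquivPi a ha (z.1 : ZMod (∏ i, a i)) i) ^ 4 +
        aeval (fun j => ZMod.prodEquivPi a ha (z.2 j : ZMod (∏ i, a i)) i) 𝒞 = 0) ↔
      ((i : ℕ) : ℤ) ^ 2 ∣ c * z.1 ^ 4 + eval z.2 𝒞 := by
    intro i
    have h6 : ∀ t : ℤ, ZMod.prodEquivPi a ha (t : ZMod (∏ i, a i)) i = (t : ZMod (a i)) := by
      intro t
      rw [map_intCast]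
      rfl
    simp only [h6]
    rw [← cast_quartic_add_eval, ZMod.intCast_zmod_eq_zero_iff_dvd]
    simp only [a]
    push_cast
    rfl
  constructor
  · intro h i h7
    exact h i.1 i.2 ((h5 i).1 h7)
  · intro h p hp h7
    exact h ⟨p, hp⟩ ((h5 ⟨p, hp⟩).2 h7)

/-- The primes up to `N`. -/
def primesUpTo (N : ℕ) : Finset Nat.Primes := (Finset.range (N + 1)).subtype Nat.Prime

theorem mem_primesUpTo {N : ℕ} {p : Nat.Primes} : p ∈ primesUpTo N ↔ (p : ℕ) ≤ N :=
  (Finset.mem_subtype (p := Nat.Prime)).trans (Finset.mem_range.trans Nat.lt_succ_iff)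

theorem prod_primesUpTo_sq_le (N : ℕ) : ∏ p ∈ primesUpTo N, (p : ℕ) ^ 2 ≤ 16 ^ N := by
  have h : ∏ p ∈ primesUpTo N, (p : ℕ) ^ 2 = primorial N ^ 2 := by
    rw [Finset.prod_pow, primorial, primesUpTo]
    congr 1
    exact Finset.prod_subtype_eq_prod_filter (s := Finset.range (N + 1)) (fun p => p)
  rw [h, show 16 = 4 ^ 2 by norm_num, ← pow_mul, mul_comm, pow_mul]
  exact Nat.pow_le_pow_left (primorial_le_four_pow N) 2

/-- The local density of zeros modulo `p²`. -/
noncomputable def localDensity (c : ℤ) (𝒞 : MvPolynomial (Fin n) ℤ) (p : Nat.Primes) : ℝ :=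
  (zeroCount c 𝒞 ((p : ℕ) ^ 2) : ℝ) / ((p : ℕ) : ℝ) ^ (2 * (n + 1))

theorem localDensity_nonneg (c : ℤ) (𝒞 : MvPolynomial (Fin n) ℤ) (p : Nat.Primes) :
    0 ≤ localDensity c 𝒞 p := by
  unfold localDensity; positivity

theorem localDensity_le_one (c : ℤ) (𝒞 : MvPolynomial (Fin n) ℤ) (p : Nat.Primes) :
    localDensity c 𝒞 p ≤ 1 := by
  have : NeZero ((p : ℕ) ^ 2) := ⟨pow_ne_zero 2 p.2.ne_zero⟩
  refine div_le_one_of_le₀ ?_ (by positivity)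
  rw [pow_mul]
  exact_mod_cast zeroCount_le c 𝒞 ((p : ℕ) ^ 2)

/-- Truncating the singular series at `N` costs `O(1 / (N log N))`. -/
theorem exists_abs_prod_sub_singularSeries_le (𝒞 : MvPolynomial (Fin n) ℤ)
    (h𝒞 : 𝒞.IsHomogeneous 3)
    (hdeg : ¬ ∃ (a : ℚ) (b : Fin n → ℚ), MvPolynomial.map (Int.castRingHom ℚ) 𝒞 =
        MvPolynomial.C a * (∑ i, MvPolynomial.C (b i) * MvPolynomial.X i) ^ 3)
    {c : ℤ} (hc : c ≠ 0) :
    ∃ K : ℝ, 0 < K ∧ ∀ N : ℕ, 2 ≤ N →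
      |∏ p ∈ primesUpTo N, (1 - localDensity c 𝒞 p) - ∏' p, (1 - localDensity c 𝒞 p)| ≤
        K / (N * Real.log N) := by
  classical
  obtain ⟨K, hK, h⟩ := exists_zeroCount_le 𝒞 h𝒞 hdeg hc
  have h' : ∀ p : Nat.Primes, localDensity c 𝒞 p ≤ K * (1 / ((p : ℕ) : ℝ) ^ 2) :=
    fun p => h p p.2
  have hs : Summable (localDensity c 𝒞) := by
    refine Summable.of_nonneg_of_le (localDensity_nonneg c 𝒞) h' (Summable.mul_left K ?_)
    exact (Real.summable_one_div_nat_pow.2 one_lt_two).comp_injective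
      Nat.Primes.coe_nat_injective
  refine ⟨K * 20, by positivity, fun N hN => ?_⟩
  refine abs_prod_sub_tprod_le _ (localDensity_nonneg c 𝒞) (localDensity_le_one c 𝒞) hs _ ?_
  intro T hT
  calc ∑ p ∈ T, localDensity c 𝒞 p ≤ ∑ p ∈ T, K * (1 / ((p : ℕ) : ℝ) ^ 2) :=
        Finset.sum_le_sum fun p _ => h' p
    _ = K * ∑ p ∈ T.map (⟨fun p => p, Nat.Primes.coe_nat_injective⟩ : Nat.Primes ↪ ℕ), (1 / (p : ℝ) ^ 2) := by
        rw [← Finset.mul_sum, Finset.sum_map]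
        rfl
    _ ≤ K * (20 / (N * Real.log N)) := by
        refine mul_le_mul_of_nonneg_left (sum_primes_inv_sq_le hN _ ?_) hK.le
        intro p hp
        obtain ⟨q, hq, rfl⟩ := Finset.mem_map.1 hp
        refine ⟨q.2, ?_⟩
        have := Finset.disjoint_left.1 hT hq
        rw [mem_primesUpTo] at this
        exact not_le.1 this
    _ = _ := by ring

theorem exists_prime_sq_dvd_of_not_squarefree {a : ℤ} (h : ¬ Squarefree a) :
    ∃ p : ℕ, p.Prime ∧ (p : ℤ) ^ 2 ∣ a := by
  rw [← Int.squarefree_natAbs, Nat.squarefree_iff_prime_squarefree] at h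
  push Not at h
  obtain ⟨p, hp, hpa⟩ := h
  refine ⟨p, hp, ?_⟩
  rw [← pow_two, ← Int.natCast_dvd_natCast, Int.dvd_natAbs] at hpa
  exact_mod_cast hpa

theorem not_sq_dvd_of_squarefree {a : ℤ} (h : Squarefree a) {p : ℕ} (hp : p.Prime) :
    ¬ (p : ℤ) ^ 2 ∣ a := by
  intro hpa
  rw [pow_two] at hpa
  have := Int.isUnit_iff_natAbs_eq.1 (h _ hpa)
  rw [Int.natAbs_natCast] at this
  exact hp.one_lt.ne' this

open Classical in
/-- The sieve inequality: sifted points that are not squarefree are divisible by the square of a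
medium or a large prime. -/
theorem card_sifted_le_card_squarefree_add {τ : Type*} (B : Finset τ) (F : τ → ℤ) {N U : ℕ}
    (hN : 2 ≤ N) :
    Finset.card {z ∈ B | ∀ p ∈ primesUpTo N, ¬ ((p : ℕ) : ℤ) ^ 2 ∣ F z} ≤
      Finset.card {z ∈ B | Squarefree (F z)} +
      ∑ p ∈ Finset.range (U ^ 7 + 1) with p.Prime ∧ N < p ∧ p ^ 8 ≤ U ^ 7,
        Finset.card {z ∈ B | (p : ℤ) ^ 2 ∣ F z} +
      Finset.card {z ∈ B | F z ≠ 0 ∧ ∃ p : ℕ, p.Prime ∧ U ^ 7 < p ^ 8 ∧ (p : ℤ) ^ 2 ∣ F z} := by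
  classical
  set T := (Finset.range (U ^ 7 + 1)).filter fun p => p.Prime ∧ N < p ∧ p ^ 8 ≤ U ^ 7
  have hsub : B.filter (fun z => ∀ p ∈ primesUpTo N, ¬ ((p : ℕ) : ℤ) ^ 2 ∣ F z) ⊆
      B.filter (fun z => Squarefree (F z)) ∪
      T.biUnion (fun p => B.filter fun z => (p : ℤ) ^ 2 ∣ F z) ∪
      B.filter (fun z => F z ≠ 0 ∧ ∃ p : ℕ, p.Prime ∧ U ^ 7 < p ^ 8 ∧ (p : ℤ) ^ 2 ∣ F z) := by
    intro z hz
    obtain ⟨hzB, hz⟩ := Finset.mem_filter.1 hz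
    have h0 : F z ≠ 0 := by
      intro h0
      exact hz ⟨2, Nat.prime_two⟩ (mem_primesUpTo.2 hN) (h0 ▸ dvd_zero _)
    by_cases hsq : Squarefree (F z)
    · exact Finset.mem_union_left _ (Finset.mem_union_left _ (Finset.mem_filter.2 ⟨hzB, hsq⟩))
    obtain ⟨p, hp, hpz⟩ := exists_prime_sq_dvd_of_not_squarefree hsq
    have hpN : N < p := by
      by_contra h
      exact hz ⟨p, hp⟩ (mem_primesUpTo.2 (not_lt.1 h)) hpz
    rcases le_or_gt (p ^ 8) (U ^ 7) with h | h
    · refine Finset.mem_union_left _ (Finset.mem_union_right _ (Finset.mem_biUnion.2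
        ⟨p, Finset.mem_filter.2 ⟨Finset.mem_range.2 ?_, hp, hpN, h⟩,
          Finset.mem_filter.2 ⟨hzB, hpz⟩⟩))
      have := Nat.le_self_pow (n := 8) (by norm_num) p
      omega
    · exact Finset.mem_union_right _ (Finset.mem_filter.2 ⟨hzB, h0, p, hp, h, hpz⟩)
  refine (Finset.card_le_card hsub).trans ((Finset.card_union_le _ _).trans ?_)
  gcongr
  refine (Finset.card_union_le _ _).trans ?_
  gcongr
  exact Finset.card_biUnion_le

open Classical in
theorem card_squarefree_le_card_sifted {τ : Type*} (B : Finset τ) (F : τ → ℤ) (N : ℕ) :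
    Finset.card {z ∈ B | Squarefree (F z)} ≤
      Finset.card {z ∈ B | ∀ p ∈ primesUpTo N, ¬ ((p : ℕ) : ℤ) ^ 2 ∣ F z} := by
  classical
  refine Finset.card_le_card fun z hz => ?_
  obtain ⟨hzB, hz⟩ := Finset.mem_filter.1 hz
  exact Finset.mem_filter.2 ⟨hzB, fun p _ => not_sq_dvd_of_squarefree hz p.2⟩

theorem le_two_mul_floor {x : ℝ} (hx : 1 ≤ x) : x ≤ 2 * ⌊x⌋₊ := by
  have h1 := Nat.lt_floor_add_one x
  have h2 : (1 : ℝ) ≤ ⌊x⌋₊ := by exact_mod_cast Nat.floor_pos.2 hx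
  linarith

theorem floor_le_four_mul_floor_sq {P : ℝ} (hP : 1 ≤ P) :
    ⌊P⌋₊ ≤ 4 * ⌊P ^ (3 / 4 : ℝ)⌋₊ ^ 2 := by
  have h1 := Nat.floor_le (show (0 : ℝ) ≤ P by linarith)
  have h2 := le_two_mul_floor (Real.one_le_rpow hP (by norm_num : (0 : ℝ) ≤ 3 / 4))
  have h3 : P ≤ (P ^ (3 / 4 : ℝ)) ^ 2 := by
    rw [← Real.rpow_natCast, ← Real.rpow_mul (by linarith)]
    exact Real.self_le_rpow_of_one_le hP (by norm_num)
  have h4 : (0 : ℝ) ≤ P ^ (3 / 4 : ℝ) := Real.rpow_nonneg (by linarith) _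
  have h5 : (⌊P⌋₊ : ℝ) ≤ (4 * ⌊P ^ (3 / 4 : ℝ)⌋₊ ^ 2 : ℕ) := by
    push_cast
    nlinarith
  exact_mod_cast h5

theorem floor_pow_four_le {P : ℝ} (hP : 1 ≤ P) :
    ⌊P ^ (3 / 4 : ℝ)⌋₊ ^ 4 ≤ (⌊P⌋₊ + 1) ^ 3 := by
  have h1 := Nat.lt_floor_add_one P
  have h4 : (0 : ℝ) ≤ P ^ (3 / 4 : ℝ) := Real.rpow_nonneg (by linarith) _
  have h2 := Nat.floor_le h4
  have h3 : (P ^ (3 / 4 : ℝ)) ^ 4 = P ^ 3 := by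
    rw [← Real.rpow_natCast, ← Real.rpow_mul (by linarith), ← Real.rpow_natCast]
    norm_num
  have h5 : ((⌊P ^ (3 / 4 : ℝ)⌋₊ ^ 4 : ℕ) : ℝ) ≤ ((⌊P⌋₊ + 1) ^ 3 : ℕ) := by
    push_cast
    calc _ ≤ (P ^ (3 / 4 : ℝ)) ^ 4 := by gcongr
      _ = P ^ 3 := h3
      _ ≤ _ := by gcongr
  exact_mod_cast h5

/-- The contribution of medium primes. -/
theorem exists_sum_medium_le (𝒞 : MvPolynomial (Fin n) ℤ) (h𝒞 : 𝒞.IsHomogeneous 3)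
    (hdeg : ¬ ∃ (a : ℚ) (b : Fin n → ℚ), MvPolynomial.map (Int.castRingHom ℚ) 𝒞 =
        MvPolynomial.C a * (∑ i, MvPolynomial.C (b i) * MvPolynomial.X i) ^ 3)
    {c : ℤ} (hc : c ≠ 0) :
    ∃ (K : ℝ) (N₀ : ℕ), 0 < K ∧ ∀ (P : ℝ) (N : ℕ), 1 ≤ P → 2 ≤ N → N₀ ≤ N →
      ∑ p ∈ Finset.range (⌊P⌋₊ ^ 7 + 1) with p.Prime ∧ N < p ∧ p ^ 8 ≤ ⌊P⌋₊ ^ 7,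
        (Finset.card {z ∈ pointBox n (P ^ (3 / 4 : ℝ)) P |
          (p : ℤ) ^ 2 ∣ c * z.1 ^ 4 + eval z.2 𝒞} : ℝ) ≤
      K * (P ^ (3 / 4 : ℝ) * P ^ n) * (1 / (N * Real.log N) + P ^ (-(1 / 64) : ℝ)) := by
  obtain ⟨K, N₀, hK, h⟩ := exists_card_sq_dvd_le 𝒞 h𝒞 hdeg hc
  refine ⟨20 * K, N₀, by positivity, fun P N hP hN hN₀ => ?_⟩
  set U := ⌊P⌋₊ with hU
  set Q := P ^ (3 / 4 : ℝ) with hQ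
  have hQ1 : 1 ≤ Q := Real.one_le_rpow hP (by norm_num)
  have hU1 : 1 ≤ U := Nat.floor_pos.2 hP
  have hUR : (1 : ℝ) ≤ U := by exact_mod_cast hU1
  have hUP : (U : ℝ) ≤ P := Nat.floor_le (by linarith)
  have hXQ : (⌊Q⌋₊ : ℝ) ≤ Q := Nat.floor_le (by linarith)
  set T := (Finset.range (U ^ 7 + 1)).filter fun p => p.Prime ∧ N < p ∧ p ^ 8 ≤ U ^ 7 with hT
  have hTcard : (T.card : ℝ) ≤ (U : ℝ) ^ (7 / 8 : ℝ) := by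
    have h1 : T ⊆ Finset.Icc 1 ⌊(U : ℝ) ^ (7 / 8 : ℝ)⌋₊ := by
      intro p hp
      obtain ⟨-, h1, -, h2⟩ := Finset.mem_filter.1 hp
      refine Finset.mem_Icc.2 ⟨h1.one_lt.le, Nat.le_floor ?_⟩
      have h3 : (p : ℝ) ^ 8 ≤ (U : ℝ) ^ 7 := by exact_mod_cast h2
      calc (p : ℝ) = ((p : ℝ) ^ 8) ^ (1 / 8 : ℝ) := by
            rw [← Real.rpow_natCast, ← Real.rpow_mul (by positivity)]
            norm_num
        _ ≤ ((U : ℝ) ^ 7) ^ (1 / 8 : ℝ) := by gcongr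
        _ = _ := by
            rw [← Real.rpow_natCast, ← Real.rpow_mul (by positivity)]
            norm_num
    calc (T.card : ℝ) ≤ (Finset.Icc 1 ⌊(U : ℝ) ^ (7 / 8 : ℝ)⌋₊).card :=
          Nat.cast_le.2 (Finset.card_le_card h1)
      _ ≤ _ := by
          rw [Nat.card_Icc, Nat.add_sub_cancel]
          exact Nat.floor_le (by positivity)
  have htail := sum_primes_inv_sq_le hN T fun p hp => by
    obtain ⟨-, h1, h2, -⟩ := Finset.mem_filter.1 hp
    exact ⟨h1, h2⟩
  have hpow : (U : ℝ) ^ (7 / 8 : ℝ) ≤ 2 * (U * P ^ (-(1 / 64) : ℝ)) := by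
    have h1 : P ≤ 2 * U := le_two_mul_floor hP
    calc (U : ℝ) ^ (7 / 8 : ℝ) ≤ P ^ (7 / 8 : ℝ) := by gcongr
      _ = P * P ^ (-(1 / 8) : ℝ) := by
          rw [← Real.rpow_one_add' (by linarith) (by norm_num)]
          norm_num
      _ ≤ (2 * U) * P ^ (-(1 / 64) : ℝ) := by
          gcongr
          norm_num
      _ = _ := by ring
  have hsum : (∑ p ∈ T, (Finset.card {z ∈ pointBox n Q P |
          (p : ℤ) ^ 2 ∣ c * z.1 ^ 4 + eval z.2 𝒞} : ℝ)) * U ≤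
      K * (U : ℝ) ^ n * ⌊Q⌋₊ * (U * (20 / (N * Real.log N)) + (U : ℝ) ^ (7 / 8 : ℝ)) := by
    calc _ = ∑ p ∈ T, (Finset.card {z ∈ pointBox n Q P |
          (p : ℤ) ^ 2 ∣ c * z.1 ^ 4 + eval z.2 𝒞} : ℝ) * U := Finset.sum_mul _ _ _
      _ ≤ ∑ p ∈ T, K * (U : ℝ) ^ n * (⌊Q⌋₊ * U / (p : ℝ) ^ 2 + ⌊Q⌋₊) := by
          refine Finset.sum_le_sum fun p hp => ?_
          obtain ⟨-, h1, h2, -⟩ := Finset.mem_filter.1 hp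
          exact h ⌊Q⌋₊ U p (Nat.floor_pos.2 hQ1) hU1 (floor_le_four_mul_floor_sq hP) h1
            (by omega) _ (Finset.filter_subset _ _) fun z hz => (Finset.mem_filter.1 hz).2
      _ = K * (U : ℝ) ^ n * ⌊Q⌋₊ * (U * ∑ p ∈ T, (1 / (p : ℝ) ^ 2) + T.card) := by
          rw [← Finset.mul_sum, Finset.sum_add_distrib, Finset.sum_const, nsmul_eq_mul,
            mul_assoc (K * (U : ℝ) ^ n), mul_add (⌊Q⌋₊ : ℝ), Finset.mul_sum, Finset.mul_sum]
          congr 2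
          · exact Finset.sum_congr rfl fun p _ => by ring
          · ring
      _ ≤ _ := by gcongr
  have hlog : 0 ≤ Real.log N := Real.log_natCast_nonneg N
  have hfin : (∑ p ∈ T, (Finset.card {z ∈ pointBox n Q P |
          (p : ℤ) ^ 2 ∣ c * z.1 ^ 4 + eval z.2 𝒞} : ℝ)) * U ≤
      (20 * K * (Q * P ^ n) * (1 / (N * Real.log N) + P ^ (-(1 / 64) : ℝ))) * U := by
    refine hsum.trans ?_
    have hPp : 0 ≤ P ^ (-(1 / 64) : ℝ) := Real.rpow_nonneg (by linarith) _
    calc _ ≤ K * P ^ n * Q * (U * (20 / (N * Real.log N)) + 20 * (U * P ^ (-(1 / 64) : ℝ))) := by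
          gcongr
          refine hpow.trans ?_
          gcongr
          norm_num
      _ = _ := by ring
  exact le_of_mul_le_mul_right hfin (by linarith)

open Classical in
/-- The contribution of large primes. -/
theorem exists_card_large_le (𝒞 : MvPolynomial (Fin n) ℤ) (h𝒞 : 𝒞.IsHomogeneous 3)
    (hdeg : ¬ ∃ (a : ℚ) (b : Fin n → ℚ), MvPolynomial.map (Int.castRingHom ℚ) 𝒞 =
        MvPolynomial.C a * (∑ i, MvPolynomial.C (b i) * MvPolynomial.X i) ^ 3)
    {c : ℤ} (hc : c ≠ 0) :
    ∃ K : ℝ, 0 < K ∧ ∀ P : ℝ, 1 ≤ P →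
      (Finset.card {z ∈ pointBox n (P ^ (3 / 4 : ℝ)) P | c * z.1 ^ 4 + eval z.2 𝒞 ≠ 0 ∧
        ∃ p : ℕ, p.Prime ∧ ⌊P⌋₊ ^ 7 < p ^ 8 ∧ (p : ℤ) ^ 2 ∣ c * z.1 ^ 4 + eval z.2 𝒞} : ℝ) ≤
      K * (P ^ (3 / 4 : ℝ) * P ^ n) * P ^ (-(1 / 64) : ℝ) := by
  obtain ⟨K, hK, h⟩ := exists_card_large_sq_dvd_le 𝒞 h𝒞 hdeg hc
  refine ⟨K, hK, fun P hP => ?_⟩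
  have hU1 : 1 ≤ ⌊P⌋₊ := Nat.floor_pos.2 hP
  have hU0 : (0 : ℝ) < ⌊P⌋₊ := by exact_mod_cast hU1
  have hUP : (⌊P⌋₊ : ℝ) ≤ P := Nat.floor_le (by linarith)
  have h1 := h ⌊P ^ (3 / 4 : ℝ)⌋₊ ⌊P⌋₊ hU1 (floor_pow_four_le hP) _ (Finset.filter_subset _ _)
    fun z hz => (Finset.mem_filter.1 hz).2
  have h2 : (⌊P⌋₊ : ℝ) ^ (175 / 64 : ℝ) = (⌊P⌋₊ : ℝ) ^ (47 / 64 : ℝ) * (⌊P⌋₊ : ℝ) ^ 2 := by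
    rw [← Real.rpow_add_natCast hU0.ne']
    norm_num
  rw [h2, ← mul_assoc] at h1
  refine (le_of_mul_le_mul_right h1 (by positivity)).trans ?_
  have h3 : P ^ (3 / 4 : ℝ) * P ^ (-(1 / 64) : ℝ) = P ^ (47 / 64 : ℝ) := by
    rw [← Real.rpow_add (by linarith)]
    norm_num
  calc K * (⌊P⌋₊ : ℝ) ^ n * (⌊P⌋₊ : ℝ) ^ (47 / 64 : ℝ) ≤ K * P ^ n * P ^ (47 / 64 : ℝ) := by gcongr
    _ = _ := by rw [← h3]; ring

theorem sieve_level_bounds {P : ℝ} {N₀ : ℕ} (hP : Real.exp (256 + 16 * N₀) ≤ P) :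
    2 ≤ ⌊Real.log P / 8⌋₊ ∧ N₀ ≤ ⌊Real.log P / 8⌋₊ ∧
    ((16 ^ ⌊Real.log P / 8⌋₊ : ℕ) : ℝ) ≤ P ^ (1 / 2 : ℝ) ∧
    1 / (⌊Real.log P / 8⌋₊ * Real.log ⌊Real.log P / 8⌋₊) ≤
      32 * (1 / (Real.log P * Real.log (Real.log P))) ∧
    P ^ (-(1 / 64) : ℝ) ≤ 128 ^ 2 * (1 / (Real.log P * Real.log (Real.log P))) := by
  have hP0 : 0 < P := (Real.exp_pos _).trans_le hP
  set L := Real.log P with hL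
  have hN₀ : (0 : ℝ) ≤ N₀ := Nat.cast_nonneg _
  have hLb : 256 + 16 * (N₀ : ℝ) ≤ L := (Real.le_log_iff_exp_le hP0).2 hP
  set N := ⌊L / 8⌋₊ with hN
  have hNL : (N : ℝ) ≤ L / 8 := Nat.floor_le (by linarith)
  have hLN : L / 8 ≤ 2 * N := le_two_mul_floor (by linarith)
  have hL0 : 0 ≤ L := by linarith
  have hlogL : 0 < Real.log L := Real.log_pos (by linarith)
  have hsqrt : 16 ≤ √L := Real.le_sqrt_of_sq_le (by norm_num; linarith)
  have hss : √L * √L = L := Real.mul_self_sqrt (by linarith)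
  have hNs : √L ≤ N := by nlinarith
  have hlogN : Real.log L / 2 ≤ Real.log N := by
    rw [← Real.log_sqrt (by linarith)]
    exact Real.log_le_log (by linarith) hNs
  refine ⟨?_, ?_, ?_, ?_, ?_⟩
  · have : ((2 : ℕ) : ℝ) ≤ N := by push_cast; linarith
    exact_mod_cast this
  · have : (N₀ : ℝ) ≤ N := by linarith
    exact_mod_cast this
  · have h16 : Real.log 16 ≤ 4 := by
      rw [show (16 : ℝ) = 2 ^ 4 by norm_num, Real.log_pow]
      push_cast
      linarith [Real.log_two_lt_d9]
    push_cast
    rw [← Real.rpow_natCast, Real.rpow_def_of_pos (by norm_num), Real.rpow_def_of_pos hP0]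
    refine Real.exp_le_exp.2 ?_
    calc Real.log 16 * N ≤ 4 * (L / 8) := by gcongr
      _ = _ := by rw [← hL]; ring
  · have hpos : 0 < L * Real.log L := mul_pos (by linarith) hlogL
    have h1 : L * Real.log L / 32 ≤ N * Real.log N := by
      calc L * Real.log L / 32 = (L / 16) * (Real.log L / 2) := by ring
        _ ≤ _ := by
          gcongr
          linarith
    calc _ ≤ 1 / (L * Real.log L / 32) := one_div_le_one_div_of_le (by positivity) h1
      _ = _ := by field_simp
  · have hpos : 0 < L * Real.log L := mul_pos (by linarith) hlogL
    have h1 : L ≤ 128 * P ^ (1 / 128 : ℝ) := by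
      have := Real.log_le_rpow_div hP0.le (ε := 1 / 128) (by norm_num)
      rw [← hL] at this
      linarith
    have h2 : Real.log L ≤ L := Real.log_le_self (by linarith)
    have h3 : P ^ (-(1 / 64) : ℝ) * (P ^ (1 / 128 : ℝ)) ^ 2 = 1 := by
      rw [← Real.rpow_natCast, ← Real.rpow_mul hP0.le, ← Real.rpow_add hP0]
      norm_num
    have h4 : 0 < P ^ (-(1 / 64) : ℝ) := Real.rpow_pos_of_pos hP0 _
    rw [mul_one_div, le_div_iff₀ hpos]
    calc P ^ (-(1 / 64) : ℝ) * (L * Real.log L) ≤ P ^ (-(1 / 64) : ℝ) * (L * L) := by gcongr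
      _ ≤ P ^ (-(1 / 64) : ℝ) * ((128 * P ^ (1 / 128 : ℝ)) * (128 * P ^ (1 / 128 : ℝ))) := by
          gcongr
      _ = 128 ^ 2 * (P ^ (-(1 / 64) : ℝ) * (P ^ (1 / 128 : ℝ)) ^ 2) := by ring
      _ = _ := by rw [h3, mul_one]

open Classical in
/-- The asymptotic formula for large `P`. -/
theorem exists_abs_card_squarefree_sub_le (𝒞 : MvPolynomial (Fin n) ℤ)
    (h𝒞 : 𝒞.IsHomogeneous 3)
    (hdeg : ¬ ∃ (a : ℚ) (b : Fin n → ℚ), MvPolynomial.map (Int.castRingHom ℚ) 𝒞 =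
        MvPolynomial.C a * (∑ i, MvPolynomial.C (b i) * MvPolynomial.X i) ^ 3)
    {c : ℤ} (hc : c ≠ 0) :
    ∃ K P₀ : ℝ, 0 < K ∧ 3 ≤ P₀ ∧ ∀ P : ℝ, P₀ ≤ P →
      |(Finset.card {z ∈ pointBox n (P ^ (3 / 4 : ℝ)) P |
          Squarefree (c * z.1 ^ 4 + eval z.2 𝒞)} : ℝ) -
        2 ^ (n + 1) * (P ^ (3 / 4 : ℝ) * P ^ n) * ∏' p, (1 - localDensity c 𝒞 p)| ≤
      K * (P ^ (3 / 4 : ℝ) * P ^ n) * (1 / (Real.log P * Real.log (Real.log P))) := by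
  obtain ⟨K₁, N₀, hK₁, hmed⟩ := exists_sum_medium_le 𝒞 h𝒞 hdeg hc
  obtain ⟨K₂, hK₂, hlarge⟩ := exists_card_large_le 𝒞 h𝒞 hdeg hc
  obtain ⟨K₃, hK₃, hser⟩ := exists_abs_prod_sub_singularSeries_le 𝒞 h𝒞 hdeg hc
  refine ⟨(K₁ + 2 ^ (n + 1) * K₃) * 32 + (K₁ + K₂ + 4 ^ (n + 1)) * 128 ^ 2,
    Real.exp (256 + 16 * N₀), by positivity, ?_, fun P hP => ?_⟩
  · have h1 := Real.add_one_le_exp (256 + 16 * (N₀ : ℝ))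
    have h2 : (0 : ℝ) ≤ N₀ := Nat.cast_nonneg _
    linarith
  obtain ⟨hN2, hNN, h16, hNlog, hPpow⟩ := sieve_level_bounds hP
  have hP1 : 1 ≤ P := (Real.one_le_exp (by positivity)).trans hP
  have hP0 : 0 < P := by linarith
  set N := ⌊Real.log P / 8⌋₊ with hN
  set Q := P ^ (3 / 4 : ℝ) with hQ
  set W := 1 / (Real.log P * Real.log (Real.log P)) with hW
  set R := P ^ (-(1 / 64) : ℝ) with hR
  set V := 1 / (N * Real.log N) with hV
  have hQ0 : 0 < Q := Real.rpow_pos_of_pos hP0 _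
  set M := Q * P ^ n with hM
  have hM0 : 0 < M := by positivity
  have hQP : Q ≤ P := Real.rpow_le_self_of_one_le hP1 (by norm_num)
  have hm : ((∏ p ∈ primesUpTo N, (p : ℕ) ^ 2 : ℕ) : ℝ) ≤ P ^ (1 / 2 : ℝ) :=
    (Nat.cast_le.2 (prod_primesUpTo_sq_le N)).trans h16
  have hmQ : ((∏ p ∈ primesUpTo N, (p : ℕ) ^ 2 : ℕ) : ℝ) ≤ Q :=
    hm.trans (Real.rpow_le_rpow_of_exponent_le hP1 (by norm_num))
  have hsift := abs_card_sifted_sub_le c 𝒞 (primesUpTo N) hmQ hQP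
  have hmR : ((∏ p ∈ primesUpTo N, (p : ℕ) ^ 2 : ℕ) : ℝ) * P ^ n ≤ M * R := by
    have h1 : P ^ (1 / 2 : ℝ) ≤ Q * R := by
      rw [hQ, hR, ← Real.rpow_add hP0]
      exact Real.rpow_le_rpow_of_exponent_le hP1 (by norm_num)
    calc _ ≤ P ^ (1 / 2 : ℝ) * P ^ n := by gcongr
      _ ≤ Q * R * P ^ n := by gcongr
      _ = _ := by rw [hM]; ring
  have hser' := hser N hN2
  have hV' : K₃ / (N * Real.log N) = K₃ * V := by rw [hV, mul_one_div]
  rw [hV'] at hser'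
  have hlo := card_squarefree_le_card_sifted (pointBox n Q P)
    (fun z => c * z.1 ^ 4 + eval z.2 𝒞) N
  have hup := card_sifted_le_card_squarefree_add (U := ⌊P⌋₊) (pointBox n Q P)
    (fun z => c * z.1 ^ 4 + eval z.2 𝒞) hN2
  have hlo' := Nat.cast_le (α := ℝ) |>.2 hlo
  have hup' := Nat.cast_le (α := ℝ) |>.2 hup
  push_cast at hup'
  have hmed' := hmed P N hP1 hN2 hNN
  have hlarge' := hlarge P hP1
  change |_ - 2 ^ (n + 1) * M * ∏ p ∈ primesUpTo N, (1 - localDensity c 𝒞 p)| ≤ _ at hsift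
  set A : ℝ := (Finset.card {z ∈ pointBox n Q P |
    Squarefree (c * z.1 ^ 4 + eval z.2 𝒞)} : ℝ) with hA
  set B : ℝ := (Finset.card {z ∈ pointBox n Q P |
    ∀ p ∈ primesUpTo N, ¬ ((p : ℕ) : ℤ) ^ 2 ∣ c * z.1 ^ 4 + eval z.2 𝒞} : ℝ) with hB
  have hAB : |A - B| ≤ K₁ * M * (V + R) + K₂ * M * R := by
    rw [abs_le]
    constructor <;> linarith
  set D := ∏ p ∈ primesUpTo N, (1 - localDensity c 𝒞 p)
  set E := ∏' p, (1 - localDensity c 𝒞 p)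
  calc |A - 2 ^ (n + 1) * M * E| = |(A - B) + (B - 2 ^ (n + 1) * M * D) +
        2 ^ (n + 1) * M * (D - E)| := by congr 1; ring
    _ ≤ |A - B| + |B - 2 ^ (n + 1) * M * D| + |2 ^ (n + 1) * M * (D - E)| := abs_add_three _ _ _
    _ = |A - B| + |B - 2 ^ (n + 1) * M * D| + 2 ^ (n + 1) * M * |D - E| := by
        rw [abs_mul, abs_of_pos (a := 2 ^ (n + 1) * M) (by positivity)]
    _ ≤ (K₁ * M * (V + R) + K₂ * M * R) + 4 ^ (n + 1) * (M * R) +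
        2 ^ (n + 1) * M * (K₃ * V) := by
        gcongr
        exact hsift.trans (by gcongr)
    _ = M * ((K₁ + 2 ^ (n + 1) * K₃) * V + (K₁ + K₂ + 4 ^ (n + 1)) * R) := by ring
    _ ≤ M * ((K₁ + 2 ^ (n + 1) * K₃) * (32 * W) + (K₁ + K₂ + 4 ^ (n + 1)) * (128 ^ 2 * W)) := by
        gcongr
    _ = _ := by ring

theorem card_pointBox_le {Q P : ℝ} (hQ : 1 ≤ Q) (hP : 1 ≤ P) :
    ((pointBox n Q P).card : ℝ) ≤ 3 ^ (n + 1) * (Q * P ^ n) := by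
  have h : ∀ x : ℝ, 1 ≤ x → 2 * (⌊x⌋₊ : ℝ) + 1 ≤ 3 * x := fun x hx => by
    linarith [Nat.floor_le (show 0 ≤ x by linarith)]
  rw [pointBox, Finset.card_product, card_intBox, card_Icc_neg]
  push_cast
  calc _ ≤ (3 * Q) * (3 * P) ^ n := by
        gcongr
        · exact h Q hQ
        · exact h P hP
    _ = _ := by rw [mul_pow]; ring

theorem one_lt_log_of_three_le {P : ℝ} (hP : 3 ≤ P) : 1 < Real.log P := by
  rw [Real.lt_log_iff_exp_lt (by linarith)]
  linarith [Real.exp_one_lt_d9]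

open Classical in
/-- The asymptotic formula for `P ≥ 3`, over finite boxes. -/
theorem exists_abs_card_squarefree_sub_le_of_three_le (𝒞 : MvPolynomial (Fin n) ℤ)
    (h𝒞 : 𝒞.IsHomogeneous 3)
    (hdeg : ¬ ∃ (a : ℚ) (b : Fin n → ℚ), MvPolynomial.map (Int.castRingHom ℚ) 𝒞 =
        MvPolynomial.C a * (∑ i, MvPolynomial.C (b i) * MvPolynomial.X i) ^ 3)
    {c : ℤ} (hc : c ≠ 0) :
    ∃ K : ℝ, ∀ P : ℝ, 3 ≤ P →
      |(Finset.card {z ∈ pointBox n (P ^ (3 / 4 : ℝ)) P |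
          Squarefree (c * z.1 ^ 4 + eval z.2 𝒞)} : ℝ) -
        2 ^ (n + 1) * (P ^ (3 / 4 : ℝ) * P ^ n) * ∏' p, (1 - localDensity c 𝒞 p)| ≤
      K * (P ^ (3 / 4 : ℝ) * P ^ n) * (1 / (Real.log P * Real.log (Real.log P))) := by
  obtain ⟨K, P₀, hK, hP₀, h⟩ := exists_abs_card_squarefree_sub_le 𝒞 h𝒞 hdeg hc
  set E := ∏' p, (1 - localDensity c 𝒞 p)
  have hl₀ : 0 < Real.log (Real.log P₀) := Real.log_pos (one_lt_log_of_three_le hP₀)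
  set Y := (3 ^ (n + 1) + 2 ^ (n + 1) * |E|) * (Real.log P₀ * Real.log (Real.log P₀))
  have hY : 0 ≤ Y := by
    have := one_lt_log_of_three_le hP₀
    positivity
  refine ⟨K + Y, fun P hP => ?_⟩
  have hP1 : 1 ≤ P := by linarith
  have hQ1 : 1 ≤ P ^ (3 / 4 : ℝ) := Real.one_le_rpow hP1 (by norm_num)
  set M := P ^ (3 / 4 : ℝ) * P ^ n with hM
  have hM0 : 0 < M := by positivity
  have hl1 := one_lt_log_of_three_le hP
  have hl2 : 0 < Real.log (Real.log P) := Real.log_pos hl1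
  have hW : 0 < Real.log P * Real.log (Real.log P) := by positivity
  rcases le_or_gt P₀ P with hPP | hPP
  · refine (h P hPP).trans ?_
    gcongr
    linarith
  · have h1 : (Finset.card {z ∈ pointBox n (P ^ (3 / 4 : ℝ)) P |
        Squarefree (c * z.1 ^ 4 + eval z.2 𝒞)} : ℝ) ≤ 3 ^ (n + 1) * M :=
      (Nat.cast_le.2 (Finset.card_filter_le _ _)).trans (card_pointBox_le hQ1 hP1)
    have h2 : Real.log P * Real.log (Real.log P) ≤ Real.log P₀ * Real.log (Real.log P₀) := by
      have h0 : 0 ≤ Real.log P₀ := zero_le_one.trans (one_lt_log_of_three_le hP₀).le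
      have h3 : Real.log P ≤ Real.log P₀ := Real.log_le_log (by linarith) hPP.le
      have h4 : Real.log (Real.log P) ≤ Real.log (Real.log P₀) :=
        Real.log_le_log (by linarith) h3
      gcongr
    calc _ ≤ 3 ^ (n + 1) * M + 2 ^ (n + 1) * M * |E| := by
          refine (abs_sub _ _).trans (add_le_add ?_ ?_)
          · rwa [Nat.abs_cast]
          · rw [abs_mul, abs_of_pos (a := 2 ^ (n + 1) * M) (by positivity)]
      _ = (3 ^ (n + 1) + 2 ^ (n + 1) * |E|) * M := by ring
      _ ≤ (3 ^ (n + 1) + 2 ^ (n + 1) * |E|) * M *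
          (Real.log P₀ * Real.log (Real.log P₀) * (1 / (Real.log P * Real.log (Real.log P)))) := by
          refine le_mul_of_one_le_right (by positivity) ?_
          rw [mul_one_div]
          exact (one_le_div hW).2 h2
      _ = Y * M * (1 / (Real.log P * Real.log (Real.log P))) := by ring
      _ ≤ _ := by
          gcongr
          linarith

open Classical in
theorem natCard_squarefree_eq (c : ℤ) (𝒞 : MvPolynomial (Fin n) ℤ) {Q P : ℝ} (hQ : 0 ≤ Q)
    (hP : 0 ≤ P) :
    Nat.card {x : ℤ × (Fin n → ℤ) // (|x.1| : ℝ) ≤ Q ∧ (∀ j, (|x.2 j| : ℝ) ≤ P) ∧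
      Squarefree (c * x.1 ^ 4 + eval x.2 𝒞)} =
    Finset.card {z ∈ pointBox n Q P | Squarefree (c * z.1 ^ 4 + eval z.2 𝒞)} := by
  have hfloor : ∀ (x : ℝ) (t : ℤ), 0 ≤ x → ((|t| : ℝ) ≤ x ↔ |t| ≤ (⌊x⌋₊ : ℤ)) := by
    intro x t hx
    have h1 : (|(t : ℝ)|) = (t.natAbs : ℝ) := by
      rw [Nat.cast_natAbs, Int.cast_abs]
    rw [h1, ← Nat.le_floor_iff hx, Int.abs_eq_natAbs, Nat.cast_le]
  refine Nat.subtype_card _ fun z => ?_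
  rw [Finset.mem_filter, pointBox, Finset.mem_product, Finset.mem_Icc, ← abs_le, mem_intBox,
    hfloor Q z.1 hQ, and_assoc]
  simp only [fun j => hfloor P (z.2 j) hP]

end Forms

end SquarefreeDensity

open MvPolynomial

/-- **Squarefree density of polynomials, Theorem 4 (case k = 4).**
For `s ≥ 3`, `c ≠ 0` and a non-degenerate integral cubic form `𝒞*` in `s-1` variables,
with `𝓟(x) = c x₁⁴ + 𝒞*(x₂,…,x_s)` and `Q = P^(3/4)`, the number of `x` with `|x₁| ≤ Q`,
`|x_j| ≤ P` and `𝓟(x)` squarefree is `2^s Q P^(s-1) 𝔖_𝓟 + O(Q P^(s-1) / (log P · log log P))`. -/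
theorem squarefree_density_thm4_quartic (s : ℕ) (hs : 3 ≤ s) (c : ℤ) (hc : c ≠ 0)
    (𝒞 : MvPolynomial (Fin (s - 1)) ℤ) (hhom : 𝒞.IsHomogeneous 3)
    (hdeg : ¬ ∃ (a : ℚ) (b : Fin (s - 1) → ℚ),
      MvPolynomial.map (Int.castRingHom ℚ) 𝒞 =
        MvPolynomial.C a * (∑ i, MvPolynomial.C (b i) * MvPolynomial.X i) ^ 3) :
    ∃ K : ℝ, ∀ P : ℝ, 3 ≤ P →
      |(Nat.card {x : ℤ × (Fin (s - 1) → ℤ) //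
            (|x.1| : ℝ) ≤ P ^ ((3 : ℝ) / 4) ∧ (∀ j, (|x.2 j| : ℝ) ≤ P) ∧
            Squarefree (c * x.1 ^ 4 + eval x.2 𝒞)} : ℝ) -
          2 ^ s * P ^ ((3 : ℝ) / 4) * P ^ (s - 1) *
            ∏' p : Nat.Primes,
              (1 - (Nat.card {y : ZMod ((p : ℕ) ^ 2) × (Fin (s - 1) → ZMod ((p : ℕ) ^ 2)) //
                  (c : ZMod ((p : ℕ) ^ 2)) * y.1 ^ 4 + aeval y.2 𝒞 = 0} : ℝ) /
                ((p : ℕ) : ℝ) ^ (2 * s))|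
        ≤ K * P ^ ((3 : ℝ) / 4) * P ^ (s - 1) / (Real.log P * Real.log (Real.log P)) := by
  obtain ⟨n, rfl⟩ : ∃ n, s = n + 1 := ⟨s - 1, by omega⟩
  obtain ⟨K, hK⟩ := SquarefreeDensity.exists_abs_card_squarefree_sub_le_of_three_le
    (n := n) 𝒞 hhom hdeg hc
  refine ⟨K, fun P hP => ?_⟩
  have h := hK P hP
  rw [← SquarefreeDensity.natCard_squarefree_eq (n := n) c 𝒞 (by positivity) (by linarith), mul_one_div,
    ← mul_assoc, ← mul_assoc] at h
  exact h
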